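/- For every ε > 0 there exists a homotopically non-trivial C¹ map from S^5 to S^3 with 3-dilation less than ε. (The class of such a map is the non-trivial element of π_5(S^3) ≅ ℤ/2, which is a suspension of a class in π_4(S^2).) -/

import Mathlib

/-!
Basic notions: the unit sphere `S^{d-1} ⊆ ℝ^d`, the norm `‖Λ^k A‖` of the induced map on
`k`-th exterior powers of a linear map between inner product spaces, and the `k`-dilation of a
`C¹` map between unit spheres.  A (`C¹`) map from `S^{d₁-1}` to `S^{d₂-1}` is represented by a
(`C¹`) ambient map `F : ℝ^{d₁} → ℝ^{d₂}` mapping the unit sphere into the unit sphere; its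
`k`-dilation only depends on the restriction of `F` to the sphere, since the derivative is
restricted to the tangent space of the sphere.
-/

open scoped RealInnerProductSpace
open Set

noncomputable section

abbrev EucA (d : ℕ) := EuclideanSpace ℝ (Fin d)

/-- The unit sphere `S^{d-1}` in `ℝ^d` (with the round metric induced from `ℝ^d`). -/
def usph (d : ℕ) : Set (EucA d) := Metric.sphere 0 1

/-- The operator norm `‖Λ^k A‖` of the induced map on `k`-th exterior powers (with their induced
inner products): the supremum, over orthonormal `k`-frames `v` of the domain, of the `k`-volume
`√ det (⟪A vᵢ, A vⱼ⟫)` of the image frame `A v₁, …, A v_k`. -/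
noncomputable def lamNorm {E F : Type*} [NormedAddCommGroup E] [InnerProductSpace ℝ E]
    [NormedAddCommGroup F] [InnerProductSpace ℝ F] (k : ℕ) (A : E →ₗ[ℝ] F) : ℝ :=
  ⨆ v : {v : Fin k → E // Orthonormal ℝ v},
    Real.sqrt (Matrix.of fun (i j : Fin k) => ⟪A (v.1 i), A (v.1 j)⟫).det

/-- The `k`-dilation of a map of the unit sphere `S^{d-1}` into an inner product space (e.g. into
`ℝ^{d₂}`, for a map to the sphere `S^{d₂-1}`), the map being given by an ambient map `F`: the
supremum over points `x` of the sphere of `‖Λ^k df_x‖`, where `df_x` is the derivative of `F` at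
`x` restricted to the tangent space `(ℝ∙x)ᗮ` of the sphere at `x`. -/
noncomputable def kDilation {d : ℕ} {F' : Type*} [NormedAddCommGroup F']
    [InnerProductSpace ℝ F'] (k : ℕ) (F : EucA d → F') : ℝ :=
  ⨆ x : usph d,
    lamNorm k ((fderiv ℝ F (x : EucA d)).toLinearMap ∘ₗ ((ℝ ∙ (x : EucA d))ᗮ).subtype)

/-- A free homotopy, through maps of the unit sphere `S^{d-1}` into `T`, between (the
restrictions to the sphere of) `f` and `g`: a map `H` on `[0,1] × S^{d-1}`, continuous there,
with values in `T`, starting at `f` and ending at `g`. -/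
def FreelyHomotopic {d : ℕ} {E : Type*} [NormedAddCommGroup E] (T : Set E)
    (f g : EucA d → E) : Prop :=
  ∃ H : ℝ → EucA d → E,
    ContinuousOn (fun q : ℝ × EucA d => H q.1 q.2) (Icc (0:ℝ) 1 ×ˢ usph d) ∧
    (∀ t ∈ Icc (0:ℝ) 1, MapsTo (H t) (usph d) T) ∧
    EqOn (H 0) f (usph d) ∧ EqOn (H 1) g (usph d)

/-- A based homotopy (rel the basepoint `x₀` of the sphere, with basepoint value `y₀`), through
maps of the unit sphere `S^{d-1}` into `T`, between `f` and `g`. -/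
def BasedHomotopic {d : ℕ} {E : Type*} [NormedAddCommGroup E] (T : Set E)
    (x₀ : EucA d) (y₀ : E) (f g : EucA d → E) : Prop :=
  ∃ H : ℝ → EucA d → E,
    ContinuousOn (fun q : ℝ × EucA d => H q.1 q.2) (Icc (0:ℝ) 1 ×ˢ usph d) ∧
    (∀ t ∈ Icc (0:ℝ) 1, MapsTo (H t) (usph d) T) ∧
    (∀ t ∈ Icc (0:ℝ) 1, H t x₀ = y₀) ∧
    EqOn (H 0) f (usph d) ∧ EqOn (H 1) g (usph d)

/-- A sphere-valued map is nullhomotopic if it is freely homotopic, through sphere maps, to a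
constant map; a map is homotopically non-trivial if it is not nullhomotopic. -/
def SphereNullhomotopic {d₁ d₂ : ℕ} (F : EucA d₁ → EucA d₂) : Prop :=
  ∃ y ∈ usph d₂, FreelyHomotopic (usph d₂) F (fun _ => y)

theorem four_dvd_finrank_of_quaternionic {V : Type*} [AddCommGroup V] [Module ℝ V]
    (i j : Module.End ℝ V) (hi : i * i = -1) (hj : j * j = -1) (hij : j * i = -(i * j)) :
    4 ∣ Module.finrank ℝ V := by
  let b : QuaternionAlgebra.Basis (Module.End ℝ V) (-1 : ℝ) 0 (-1) :=
    { i := i, j := j, k := i * j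
      i_mul_i := by rw [hi]; simp
      j_mul_j := by rw [hj]; simp
      i_mul_j := rfl
      j_mul_i := by rw [hij]; simp }
  let φ : Quaternion ℝ →ₐ[ℝ] Module.End ℝ V := b.liftHom
  let _ : Module (Quaternion ℝ) V := Module.compHom V φ.toRingHom
  have : IsScalarTower ℝ (Quaternion ℝ) V := ⟨fun r q v => by
    change φ (r • q) v = r • φ q v
    rw [map_smul]; rfl⟩
  rw [← Module.finrank_mul_finrank ℝ (Quaternion ℝ) V, Quaternion.finrank_eq_four]
  exact Dvd.intro _ rfl

/-- Two anticommuting skew injective operators whose squares add up to a scalar. -/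
theorem four_dvd_finrank_of_anticommuting {W : Type*} [NormedAddCommGroup W]
    [InnerProductSpace ℝ W] [FiniteDimensional ℝ W] (s m : Module.End ℝ W) (c : ℝ)
    (hs : ∀ x y, ⟪s x, y⟫ = -⟪x, s y⟫) (hm : ∀ x y, ⟪m x, y⟫ = -⟪x, m y⟫)
    (hs0 : ∀ x, s x = 0 → x = 0) (hm0 : ∀ x, m x = 0 → x = 0)
    (hsm : ∀ x, s (m x) = -m (s x)) (hc : ∀ x, s (s x) + m (m x) = c • x) :
    4 ∣ Module.finrank ℝ W := by
  classical
  have hT : (m * m).IsSymmetric := fun x y => by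
    simp [Module.End.mul_apply, hm]
  have hsum := hT.direct_sum_isInternal
  rw [← (LinearEquiv.ofBijective (DirectSum.coeLinearMap _) hsum).finrank_eq, Module.finrank_directSum]
  refine Finset.dvd_sum fun μ _ => ?_
  set K := Module.End.eigenspace (m * m) (μ : ℝ) with hK
  obtain ⟨v, hv, hv0⟩ := Submodule.exists_mem_ne_zero_of_ne_bot μ.2
  replace hv := Module.End.mem_eigenspace_iff.1 hv
  have hmem : ∀ x, x ∈ K ↔ m (m x) = (μ : ℝ) • x := fun x => by
    rw [hK, Module.End.mem_eigenspace_iff, Module.End.mul_apply]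
  have hneg : ∀ a : Module.End ℝ W, (∀ x y, ⟪a x, y⟫ = -⟪x, a y⟫) → (∀ x, a x = 0 → x = 0) →
      ∀ d : ℝ, a (a v) = d • v → d < 0 := by
    intro a ha ha0 d hd
    have h1 : 0 < ⟪a v, a v⟫ := real_inner_self_pos.2 fun h => hv0 (ha0 v h)
    rw [ha, hd, inner_smul_right] at h1
    have h2 : 0 < ⟪v, v⟫ := real_inner_self_pos.2 hv0
    nlinarith
  have hμ : (μ : ℝ) < 0 := hneg m hm hm0 _ hv
  have hν : c - (μ : ℝ) < 0 := hneg s hs hs0 _ (by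
    have := hc v
    rw [show m (m v) = (μ : ℝ) • v from hv] at this
    rw [sub_smul, ← this]; abel)
  have hmK : ∀ x ∈ K, m x ∈ K := fun x hx => by
    rw [hmem] at hx ⊢; rw [hx, map_smul]
  have hsK : ∀ x ∈ K, s x ∈ K := fun x hx => by
    rw [hmem] at hx ⊢
    have : s (m (m x)) = m (m (s x)) := by rw [hsm, hsm]; simp
    rw [← this, hx, map_smul]
  have hss : ∀ x ∈ K, s (s x) = (c - μ) • x := fun x hx => by
    rw [hmem] at hx
    have := hc x
    rw [hx] at this
    rw [sub_smul, ← this]; abel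
  set a := Real.sqrt (-(c - μ))
  set b := Real.sqrt (-(μ : ℝ))
  have ha : a * a = -(c - μ) := Real.mul_self_sqrt (by linarith)
  have hb : b * b = -μ := Real.mul_self_sqrt (by linarith)
  have ha0 : a ≠ 0 := fun h => by rw [h] at ha; linarith
  have hb0 : b ≠ 0 := fun h => by rw [h] at hb; linarith
  refine four_dvd_finrank_of_quaternionic (V := K) (a⁻¹ • s.restrict hsK) (b⁻¹ • m.restrict hmK)
    ?_ ?_ ?_
  · ext x
    have := hss x x.2
    simp only [Module.End.mul_apply, LinearMap.smul_apply, map_smul, LinearMap.coe_restrict_apply,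
      Submodule.coe_smul, this, smul_smul, LinearMap.neg_apply, Module.End.one_apply,
      Submodule.coe_neg]
    rw [show a⁻¹ * a⁻¹ * (c - μ) = -1 by field_simp; nlinarith, neg_one_smul]
  · ext x
    have := (hmem x).1 x.2
    simp only [Module.End.mul_apply, LinearMap.smul_apply, map_smul, LinearMap.coe_restrict_apply,
      Submodule.coe_smul, this, smul_smul, LinearMap.neg_apply, Module.End.one_apply,
      Submodule.coe_neg]
    rw [show b⁻¹ * b⁻¹ * (μ : ℝ) = -1 by field_simp; nlinarith, neg_one_smul]
  · ext x
    simp only [Module.End.mul_apply, LinearMap.smul_apply, map_smul, LinearMap.coe_restrict_apply,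
      Submodule.coe_smul, smul_smul, LinearMap.neg_apply, Submodule.coe_neg, hsm, smul_neg,
      neg_neg]
    rw [mul_comm]

section Parity

variable {E : Type*} [NormedAddCommGroup E] [InnerProductSpace ℝ E]

/-- Orthogonal complex structures on a real inner product space. -/
structure IsCS (J : E →L[ℝ] E) : Prop where
  sq : ∀ x, J (J x) = -x
  skew : ∀ x y, ⟪J x, y⟫ = -⟪x, J y⟫

/-- The dimension of the space on which `J₂ = -J₁`. -/
def par (J₁ J₂ : E →L[ℝ] E) : ℕ := Module.finrank ℝ (LinearMap.ker (J₁ + J₂).toLinearMap)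

theorem IsCS.norm_apply {J : E →L[ℝ] E} (h : IsCS J) (x : E) : ‖J x‖ = ‖x‖ := by
  have : ‖J x‖ ^ 2 = ‖x‖ ^ 2 := by
    rw [← real_inner_self_eq_norm_sq, h.skew, h.sq, inner_neg_right, neg_neg,
      real_inner_self_eq_norm_sq]
  exact (sq_eq_sq₀ (norm_nonneg _) (norm_nonneg _)).1 this

/-- The sum of the eigenspaces with eigenvalue in `A`. -/
def eigSum (T : E →L[ℝ] E) (A : Set ℝ) : Submodule ℝ E :=
  ⨆ μ : A, Module.End.eigenspace (T : Module.End ℝ E) (μ : ℝ)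

theorem eigSum_invariant (T a : E →L[ℝ] E) (A : Set ℝ) (h : ∀ x, a (T x) = T (a x)) {x : E}
    (hx : x ∈ eigSum T A) : a x ∈ eigSum T A := by
  have : eigSum T A ≤ (eigSum T A).comap (a : E →ₗ[ℝ] E) := by
    refine iSup_le fun μ y hy => ?_
    refine Submodule.mem_iSup_of_mem μ ?_
    rw [Module.End.mem_eigenspace_iff] at hy ⊢
    change T (a y) = _
    rw [← h, show T y = (μ : ℝ) • y from hy, map_smul]; rfl
  exact this hx

theorem eigSum_form {T : E →L[ℝ] E} (hT : (T : E →ₗ[ℝ] E).IsSymmetric) {A : Set ℝ} {x : E}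
    (hx : x ∈ eigSum T A) (r : ℝ) : ∃ f : A →₀ E,
      ⟪T x, x⟫ - r * ‖x‖ ^ 2 = f.sum fun μ v => ((μ : ℝ) - r) * ‖v‖ ^ 2 := by
  obtain ⟨f, hf, rfl⟩ := (Submodule.mem_iSup_iff_exists_finsupp _ _).1 hx
  have hf' : ∀ μ, T (f μ) = (μ : ℝ) • f μ := fun μ => Module.End.mem_eigenspace_iff.1 (hf μ)
  have horth : ∀ μ ν : A, μ ≠ ν → ⟪f μ, f ν⟫ = 0 := by
    intro μ ν hne
    have := hT (f μ) (f ν)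
    simp only [ContinuousLinearMap.coe_coe, hf', inner_smul_left, inner_smul_right] at this
    rcases (by simpa using this : (μ : ℝ) = ν ∨ _) with h | h
    · exact absurd (Subtype.ext h) hne
    · exact h
  refine ⟨f, ?_⟩
  have key : ∀ g : A → ℝ, ⟪f.sum fun μ v => g μ • v, f.sum fun _ v => v⟫
      = f.sum fun μ v => g μ * ‖v‖ ^ 2 := by
    intro g
    simp only [Finsupp.sum, sum_inner, inner_sum]
    refine Finset.sum_congr rfl fun μ hμ => ?_
    rw [Finset.sum_eq_single μ]
    · rw [inner_smul_left, real_inner_self_eq_norm_sq]; simp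
    · intro ν _ hν
      rw [inner_smul_left, horth _ _ hν]; simp
    · intro h; exact absurd hμ h
  have h1 : T (f.sum fun _ v => v) = f.sum fun μ v => (μ : ℝ) • v := by
    simp only [Finsupp.sum, map_sum, hf']
  have h2 := key fun μ => μ
  have h3 := key fun _ => 1
  simp only [one_smul, one_mul, real_inner_self_eq_norm_sq] at h3
  rw [h1, h2, h3]
  simp only [Finsupp.sum, Finset.mul_sum, ← Finset.sum_sub_distrib, sub_mul]

theorem eigSum_orthogonal_form [CompleteSpace E] {T : E →L[ℝ] E} (hc : IsCompactOperator T)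
    (hT : (T : E →ₗ[ℝ] E).IsSymmetric) (r : ℝ) {x : E} (hx : x ∈ (eigSum T (Ioi r))ᗮ) :
    ⟪T x, x⟫ ≤ r * ‖x‖ ^ 2 := by
  set N := (eigSum T (Iic r)).topologicalClosure
  have hNle : N ≤ (eigSum T (Ioi r))ᗮ := by
    refine Submodule.topologicalClosure_minimal _ ?_ (Submodule.isClosed_orthogonal _)
    refine iSup_le fun μ y hy => ?_
    rw [Submodule.mem_orthogonal]
    intro z hz
    have : eigSum T (Ioi r) ≤ (ℝ ∙ y)ᗮ := by
      refine iSup_le fun ν w hw => ?_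
      rw [Submodule.mem_orthogonal_singleton_iff_inner_right]
      have := hT.orthogonalFamily_eigenspaces.isOrtho (i := (μ : ℝ)) (j := ν)
        (ne_of_lt (lt_of_le_of_lt μ.2 ν.2))
      exact Submodule.isOrtho_iff_inner_eq.1 this y hy w hw
    have := Submodule.mem_orthogonal_singleton_iff_inner_right.1 (this hz)
    rw [real_inner_comm]; exact this
  have hclosed : IsClosed (N : Set E) := Submodule.isClosed_topologicalClosure _
  have : CompleteSpace N := hclosed.completeSpace_coe
  obtain ⟨p, hp, q, hq, rfl⟩ := N.exists_add_mem_mem_orthogonal x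
  have hq0 : q = 0 := by
    have hq1 : q ∈ (eigSum T (Ioi r))ᗮ := by
      have := Submodule.sub_mem _ hx (hNle hp)
      simpa using this
    have hq2 : q ∈ (⨆ μ, Module.End.eigenspace (T : Module.End ℝ E) μ)ᗮ := by
      rw [Submodule.mem_orthogonal']
      intro u hu
      have : (⨆ μ, Module.End.eigenspace (T : Module.End ℝ E) μ) ≤ (ℝ ∙ q)ᗮ := by
        refine iSup_le fun μ w hw => ?_
        rw [Submodule.mem_orthogonal_singleton_iff_inner_right]
        rcases le_or_gt μ r with h | h
        · refine (Submodule.mem_orthogonal' _ _).1 hq w (Submodule.le_topologicalClosure _ ?_)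
          exact Submodule.mem_iSup_of_mem (⟨μ, h⟩ : Iic r) hw
        · refine (Submodule.mem_orthogonal' _ _).1 hq1 w ?_
          exact Submodule.mem_iSup_of_mem (⟨μ, h⟩ : Ioi r) hw
      exact Submodule.mem_orthogonal_singleton_iff_inner_right.1 (this hu)
    rw [ContinuousLinearMap.orthogonalComplement_iSup_eigenspaces_eq_bot hc hT] at hq2
    exact hq2
  have hcl : IsClosed {y : E | ⟪T y, y⟫ ≤ r * ‖y‖ ^ 2} :=
    isClosed_le (by fun_prop) (by fun_prop)
  have hsub : (eigSum T (Iic r) : Set E) ⊆ {y : E | ⟪T y, y⟫ ≤ r * ‖y‖ ^ 2} := by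
    intro y hy
    obtain ⟨f, hf⟩ := eigSum_form hT hy r
    have : (f.sum fun μ v => ((μ : ℝ) - r) * ‖v‖ ^ 2) ≤ 0 :=
      Finset.sum_nonpos fun μ _ => mul_nonpos_of_nonpos_of_nonneg
        (sub_nonpos.2 μ.2) (by positivity)
    simp only [mem_ofPred_eq]; linarith
  rw [hq0, add_zero]
  exact closure_minimal hsub hcl hp

theorem le_of_mem_eigSum {T : E →L[ℝ] E} (hT : (T : E →ₗ[ℝ] E).IsSymmetric) {r : ℝ} {x : E}
    (hx : x ∈ eigSum T (Ioi r)) : r * ‖x‖ ^ 2 ≤ ⟪T x, x⟫ := by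
  obtain ⟨f, hf⟩ := eigSum_form hT hx r
  have : 0 ≤ (f.sum fun μ v => ((μ : ℝ) - r) * ‖v‖ ^ 2) :=
    Finset.sum_nonneg fun μ _ => mul_nonneg (sub_nonneg.2 (le_of_lt μ.2)) (by positivity)
  linarith

theorem finrank_le_of_inf_orthogonal_eq_bot {U K : Submodule ℝ E} [FiniteDimensional ℝ K]
    (h : ∀ x ∈ U, x ∈ Kᗮ → x = 0) :
    FiniteDimensional ℝ U ∧ Module.finrank ℝ U ≤ Module.finrank ℝ K := by
  let φ : U →ₗ[ℝ] K := K.orthogonalProjectionOnto.toLinearMap ∘ₗ U.subtype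
  have hφ : Function.Injective φ := by
    rw [injective_iff_map_eq_zero]
    intro x hx
    refine Subtype.ext (h x x.2 ?_)
    exact Submodule.orthogonalProjectionOnto_eq_zero_iff.1 hx
  exact ⟨Module.Finite.of_injective φ hφ, LinearMap.finrank_le_finrank_of_injective hφ⟩

end Parity

section ParityPath

variable {E : Type*} [NormedAddCommGroup E] [InnerProductSpace ℝ E]

theorem IsCS.anticomm {A B : E →L[ℝ] E} (hA : IsCS A) (hB : IsCS B) (x : E) :
    (A + B) ((A - B) x) = -(A - B) ((A + B) x) := by
  simp only [add_apply, sub_apply, map_add, map_sub, hA.sq, hB.sq]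
  abel

theorem IsCS.sq_add_sq {A B : E →L[ℝ] E} (hA : IsCS A) (hB : IsCS B) (x : E) :
    (A + B) ((A + B) x) + (A - B) ((A - B) x) = (-4 : ℝ) • x := by
  simp only [add_apply, sub_apply, map_add, map_sub, hA.sq, hB.sq]
  module

theorem IsCS.add_skew {A B : E →L[ℝ] E} (hA : IsCS A) (hB : IsCS B) (x y : E) :
    ⟪(A + B) x, y⟫ = -⟪x, (A + B) y⟫ := by
  simp only [add_apply, inner_add_left, inner_add_right, hA.skew, hB.skew]
  ring

theorem IsCS.sub_skew {A B : E →L[ℝ] E} (hA : IsCS A) (hB : IsCS B) (x y : E) :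
    ⟪(A - B) x, y⟫ = -⟪x, (A - B) y⟫ := by
  simp only [sub_apply, inner_sub_left, inner_sub_right, hA.skew, hB.skew]
  ring

theorem IsCS.norm_sq_add {A B : E →L[ℝ] E} (hA : IsCS A) (hB : IsCS B) (x : E) :
    ‖(A + B) x‖ ^ 2 + ‖(A - B) x‖ ^ 2 = 4 * ‖x‖ ^ 2 := by
  have := congrArg (fun z => ⟪x, z⟫) (hA.sq_add_sq hB x)
  simp only [inner_add_right, inner_smul_right, real_inner_self_eq_norm_sq] at this
  rw [← real_inner_self_eq_norm_sq, ← real_inner_self_eq_norm_sq ((A - B) x),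
    hA.add_skew hB, hA.sub_skew hB]
  linarith

theorem IsCS.exists_norm_sub_le {A B : E →L[ℝ] E} (hA : IsCS A) (hB : IsCS B)
    (hc : IsCompactOperator (A - B)) :
    ∃ a : ℝ, 0 ≤ a ∧ a < 2 ∧
      ∀ x ∈ (LinearMap.ker (A + B).toLinearMap)ᗮ, ‖(A - B) x‖ ≤ a * ‖x‖ := by
  by_contra! hcon
  set K := LinearMap.ker (A + B).toLinearMap
  have h1 : ∀ n : ℕ, ∃ x ∈ Kᗮ, ‖x‖ = 1 ∧ 2 - 1 / ((n : ℝ) + 1) < ‖(A - B) x‖ := by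
    intro n
    have hn : 1 / ((n : ℝ) + 1) ≤ 1 := by
      rw [div_le_one (by positivity)]; linarith [Nat.cast_nonneg (α := ℝ) n]
    obtain ⟨x, hx, hx2⟩ := hcon (2 - 1 / ((n : ℝ) + 1)) (by linarith)
      (by linarith [show 0 < 1 / ((n : ℝ) + 1) by positivity])
    have hx0 : 0 < ‖x‖ := by
      rw [norm_pos_iff]; rintro rfl; simp at hx2
    refine ⟨‖x‖⁻¹ • x, Submodule.smul_mem _ _ hx, ?_, ?_⟩
    · rw [norm_smul, norm_inv, norm_norm, inv_mul_cancel₀ hx0.ne']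
    · rw [map_smul, norm_smul, norm_inv, norm_norm, lt_inv_mul_iff₀ hx0, mul_comm]
      exact hx2
  choose x hxK hx1 hx2 using h1
  obtain ⟨C, hC, hC'⟩ := IsCompactOperator.image_closedBall_subset_compact
    (f := (A - B).toLinearMap) hc 1
  obtain ⟨y, -, φ, hφ, hy⟩ := hC.tendsto_subseq (x := fun n => (A - B) (x n)) fun n =>
    hC' ⟨x n, by simp [hx1], rfl⟩
  have hS : Filter.Tendsto (fun n => (A + B) (x n)) Filter.atTop (nhds 0) := by
    rw [tendsto_zero_iff_norm_tendsto_zero]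
    have hsq : Filter.Tendsto (fun n : ℕ => Real.sqrt (4 * (1 / ((n : ℝ) + 1)))) Filter.atTop
        (nhds 0) := by
      have := (tendsto_one_div_add_atTop_nhds_zero_nat (𝕜 := ℝ)).const_mul 4
      rw [mul_zero] at this
      simpa using this.sqrt
    refine squeeze_zero (fun _ => norm_nonneg _) (fun n => ?_) hsq
    refine Real.le_sqrt_of_sq_le ?_
    have h3 := hA.norm_sq_add hB (x n)
    rw [hx1] at h3
    have hn : 1 / ((n : ℝ) + 1) ≤ 1 := by
      rw [div_le_one (by positivity)]; linarith [Nat.cast_nonneg (α := ℝ) n]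
    have hn0 : 0 < 1 / ((n : ℝ) + 1) := by positivity
    nlinarith [hx2 n]
  have hx : Filter.Tendsto (fun n => x (φ n)) Filter.atTop (nhds ((-(1 / 2) : ℝ) • A y)) := by
    have h4 := ((hS.comp hφ.tendsto_atTop).add hy)
    have h5 : ∀ n, x (φ n) = (-(1 / 2) : ℝ) • A ((A + B) (x (φ n)) + (A - B) (x (φ n))) := by
      intro n
      have : (A + B) (x (φ n)) + (A - B) (x (φ n)) = (2 : ℝ) • A (x (φ n)) := by
        simp only [add_apply, sub_apply]; module
      rw [this, map_smul, hA.sq]; module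
    rw [funext h5]
    rw [zero_add] at h4
    exact ((A.continuous.tendsto y).comp h4).const_smul _
  set u := (-(1 / 2) : ℝ) • A y
  have hu1 : ‖u‖ = 1 := tendsto_nhds_unique hx.norm (by simp [hx1])
  have huK : u ∈ K := by
    have := ((A + B).continuous.tendsto u).comp hx
    exact tendsto_nhds_unique this (hS.comp hφ.tendsto_atTop)
  have huK' : u ∈ Kᗮ := (Submodule.isClosed_orthogonal K).mem_of_tendsto hx
    (Filter.Eventually.of_forall fun n => hxK _)
  have : ⟪u, u⟫ = 0 := (Submodule.mem_orthogonal _ _).1 huK' u huK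
  rw [inner_self_eq_zero] at this
  rw [this, norm_zero] at hu1
  exact zero_ne_one hu1

theorem IsCS.norm_sub_of_mem_ker {A B : E →L[ℝ] E} (hA : IsCS A) (hB : IsCS B) {x : E}
    (hx : x ∈ LinearMap.ker (A + B).toLinearMap) : ‖(A - B) x‖ = 2 * ‖x‖ := by
  have h := hA.norm_sq_add hB x
  rw [show (A + B) x = 0 from hx, norm_zero] at h
  rw [← sq_eq_sq₀ (norm_nonneg _) (by positivity), mul_pow]
  linarith

theorem IsCS.finiteDimensional_ker [CompleteSpace E] {A B : E →L[ℝ] E} (hA : IsCS A)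
    (hB : IsCS B) (hc : IsCompactOperator (A - B)) :
    FiniteDimensional ℝ (LinearMap.ker (A + B).toLinearMap) := by
  have h := ContinuousLinearMap.finite_dimensional_eigenspace
    (T := (A - B) ∘L (A - B)) (hc.comp_clm (A - B)) (-4 : ℝ) (by norm_num)
  refine @Submodule.finiteDimensional_of_le _ _ _ _ _ _ _ h fun x hx => ?_
  rw [Module.End.mem_eigenspace_iff]
  have := hA.sq_add_sq hB x
  rw [show (A + B) x = 0 from hx, map_zero, zero_add] at this
  exact this

/-- A finite-dimensional space invariant under `A + B` and `A - B`, containing the kernel of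
`A + B` and on which `A - B` is injective, has dimension `par A B` modulo four. -/
theorem IsCS.finrank_modEq {A B : E →L[ℝ] E} (hA : IsCS A) (hB : IsCS B) (V : Submodule ℝ E)
    [FiniteDimensional ℝ V] (hK : LinearMap.ker (A + B).toLinearMap ≤ V)
    (hS : ∀ x ∈ V, (A + B) x ∈ V) (hM : ∀ x ∈ V, (A - B) x ∈ V)
    (hM0 : ∀ x ∈ V, (A - B) x = 0 → x = 0) :
    Module.finrank ℝ V ≡ par A B [MOD 4] := by
  set K := LinearMap.ker (A + B).toLinearMap with hKdef
  have hSW : ∀ x ∈ Kᗮ ⊓ V, (A + B).toLinearMap x ∈ Kᗮ ⊓ V := fun x hx => by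
    refine ⟨(Submodule.mem_orthogonal _ _).2 fun u hu => ?_, hS x hx.2⟩
    have := hA.add_skew hB u x
    rw [show (A + B) u = 0 from hu, inner_zero_left] at this
    exact neg_eq_zero.1 this.symm
  have hMW : ∀ x ∈ Kᗮ ⊓ V, (A - B).toLinearMap x ∈ Kᗮ ⊓ V := fun x hx => by
    refine ⟨(Submodule.mem_orthogonal _ _).2 fun u hu => ?_, hM x hx.2⟩
    have h2 : (A - B) u ∈ K := by
      rw [hKdef, LinearMap.mem_ker]
      change (A + B) ((A - B) u) = 0
      rw [hA.anticomm hB, show (A + B) u = 0 from hu, map_zero, neg_zero]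
    have := hA.sub_skew hB u x
    rw [(Submodule.mem_orthogonal _ _).1 hx.1 _ h2] at this
    exact neg_eq_zero.1 this.symm
  have hfin : FiniteDimensional ℝ (Kᗮ ⊓ V : Submodule ℝ E) :=
    Submodule.finiteDimensional_of_le (inf_le_right : Kᗮ ⊓ V ≤ V)
  have h4 : 4 ∣ Module.finrank ℝ (Kᗮ ⊓ V : Submodule ℝ E) := by
    refine four_dvd_finrank_of_anticommuting ((A + B).toLinearMap.restrict hSW)
      ((A - B).toLinearMap.restrict hMW) (-4) ?_ ?_ ?_ ?_ ?_ ?_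
    · intro x y; exact hA.add_skew hB x y
    · intro x y; exact hA.sub_skew hB x y
    · intro x hx
      have h1 : (x : E) ∈ K := congrArg Subtype.val hx
      have h2 := (Submodule.mem_orthogonal _ _).1 x.2.1 _ h1
      exact Subtype.ext (inner_self_eq_zero.1 h2)
    · intro x hx
      exact Subtype.ext (hM0 x x.2.2 (congrArg Subtype.val hx))
    · intro x; exact Subtype.ext (hA.anticomm hB x)
    · intro x; exact Subtype.ext (hA.sq_add_sq hB x)
  have h := Submodule.finrank_add_inf_finrank_orthogonal hK
  obtain ⟨k, hk⟩ := h4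
  rw [← h, hk]
  change (Module.finrank ℝ K + 4 * k) % 4 = Module.finrank ℝ K % 4
  omega

theorem par_locally_constant [CompleteSpace E] {A B : E →L[ℝ] E} (hA : IsCS A) (hB : IsCS B)
    (hc : IsCompactOperator (A - B)) : ∃ η > 0, ∀ A' B' : E →L[ℝ] E, IsCS A' → IsCS B' →
      IsCompactOperator (A' - B') → ‖A' - A‖ < η → ‖B' - B‖ < η →
      par A' B' ≡ par A B [MOD 4] := by
  obtain ⟨a, ha0, ha2, ha⟩ := hA.exists_norm_sub_le hB hc
  obtain ⟨b, hab, hb2⟩ := exists_between ha2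
  refine ⟨min (b - a) (2 - b) / 2, by
    have := lt_min (sub_pos.2 hab) (sub_pos.2 hb2); positivity, ?_⟩
  intro A' B' hA' hB' hc' hAA hBB
  have h1 : ∀ x, x ≠ 0 → |‖(A' - B') x‖ - ‖(A - B) x‖| < min (b - a) (2 - b) * ‖x‖ := by
    intro x hx
    refine lt_of_le_of_lt (abs_norm_sub_norm_le _ _) ?_
    have : (A' - B') x - (A - B) x = (A' - A) x - (B' - B) x := by
      simp only [sub_apply]; abel
    rw [this]
    have hx0 := norm_pos_iff.2 hx
    calc _ ≤ ‖(A' - A) x‖ + ‖(B' - B) x‖ := norm_sub_le _ _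
      _ ≤ ‖A' - A‖ * ‖x‖ + ‖B' - B‖ * ‖x‖ :=
        add_le_add ((A' - A).le_opNorm x) ((B' - B).le_opNorm x)
      _ < _ := by nlinarith
  set K := LinearMap.ker (A + B).toLinearMap with hK
  have hKf : FiniteDimensional ℝ K := hA.finiteDimensional_ker hB hc
  set T : E →L[ℝ] E := -((A' - B') ∘L (A' - B')) with hT
  have hTc : IsCompactOperator T := (hc'.comp_clm (A' - B')).neg
  have hTx : ∀ x y, ⟪T x, y⟫ = ⟪(A' - B') x, (A' - B') y⟫ := fun x y => by
    change ⟪-((A' - B') ((A' - B') x)), y⟫ = _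
    rw [inner_neg_left, hA'.sub_skew hB', neg_neg]
  have hTs : (T : E →ₗ[ℝ] E).IsSymmetric := fun x y => by
    change ⟪T x, y⟫ = ⟪x, T y⟫
    rw [hTx, real_inner_comm, ← hTx, real_inner_comm]
  set V := eigSum T (Ioi (b ^ 2)) with hV
  have hb0 : 0 ≤ b := ha0.trans hab.le
  have hVge : ∀ x ∈ V, b * ‖x‖ ≤ ‖(A' - B') x‖ := fun x hx => by
    have := le_of_mem_eigSum hTs hx
    rw [hTx, real_inner_self_eq_norm_sq] at this
    exact (sq_le_sq₀ (by positivity) (by positivity)).1 (by rw [mul_pow]; exact this)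
  have hVle : ∀ x ∈ Vᗮ, ‖(A' - B') x‖ ≤ b * ‖x‖ := fun x hx => by
    have := eigSum_orthogonal_form hTc hTs _ hx
    rw [hTx, real_inner_self_eq_norm_sq] at this
    exact (sq_le_sq₀ (by positivity) (by positivity)).1 (by rw [mul_pow]; exact this)
  obtain ⟨hVf, hle⟩ := finrank_le_of_inf_orthogonal_eq_bot (U := V) (K := K) (by
    intro x hx hx'
    by_contra hne
    have h2 := abs_lt.1 (h1 x hne)
    have h3 := hVge x hx
    have h4 := ha x hx'
    have := mul_le_mul_of_nonneg_right (min_le_left (b - a) (2 - b)) (norm_nonneg x)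
    linarith [h2.2])
  obtain ⟨-, hge⟩ := finrank_le_of_inf_orthogonal_eq_bot (U := K) (K := V) (by
    intro x hx hx'
    by_contra hne
    have h2 := abs_lt.1 (h1 x hne)
    have h3 := hVle x hx'
    have h4 := hA.norm_sub_of_mem_ker hB hx
    have := mul_le_mul_of_nonneg_right (min_le_right (b - a) (2 - b)) (norm_nonneg x)
    linarith [h2.1])
  have hKV : LinearMap.ker (A' + B').toLinearMap ≤ V := fun x hx => by
    refine Submodule.mem_iSup_of_mem (⟨4, by simp only [mem_Ioi]; nlinarith⟩ : Ioi (b ^ 2)) ?_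
    rw [Module.End.mem_eigenspace_iff]
    have := hA'.sq_add_sq hB' x
    rw [show (A' + B') x = 0 from hx, map_zero, zero_add] at this
    change -((A' - B') ((A' - B') x)) = _
    rw [this]; module
  have hcomm : ∀ x, (A' + B') (T x) = T ((A' + B') x) := fun x => by
    simp only [hT, neg_apply, ContinuousLinearMap.comp_apply, map_neg, hA'.anticomm hB', neg_neg]
  have := hA'.finrank_modEq hB' V hKV
    (fun x hx => eigSum_invariant T (A' + B') _ hcomm hx)
    (fun x hx => eigSum_invariant T (A' - B') _ (fun x => by
      simp only [hT, neg_apply, ContinuousLinearMap.comp_apply, map_neg]) hx)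
    (fun x hx hx0 => by
      have := hVge x hx
      rw [hx0, norm_zero] at this
      by_contra hne
      have := norm_pos_iff.2 hne
      nlinarith)
  rw [le_antisymm hle hge] at this
  exact this.symm

theorem par_eq_of_path [CompleteSpace E] (A B : unitInterval → E →L[ℝ] E) (hAc : Continuous A)
    (hBc : Continuous B) (hA : ∀ t, IsCS (A t)) (hB : ∀ t, IsCS (B t))
    (hc : ∀ t, IsCompactOperator (A t - B t)) : par (A 0) (B 0) ≡ par (A 1) (B 1) [MOD 4] := by
  have : IsLocallyConstant fun t => par (A t) (B t) % 4 := by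
    rw [IsLocallyConstant.iff_eventually_eq]
    intro t
    obtain ⟨η, hη, h⟩ := par_locally_constant (hA t) (hB t) (hc t)
    have h1 := Metric.tendsto_nhds.1 (hAc.tendsto t) η hη
    have h2 := Metric.tendsto_nhds.1 (hBc.tendsto t) η hη
    filter_upwards [h1, h2] with s hs1 hs2
    rw [dist_eq_norm] at hs1 hs2
    exact h _ _ (hA s) (hB s) (hc s) hs1 hs2
  exact this.apply_eq_of_preconnectedSpace 0 1

end ParityPath

section BlockOperators

variable {E : Type*} [NormedAddCommGroup E] [InnerProductSpace ℝ E]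

/-- The square of a Hilbert space. -/
abbrev Sqr (E : Type*) := WithLp 2 (E × E)

/-- The operator on the square of `E` with a given matrix of operators. -/
def blk (a b c d : E →L[ℝ] E) : Sqr E →L[ℝ] Sqr E :=
  (WithLp.prodContinuousLinearEquiv 2 ℝ E E).symm.toContinuousLinearMap ∘L
    (ContinuousLinearMap.inl ℝ E E ∘L
        (a ∘L WithLp.fstL 2 ℝ E E + b ∘L WithLp.sndL 2 ℝ E E) +
      ContinuousLinearMap.inr ℝ E E ∘L
        (c ∘L WithLp.fstL 2 ℝ E E + d ∘L WithLp.sndL 2 ℝ E E))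

theorem blk_apply (a b c d : E →L[ℝ] E) (x y : E) :
    blk a b c d (WithLp.toLp 2 (x, y)) = WithLp.toLp 2 (a x + b y, c x + d y) := by
  simp [blk, ← WithLp.toLp_add]

theorem blk_add (a b c d a' b' c' d' : E →L[ℝ] E) :
    blk a b c d + blk a' b' c' d' = blk (a + a') (b + b') (c + c') (d + d') := by
  ext ⟨x, y⟩
  simp only [add_apply, blk_apply, ← WithLp.toLp_add, Prod.mk_add_mk]
  congr 2 <;> abel

theorem blk_sub (a b c d a' b' c' d' : E →L[ℝ] E) :
    blk a b c d - blk a' b' c' d' = blk (a - a') (b - b') (c - c') (d - d') := by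
  ext ⟨x, y⟩
  simp only [sub_apply, blk_apply, ← WithLp.toLp_sub, Prod.mk_sub_mk]
  congr 2 <;> abel

theorem isCompactOperator_blk {a b c d : E →L[ℝ] E} (ha : IsCompactOperator a)
    (hb : IsCompactOperator b) (hc : IsCompactOperator c) (hd : IsCompactOperator d) :
    IsCompactOperator (blk a b c d) := by
  have h1 : IsCompactOperator (ContinuousLinearMap.inl ℝ E E ∘L
      (a ∘L WithLp.fstL 2 ℝ E E + b ∘L WithLp.sndL 2 ℝ E E)) :=
    ((ha.comp_clm (WithLp.fstL 2 ℝ E E)).add (hb.comp_clm (WithLp.sndL 2 ℝ E E))).clm_comp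
      (ContinuousLinearMap.inl ℝ E E)
  have h2 : IsCompactOperator (ContinuousLinearMap.inr ℝ E E ∘L
      (c ∘L WithLp.fstL 2 ℝ E E + d ∘L WithLp.sndL 2 ℝ E E)) :=
    ((hc.comp_clm (WithLp.fstL 2 ℝ E E)).add (hd.comp_clm (WithLp.sndL 2 ℝ E E))).clm_comp
      (ContinuousLinearMap.inr ℝ E E)
  exact (h1.add h2).clm_comp
    (WithLp.prodContinuousLinearEquiv 2 ℝ E E).symm.toContinuousLinearMap

theorem continuous_blk {X : Type*} [TopologicalSpace X] {a b c d : X → E →L[ℝ] E}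
    (ha : Continuous a) (hb : Continuous b) (hc : Continuous c) (hd : Continuous d) :
    Continuous fun t => blk (a t) (b t) (c t) (d t) := by
  unfold blk
  fun_prop

theorem IsCS.blk {a b c d : E →L[ℝ] E} (h1 : ∀ x, a (a x) + b (c x) = -x)
    (h2 : ∀ x, a (b x) + b (d x) = 0) (h3 : ∀ x, c (a x) + d (c x) = 0)
    (h4 : ∀ x, c (b x) + d (d x) = -x) (ha : ∀ x y, ⟪a x, y⟫ = -⟪x, a y⟫)
    (hd : ∀ x y, ⟪d x, y⟫ = -⟪x, d y⟫) (hbc : ∀ x y, ⟪b x, y⟫ = -⟪x, c y⟫) :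
    IsCS (blk a b c d) where
  sq := by
    rintro ⟨x, y⟩
    simp only [blk_apply, map_add]
    rw [show a (a x) + a (b y) + (b (c x) + b (d y))
        = (a (a x) + b (c x)) + (a (b y) + b (d y)) by abel,
      show c (a x) + c (b y) + (d (c x) + d (d y))
        = (c (a x) + d (c x)) + (c (b y) + d (d y)) by abel, h1, h2, h3, h4, add_zero, zero_add,
      ← WithLp.toLp_neg, Prod.neg_mk]
  skew := by
    rintro ⟨x, y⟩ ⟨x', y'⟩
    simp only [blk_apply, WithLp.prod_inner_apply, inner_add_left, inner_add_right, ha, hd, hbc]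
    have h5 : ⟪c x, y'⟫ = -⟪x, b y'⟫ := by
      rw [real_inner_comm, ← neg_eq_iff_eq_neg, ← hbc, real_inner_comm]
    linarith

theorem finrank_ker_blk (a d : E →L[ℝ] E) [FiniteDimensional ℝ (LinearMap.ker a.toLinearMap)]
    [FiniteDimensional ℝ (LinearMap.ker d.toLinearMap)] :
    Module.finrank ℝ (LinearMap.ker (blk a 0 0 d).toLinearMap) =
      Module.finrank ℝ (LinearMap.ker a.toLinearMap) +
        Module.finrank ℝ (LinearMap.ker d.toLinearMap) := by
  rw [← Module.finrank_prod]
  have h : ∀ z : Sqr E, z ∈ LinearMap.ker (blk a 0 0 d).toLinearMap ↔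
      z.fst ∈ LinearMap.ker a.toLinearMap ∧ z.snd ∈ LinearMap.ker d.toLinearMap := by
    rintro ⟨x, y⟩
    simp [LinearMap.mem_ker, blk_apply]
  refine LinearEquiv.finrank_eq
    { toFun := fun z => (⟨_, ((h _).1 z.2).1⟩, ⟨_, ((h _).1 z.2).2⟩)
      invFun := fun w => ⟨WithLp.toLp 2 (w.1.1, w.2.1), (h _).2 ⟨w.1.2, w.2.2⟩⟩
      map_add' := fun _ _ => rfl
      map_smul' := fun _ _ => rfl
      left_inv := fun _ => rfl
      right_inv := fun _ => rfl }

theorem par_self {A : E →L[ℝ] E} (hA : IsCS A) : par A A = 0 := by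
  unfold par
  have : LinearMap.ker (A + A).toLinearMap = ⊥ := by
    rw [LinearMap.ker_eq_bot']
    intro x hx
    have h1 : (2 : ℝ) • A x = 0 := by rw [two_smul]; exact hx
    have h2 : A x = 0 := by simpa using h1
    have := hA.norm_apply x
    rw [h2, norm_zero] at this
    exact norm_eq_zero.1 this.symm
  rw [this, finrank_bot]

theorem par_comm (A B : E →L[ℝ] E) : par A B = par B A := by
  unfold par
  rw [add_comm]

theorem IsCompactOperator.sub_comm {A B : E →L[ℝ] E} (h : IsCompactOperator (A - B)) :
    IsCompactOperator (B - A) := by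
  rw [← neg_sub]; exact h.neg

theorem par_add [CompleteSpace E] {A B C : E →L[ℝ] E} (hA : IsCS A) (hB : IsCS B) (hC : IsCS C)
    (hAB : IsCompactOperator (A - B)) (hBC : IsCompactOperator (B - C)) :
    par A C ≡ par A B + par B C [MOD 4] := by
  have hAC : IsCompactOperator (A - C) := by
    rw [← sub_add_sub_cancel A B C]; exact hAB.add hBC
  let c : unitInterval → ℝ := fun t => Real.cos (Real.pi / 2 * t)
  let s : unitInterval → ℝ := fun t => Real.sin (Real.pi / 2 * t)
  have hcs : ∀ t, c t ^ 2 + s t ^ 2 = 1 := fun t => Real.cos_sq_add_sin_sq _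
  have hc : Continuous c := by fun_prop
  have hs : Continuous s := by fun_prop
  have key := par_eq_of_path (E := Sqr E) (fun _ => blk A 0 0 B)
    (fun t => blk (c t ^ 2 • C + s t ^ 2 • B) ((c t * s t) • (C - B)) ((c t * s t) • (C - B))
      (s t ^ 2 • C + c t ^ 2 • B)) continuous_const
    (continuous_blk (by fun_prop) (by fun_prop) (by fun_prop) (by fun_prop))
    (fun _ => IsCS.blk (by simp [hA.sq]) (by simp) (by simp) (by simp [hB.sq]) hA.skew hB.skew
      (by simp))
    (fun t => IsCS.blk ?_ ?_ ?_ ?_ ?_ ?_ ?_) (fun t => ?_)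
  · have f1 := hA.finiteDimensional_ker hC hAC
    have f2 := hA.finiteDimensional_ker hB hAB
    have f3 := hB.finiteDimensional_ker hC hBC
    have f4 := hB.finiteDimensional_ker hB (by rw [sub_self]; exact isCompactOperator_zero)
    have h0 : c 0 = 1 ∧ s 0 = 0 := by simp [c, s]
    have h1 : c 1 = 0 ∧ s 1 = 1 := by simp [c, s]
    unfold par at key
    rw [blk_add, blk_add, h0.1, h0.2, h1.1, h1.2] at key
    have e : ∀ X Y Z : E →L[ℝ] E, X + ((1 : ℝ) ^ 2 • Y + (0 : ℝ) ^ 2 • Z) = X + Y ∧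
        X + ((0 : ℝ) ^ 2 • Y + (1 : ℝ) ^ 2 • Z) = X + Z ∧ 0 + ((1 : ℝ) * 0) • X = 0 ∧
        0 + ((0 : ℝ) * 1) • X = 0 := by intros; simp
    rw [(e A C B).1, (e A C B).2.1, (e B C B).1, (e B C B).2.1, (e (C - B) 0 0).2.2.1,
      (e (C - B) 0 0).2.2.2] at key
    rw [finrank_ker_blk, finrank_ker_blk] at key
    change par A C + par B B ≡ par A B + par B C [MOD 4] at key
    rwa [par_self hB, add_zero] at key
  · intro x
    have : -x = (-(c t ^ 2 + s t ^ 2)) • (c t ^ 2 + s t ^ 2) • x := by rw [hcs]; simp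
    rw [this]
    simp only [add_apply, smul_apply, sub_apply, map_add, map_sub, map_smul, hB.sq, hC.sq]
    module
  · intro x
    simp only [add_apply, smul_apply, sub_apply, map_add, map_sub, map_smul, hB.sq, hC.sq]
    module
  · intro x
    simp only [add_apply, smul_apply, sub_apply, map_add, map_sub, map_smul, hB.sq, hC.sq]
    module
  · intro x
    have : -x = (-(c t ^ 2 + s t ^ 2)) • (c t ^ 2 + s t ^ 2) • x := by rw [hcs]; simp
    rw [this]
    simp only [add_apply, smul_apply, sub_apply, map_add, map_sub, map_smul, hB.sq, hC.sq]
    module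
  · intro x y
    simp only [add_apply, smul_apply, inner_add_left, inner_add_right, inner_smul_left,
      inner_smul_right, hB.skew, hC.skew]
    simp; ring
  · intro x y
    simp only [add_apply, smul_apply, inner_add_left, inner_add_right, inner_smul_left,
      inner_smul_right, hB.skew, hC.skew]
    simp; ring
  · intro x y
    simp only [sub_apply, smul_apply, inner_sub_left, inner_sub_right, inner_smul_left,
      inner_smul_right, hB.skew, hC.skew]
    simp; ring
  · rw [blk_sub]
    have hCB : IsCompactOperator ((c t * s t) • (C - B)) := hBC.sub_comm.smul (c t * s t)
    refine isCompactOperator_blk ?_ ?_ ?_ ?_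
    · have : A - (c t ^ 2 • C + s t ^ 2 • B) = c t ^ 2 • (A - C) + s t ^ 2 • (A - B) := by
        nth_rewrite 1 [← one_smul ℝ A]
        rw [← hcs t]; module
      rw [this]
      exact (hAC.smul (c t ^ 2)).add (hAB.smul (s t ^ 2))
    · rw [zero_sub]; exact hCB.neg
    · rw [zero_sub]; exact hCB.neg
    · have : B - (s t ^ 2 • C + c t ^ 2 • B) = s t ^ 2 • (B - C) := by
        nth_rewrite 1 [← one_smul ℝ B]
        rw [← hcs t]; module
      rw [this]
      exact hBC.smul (s t ^ 2)

/-- Conjugation of an operator by a unitary. -/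
def cconj (Q : E ≃ₗᵢ[ℝ] E) (J : E →L[ℝ] E) : E →L[ℝ] E :=
  (Q.symm : E →L[ℝ] E) ∘L J ∘L (Q : E →L[ℝ] E)

theorem cconj_apply (Q : E ≃ₗᵢ[ℝ] E) (J : E →L[ℝ] E) (x : E) :
    cconj Q J x = Q.symm (J (Q x)) := rfl

theorem cconj_sub (Q : E ≃ₗᵢ[ℝ] E) (A B : E →L[ℝ] E) :
    cconj Q (A - B) = cconj Q A - cconj Q B := by
  ext x; simp [cconj_apply]

theorem IsCS.cconj {J : E →L[ℝ] E} (hJ : IsCS J) (Q : E ≃ₗᵢ[ℝ] E) : IsCS (cconj Q J) where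
  sq x := by simp [cconj_apply, hJ.sq]
  skew x y := by
    rw [cconj_apply, cconj_apply, ← Q.inner_map_map, Q.apply_symm_apply, hJ.skew,
      ← Q.inner_map_map x, Q.apply_symm_apply]

theorem isCompactOperator_cconj {J : E →L[ℝ] E} (hJ : IsCompactOperator J) (Q : E ≃ₗᵢ[ℝ] E) :
    IsCompactOperator (cconj Q J) :=
  (hJ.comp_clm (Q : E →L[ℝ] E)).clm_comp (Q.symm : E →L[ℝ] E)

theorem par_cconj (Q : E ≃ₗᵢ[ℝ] E) (A B : E →L[ℝ] E) :
    par (cconj Q A) (cconj Q B) = par A B := by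
  have h : ∀ z, z ∈ LinearMap.ker (cconj Q A + cconj Q B).toLinearMap ↔
      Q z ∈ LinearMap.ker (A + B).toLinearMap := by
    intro z
    change Q.symm (A (Q z)) + Q.symm (B (Q z)) = 0 ↔ A (Q z) + B (Q z) = 0
    rw [← map_add, map_eq_zero_iff _ Q.symm.injective]
  exact LinearEquiv.finrank_eq
    { toFun := fun z => ⟨Q z, (h _).1 z.2⟩
      invFun := fun z => ⟨Q.symm z, (h _).2 (by rw [Q.apply_symm_apply]; exact z.2)⟩
      map_add' := fun _ _ => Subtype.ext (map_add Q _ _)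
      map_smul' := fun _ _ => Subtype.ext (map_smul Q _ _)
      left_inv := fun _ => Subtype.ext (Q.symm_apply_apply _)
      right_inv := fun _ => Subtype.ext (Q.apply_symm_apply _) }

/-- The mod four index of a unitary commuting with `J` modulo compact operators. -/
def cidx (J : E →L[ℝ] E) (Q : E ≃ₗᵢ[ℝ] E) : ℕ := par J (cconj Q J)

theorem cidx_congr [CompleteSpace E] {J J' : E →L[ℝ] E} (hJ : IsCS J) (hJ' : IsCS J')
    (h : IsCompactOperator (J - J')) {Q : E ≃ₗᵢ[ℝ] E} (hQ : IsCompactOperator (J - cconj Q J)) :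
    cidx J' Q ≡ cidx J Q [MOD 4] := by
  have hc : IsCompactOperator (cconj Q J - cconj Q J') := by
    rw [← cconj_sub]; exact isCompactOperator_cconj h Q
  have h1 := par_add hJ' hJ (hJ'.cconj Q) h.sub_comm (C := cconj Q J') (by
    rw [← sub_add_sub_cancel _ (cconj Q J)]; exact hQ.add hc)
  have h2 := par_add hJ (hJ.cconj Q) (hJ'.cconj Q) hQ hc
  have h3 := par_add hJ hJ' hJ h h.sub_comm
  rw [par_cconj] at h2
  rw [par_self hJ, par_comm J' J] at h3
  rw [par_comm J' J] at h1
  unfold cidx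
  unfold Nat.ModEq at *
  omega

theorem cidx_mul [CompleteSpace E] {J : E →L[ℝ] E} (hJ : IsCS J) {Q R : E ≃ₗᵢ[ℝ] E}
    (hQ : IsCompactOperator (J - cconj Q J)) (hR : IsCompactOperator (J - cconj R J)) :
    cidx J (R.trans Q) ≡ cidx J Q + cidx J R [MOD 4] := by
  have h1 : cconj (R.trans Q) J = cconj R (cconj Q J) := rfl
  have h2 : IsCompactOperator (cconj R J - cconj R (cconj Q J)) := by
    rw [← cconj_sub]; exact isCompactOperator_cconj hQ R
  have h := par_add hJ (hJ.cconj R) ((hJ.cconj Q).cconj R) hR h2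
  rw [par_cconj] at h
  rw [cidx, h1, add_comm]
  exact h

theorem cidx_eq_of_path [CompleteSpace E] {J : E →L[ℝ] E} (hJ : IsCS J)
    (Q : unitInterval → E ≃ₗᵢ[ℝ] E) (h1 : Continuous fun t => (Q t : E →L[ℝ] E))
    (h2 : Continuous fun t => ((Q t).symm : E →L[ℝ] E))
    (hQ : ∀ t, IsCompactOperator (J - cconj (Q t) J)) :
    cidx J (Q 0) ≡ cidx J (Q 1) [MOD 4] :=
  par_eq_of_path (fun _ => J) (fun t => cconj (Q t) J) continuous_const
    (by unfold cconj; fun_prop) (fun _ => hJ) (fun t => hJ.cconj _) hQ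

end BlockOperators

section Dec

open Filter Topology

variable {ι H F : Type*} [NormedAddCommGroup H] [InnerProductSpace ℝ H]
  [NormedAddCommGroup F] [InnerProductSpace ℝ F]

/-- Decompositions of a Hilbert space into an orthogonal sum of finite-dimensional subspaces. -/
structure Dec (ι H : Type*) [NormedAddCommGroup H] [InnerProductSpace ℝ H] where
  /-- The summands. -/
  V : ι → Submodule ℝ H
  fin : ∀ i, FiniteDimensional ℝ (V i)
  orth : OrthogonalFamily ℝ (fun i => V i) fun i => (V i).subtypeₗᵢ
  total : ⊤ ≤ (⨆ i, V i).topologicalClosure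

namespace Dec

variable (d : Dec ι H)

theorem eq_zero_of_orthogonal {x : H} (h : ∀ i, ∀ y ∈ d.V i, ⟪y, x⟫ = 0) : x = 0 := by
  have h1 : x ∈ (⨆ i, d.V i)ᗮ := by
    rw [← Submodule.iInf_orthogonal]
    simp only [Submodule.mem_iInf]
    exact fun i y hy => h i y hy
  have h2 : (⨆ i, d.V i)ᗮ = ⊥ := by
    rw [← Submodule.orthogonal_closure, top_le_iff.1 d.total, Submodule.top_orthogonal_eq_bot]
  rwa [h2, Submodule.mem_bot] at h1

theorem clm_ext {G : Type*} [NormedAddCommGroup G] [NormedSpace ℝ G] {A B : H →L[ℝ] G}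
    (h : ∀ i, ∀ x ∈ d.V i, A x = B x) : A = B := by
  have h1 : (⨆ i, d.V i) ≤ LinearMap.ker (A - B).toLinearMap := by
    refine iSup_le fun i x hx => ?_
    rw [LinearMap.mem_ker]
    exact sub_eq_zero.2 (h i x hx)
  have h2 := Submodule.topologicalClosure_minimal _ h1 (A - B).isClosed_ker
  ext x
  exact sub_eq_zero.1 (h2 (d.total trivial))

theorem inner_ext {A B C D : H →L[ℝ] H}
    (h : ∀ i j, ∀ x ∈ d.V i, ∀ y ∈ d.V j, ⟪A x, B y⟫ = ⟪C x, D y⟫) (x y : H) :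
    ⟪A x, B y⟫ = ⟪C x, D y⟫ := by
  have h1 : ∀ j, ∀ y ∈ d.V j, ∀ x, ⟪A x, B y⟫ = ⟪C x, D y⟫ := by
    intro j y hy x
    have : (innerSL ℝ (B y)) ∘L A = (innerSL ℝ (D y)) ∘L C := by
      refine d.clm_ext fun i x hx => ?_
      simpa [real_inner_comm] using h i j x hx y hy
    simpa [real_inner_comm] using DFunLike.congr_fun this x
  have : (innerSL ℝ (A x)) ∘L B = (innerSL ℝ (C x)) ∘L D :=
    d.clm_ext fun j y hy => by simpa using h1 j y hy x
  simpa using DFunLike.congr_fun this y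

theorem inner_eq_zero {i j : ι} (hij : i ≠ j) {x y : H} (hx : x ∈ d.V i) (hy : y ∈ d.V j) :
    ⟪x, y⟫ = 0 :=
  d.orth hij ⟨x, hx⟩ ⟨y, hy⟩

theorem exists_diag (γ : ι → ℝ) {C : ℝ} (hC : ∀ i, |γ i| ≤ C) [CompleteSpace H] :
    ∃ T : H →L[ℝ] H, (∀ i, ∀ x ∈ d.V i, T x = γ i • x) ∧ (0 ≤ C → ‖T‖ ≤ C) := by
  classical
  have := d.fin
  have hs := IsHilbertSum.mkInternal (𝕜 := ℝ) d.V d.orth d.total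
  let e := hs.linearIsometryEquiv
  have hC0 : 0 ≤ max C 0 := le_max_right _ _
  have hle : ∀ (f : lp (fun i => d.V i) 2) i, ‖γ i • f i‖ ≤ ‖((max C 0) • f) i‖ := by
    intro f i
    rw [lp.coeFn_smul, Pi.smul_apply, norm_smul, norm_smul, Real.norm_eq_abs, Real.norm_eq_abs,
      abs_of_nonneg hC0]
    gcongr
    exact (hC i).trans (le_max_left _ _)
  let T₀ : lp (fun i => d.V i) 2 →ₗ[ℝ] lp (fun i => d.V i) 2 :=
    { toFun := fun f => ⟨fun i => γ i • f i, by
        refine memℓp_gen (((lp.memℓp ((max C 0) • f)).summable (by simp)).of_nonneg_of_le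
          (fun i => by positivity) fun i => ?_)
        gcongr
        exact hle f i⟩
      map_add' := fun f g => by ext i; simp; rfl
      map_smul' := fun c f => by
        ext i
        simp only [lp.coeFn_smul, Pi.smul_apply, RingHom.id_apply]
        rw [smul_comm] }
  have hT₀ : ∀ f, ‖T₀ f‖ ≤ max C 0 * ‖f‖ := by
    intro f
    calc ‖T₀ f‖ ≤ ‖(max C 0) • f‖ := lp.norm_mono (by simp) fun i => hle f i
      _ = _ := by rw [norm_smul, Real.norm_eq_abs, abs_of_nonneg hC0]
  let T₁ := T₀.mkContinuous _ hT₀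
  refine ⟨(e.symm : _ →L[ℝ] H) ∘L T₁ ∘L (e : H →L[ℝ] _), ?_, ?_⟩
  · intro i x hx
    have h1 : e x = lp.single 2 i ⟨x, hx⟩ := by
      refine (e.symm_apply_eq.1 ?_).symm
      rw [hs.linearIsometryEquiv_symm_apply_single]; rfl
    have h2 : T₁ (e x) = γ i • e x := by
      rw [h1]
      ext j
      change ((γ j • (lp.single 2 i (⟨x, hx⟩ : d.V i) : lp (fun i => d.V i) 2) j : d.V j) : H) = _
      rw [lp.coeFn_smul, Pi.smul_apply, lp.single_apply]
      by_cases h : j = i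
      · subst h; rfl
      · simp [Pi.single_eq_of_ne h]
    change e.symm (T₁ (e x)) = _
    rw [h2, map_smul, e.symm_apply_apply]
  · intro h0
    refine ContinuousLinearMap.opNorm_le_bound _ h0 fun x => ?_
    change ‖e.symm (T₁ (e x))‖ ≤ _
    rw [e.symm.norm_map]
    have := hT₀ (e x)
    rw [e.norm_map, max_eq_left h0] at this
    exact this

open Classical in
/-- The operator acting on the `i`-th summand as the scalar `γ i`, for bounded `γ`. -/
def diag [CompleteSpace H] (γ : ι → ℝ) : H →L[ℝ] H :=
  if h : ∃ C, ∀ i, |γ i| ≤ C then (d.exists_diag γ h.choose_spec).choose else 0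

variable [CompleteSpace H]

theorem diag_apply {γ : ι → ℝ} (h : ∃ C, ∀ i, |γ i| ≤ C) {i : ι} {x : H} (hx : x ∈ d.V i) :
    d.diag γ x = γ i • x := by
  rw [diag, dif_pos h]
  exact (d.exists_diag γ h.choose_spec).choose_spec.1 i x hx

theorem norm_diag_le {γ : ι → ℝ} {C : ℝ} (hC : 0 ≤ C) (h : ∀ i, |γ i| ≤ C) :
    ‖d.diag γ‖ ≤ C := by
  obtain ⟨T, hT, hT'⟩ := d.exists_diag γ h
  rw [d.clm_ext fun i x hx => (d.diag_apply ⟨C, h⟩ hx).trans (hT i x hx).symm]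
  exact hT' hC

theorem inner_diag (γ : ι → ℝ) (x y : H) : ⟪d.diag γ x, y⟫ = ⟪x, d.diag γ y⟫ := by
  by_cases h : ∃ C, ∀ i, |γ i| ≤ C
  · refine d.inner_ext (A := d.diag γ) (B := 1) (C := 1) (D := d.diag γ) ?_ x y
    intro i j x hx y hy
    rw [one_apply_eq_self, one_apply_eq_self, d.diag_apply h hx, d.diag_apply h hy,
      inner_smul_left, inner_smul_right]
    by_cases hij : i = j
    · subst hij; rfl
    · simp [d.inner_eq_zero hij hx hy]
  · simp [diag, h]

theorem isCompactOperator_diag {γ : ι → ℝ} (h : Tendsto γ cofinite (𝓝 0)) :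
    IsCompactOperator (d.diag γ) := by
  classical
  have hfin : ∀ ε > 0, {i | ε ≤ |γ i|}.Finite := fun ε hε => by
    have := h (Metric.ball_mem_nhds 0 hε)
    rw [mem_map, mem_cofinite] at this
    refine this.subset fun i hi => ?_
    simpa [mem_ofPred_eq] using hi
  have hb : ∃ C, ∀ i, |γ i| ≤ C := by
    obtain ⟨C, hC⟩ := ((hfin 1 one_pos).image fun i => |γ i|).bddAbove
    refine ⟨max C 1, fun i => ?_⟩
    by_cases hi : 1 ≤ |γ i|
    · exact (hC ⟨i, hi, rfl⟩).trans (le_max_left _ _)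
    · exact (not_le.1 hi).le.trans (le_max_right _ _)
  obtain ⟨C, hC⟩ := hb
  let γ' : ℕ → ι → ℝ := fun n i => if (1 / (n + 1 : ℝ)) ≤ |γ i| then γ i else 0
  have hγ' : ∀ n i, |γ' n i| ≤ C := fun n i => by
    simp only [γ']
    split_ifs
    · exact hC i
    · simpa using (abs_nonneg _).trans (hC i)
  refine isCompactOperator_of_tendsto (l := atTop) (F := fun n => d.diag (γ' n)) ?_
    (Eventually.of_forall fun n => ?_)
  · rw [tendsto_iff_norm_sub_tendsto_zero]
    refine squeeze_zero (fun _ => norm_nonneg _) (fun n => ?_)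
      (tendsto_one_div_add_atTop_nhds_zero_nat (𝕜 := ℝ))
    have hγ'' : ∀ i, |γ' n i - γ i| ≤ 1 / (n + 1 : ℝ) := fun i => by
      simp only [γ']
      split_ifs with h
      · simp only [sub_self, abs_zero]; positivity
      · simpa using (not_le.1 h).le
    have : d.diag (γ' n) - d.diag γ = d.diag (fun i => γ' n i - γ i) := by
      refine d.clm_ext fun i x hx => ?_
      rw [sub_apply, d.diag_apply ⟨C, hγ' n⟩ hx, d.diag_apply ⟨C, hC⟩ hx,
        d.diag_apply ⟨_, hγ''⟩ hx, sub_smul]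
    rw [this]
    exact d.norm_diag_le (by positivity) hγ''
  · set S : Finset ι := (hfin (1 / (n + 1 : ℝ)) (by positivity)).toFinset
    have := d.fin
    have : FiniteDimensional ℝ (S.sup d.V : Submodule ℝ H) :=
      Submodule.finiteDimensional_finset_sup S d.V
    set K : Submodule ℝ H := S.sup d.V
    have hK : K.topologicalClosure = K :=
      (Submodule.closed_of_finiteDimensional K).submodule_topologicalClosure_eq
    have hmem : ∀ x, d.diag (γ' n) x ∈ K := by
      intro x
      have h1 : (⨆ i, d.V i) ≤ K.comap (d.diag (γ' n)).toLinearMap := by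
        refine iSup_le fun i x hx => ?_
        rw [Submodule.mem_comap]
        change d.diag (γ' n) x ∈ K
        rw [d.diag_apply ⟨C, hγ' n⟩ hx]
        by_cases hi : i ∈ S
        · exact K.smul_mem _ ((Finset.le_sup (f := d.V) hi) hx)
        · have : γ' n i = 0 := by
            simp only [γ']
            rw [if_neg]
            simpa [S] using hi
          rw [this, zero_smul]; exact K.zero_mem
      refine (Submodule.topologicalClosure_minimal _ h1 ?_) (d.total trivial)
      exact (Submodule.closed_of_finiteDimensional K).preimage (d.diag (γ' n)).continuous
    have : d.diag (γ' n) = K.subtypeL ∘L ((d.diag (γ' n)).codRestrict K hmem) := by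
      ext x; rfl
    rw [this]
    have : ProperSpace K := FiniteDimensional.proper ℝ K
    have hc : IsCompactOperator (id : K → K) := isCompactOperator_id
    exact (hc.comp_clm ((d.diag (γ' n)).codRestrict K hmem)).clm_comp K.subtypeL

/-- Compactness of the commutator of `diag f` with an operator shifting the summands. -/
theorem isCompactOperator_comm_diag {A B : H →L[ℝ] H} (s : ι → ι)
    (hA : ∀ i, ∀ x ∈ d.V i, A x ∈ d.V (s i)) (g : ι → ℝ)
    (hg : ∀ i, ∀ x ∈ d.V i, A x = g i • B x) {f : ι → ℝ} (hf : ∃ C, ∀ i, |f i| ≤ C)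
    (h : Tendsto (fun i => (f (s i) - f i) * g i) cofinite (𝓝 0)) :
    IsCompactOperator (d.diag f ∘L A - A ∘L d.diag f) := by
  have hb : ∃ C, ∀ i, |(f (s i) - f i) * g i| ≤ C := by
    have := h (Metric.ball_mem_nhds 0 one_pos)
    rw [mem_map, mem_cofinite] at this
    obtain ⟨C, hC⟩ := (this.image fun i => |(f (s i) - f i) * g i|).bddAbove
    refine ⟨max C 1, fun i => ?_⟩
    by_cases hi : |(f (s i) - f i) * g i| < 1
    · exact hi.le.trans (le_max_right _ _)
    · exact (hC ⟨i, by simpa using hi, rfl⟩).trans (le_max_left _ _)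
  have : d.diag f ∘L A - A ∘L d.diag f = B ∘L d.diag (fun i => (f (s i) - f i) * g i) := by
    refine d.clm_ext fun i x hx => ?_
    rw [sub_apply, ContinuousLinearMap.comp_apply, ContinuousLinearMap.comp_apply,
      ContinuousLinearMap.comp_apply, d.diag_apply hf (hA i x hx), d.diag_apply hf hx,
      d.diag_apply hb hx, map_smul, map_smul, hg i x hx]
    module
  rw [this]
  exact (d.isCompactOperator_diag h).clm_comp B

end Dec

end Dec

section Harmonic

open MvPolynomial

/-- Polynomials in the four real coordinates of a quaternion. -/
abbrev Pol := MvPolynomial (Fin 4) ℝ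

/-- Quaternion-valued polynomials. -/
abbrev QPol := Quaternion Pol

namespace QPol

theorem pderiv_comm' (i j : Fin 4) (p : Pol) :
    pderiv i (pderiv j p) = pderiv j (pderiv i p) := by
  have : ⁅(pderiv i : Derivation ℝ Pol Pol), (pderiv j : Derivation ℝ Pol Pol)⁆ = 0 := by
    refine MvPolynomial.derivation_ext fun k => ?_
    simp only [Derivation.commutator_apply, pderiv_X, Derivation.coe_zero, Pi.zero_apply,
      Pi.single_apply]
    split_ifs <;> simp
  have h := DFunLike.congr_fun this p
  rw [Derivation.commutator_apply] at h
  exact sub_eq_zero.1 h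

/-- The derivative along `x ↦ i x`. -/
def lv1 : Derivation ℝ Pol Pol :=
  (X 0 : Pol) • pderiv 1 - (X 1 : Pol) • pderiv 0 + (X 2 : Pol) • pderiv 3 - (X 3 : Pol) • pderiv 2

/-- The derivative along `x ↦ j x`. -/
def lv2 : Derivation ℝ Pol Pol :=
  (X 0 : Pol) • pderiv 2 - (X 2 : Pol) • pderiv 0 + (X 3 : Pol) • pderiv 1 - (X 1 : Pol) • pderiv 3

/-- The derivative along `x ↦ k x`. -/
def lv3 : Derivation ℝ Pol Pol :=
  (X 0 : Pol) • pderiv 3 - (X 3 : Pol) • pderiv 0 + (X 1 : Pol) • pderiv 2 - (X 2 : Pol) • pderiv 1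

theorem lv1_apply (p : Pol) : lv1 p =
    X 0 * pderiv 1 p - X 1 * pderiv 0 p + X 2 * pderiv 3 p - X 3 * pderiv 2 p := rfl

theorem lv2_apply (p : Pol) : lv2 p =
    X 0 * pderiv 2 p - X 2 * pderiv 0 p + X 3 * pderiv 1 p - X 1 * pderiv 3 p := rfl

theorem lv3_apply (p : Pol) : lv3 p =
    X 0 * pderiv 3 p - X 3 * pderiv 0 p + X 1 * pderiv 2 p - X 2 * pderiv 1 p := rfl

theorem lv1_X (i : Fin 4) : lv1 (X i) = ![-X 1, X 0, -X 3, X 2] i := by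
  fin_cases i <;> simp [lv1_apply, pderiv_X]

theorem lv2_X (i : Fin 4) : lv2 (X i) = ![-X 2, X 3, X 0, -X 1] i := by
  fin_cases i <;> simp [lv2_apply, pderiv_X]

theorem lv3_X (i : Fin 4) : lv3 (X i) = ![-X 3, -X 2, X 1, X 0] i := by
  fin_cases i <;> simp [lv3_apply, pderiv_X]

theorem lv12 (p : Pol) : lv1 (lv2 p) = lv2 (lv1 p) - 2 * lv3 p := by
  have : ⁅lv1, lv2⁆ = -(2 : Pol) • lv3 := by
    refine MvPolynomial.derivation_ext fun k => ?_
    fin_cases k <;> simp [Derivation.commutator_apply, lv1_X, lv2_X, lv3_X] <;> ring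
  have h := DFunLike.congr_fun this p
  rw [Derivation.commutator_apply] at h
  have h' : lv1 (lv2 p) - lv2 (lv1 p) = -2 * lv3 p := h
  linear_combination h'

theorem lv23 (p : Pol) : lv2 (lv3 p) = lv3 (lv2 p) - 2 * lv1 p := by
  have : ⁅lv2, lv3⁆ = -(2 : Pol) • lv1 := by
    refine MvPolynomial.derivation_ext fun k => ?_
    fin_cases k <;> simp [Derivation.commutator_apply, lv1_X, lv2_X, lv3_X] <;> ring
  have h := DFunLike.congr_fun this p
  rw [Derivation.commutator_apply] at h
  have h' : lv2 (lv3 p) - lv3 (lv2 p) = -2 * lv1 p := h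
  linear_combination h'

theorem lv31 (p : Pol) : lv3 (lv1 p) = lv1 (lv3 p) - 2 * lv2 p := by
  have : ⁅lv3, lv1⁆ = -(2 : Pol) • lv2 := by
    refine MvPolynomial.derivation_ext fun k => ?_
    fin_cases k <;> simp [Derivation.commutator_apply, lv1_X, lv2_X, lv3_X] <;> ring
  have h := DFunLike.congr_fun this p
  rw [Derivation.commutator_apply] at h
  have h' : lv3 (lv1 p) - lv1 (lv3 p) = -2 * lv2 p := h
  linear_combination h'

/-- The Laplacian. -/
def lap : Pol →ₗ[ℝ] Pol := ∑ i, (pderiv i).toLinearMap ∘ₗ (pderiv i).toLinearMap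

theorem lap_apply (p : Pol) : lap p = pderiv 0 (pderiv 0 p) + pderiv 1 (pderiv 1 p) +
    pderiv 2 (pderiv 2 p) + pderiv 3 (pderiv 3 p) := by
  simp [lap, Fin.sum_univ_four]

/-- The squared norm. -/
def rsq : Pol := X 0 * X 0 + X 1 * X 1 + X 2 * X 2 + X 3 * X 3

/-- Harmonic homogeneous polynomials. -/
def harmP (n : ℕ) : Submodule ℝ Pol := homogeneousSubmodule (Fin 4) ℝ n ⊓ LinearMap.ker lap

theorem mem_harmP {n : ℕ} {p : Pol} : p ∈ harmP n ↔ p.IsHomogeneous n ∧ lap p = 0 := by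
  simp [harmP, Submodule.mem_inf, mem_homogeneousSubmodule]

instance (n : ℕ) : FiniteDimensional ℝ (harmP n) := by
  have : FiniteDimensional ℝ (homogeneousSubmodule (Fin 4) ℝ n) :=
    Module.Finite.iff_fg.2 (homogeneousSubmodule_fg _ _ n)
  exact Submodule.finiteDimensional_inf_left _ _

theorem euler {n : ℕ} {p : Pol} (h : p.IsHomogeneous n) :
    X 0 * pderiv 0 p + X 1 * pderiv 1 p + X 2 * pderiv 2 p + X 3 * pderiv 3 p =
      (n : Pol) * p := by
  have := h.sum_X_mul_pderiv
  rwa [Fin.sum_univ_four, nsmul_eq_mul] at this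

theorem lap_pderiv (i : Fin 4) (p : Pol) : lap (pderiv i p) = pderiv i (lap p) := by
  simp only [lap_apply, map_add]
  simp only [pderiv_comm' i]

theorem lap_X_mul (i : Fin 4) (p : Pol) : lap (X i * p) = X i * lap p + 2 * pderiv i p := by
  fin_cases i <;>
  · simp [lap_apply, pderiv_X]
    ring

theorem pderiv_mem_harmP {n : ℕ} {p : Pol} (h : p ∈ harmP n) (i : Fin 4) :
    pderiv i p ∈ harmP (n - 1) := by
  rw [mem_harmP] at *
  exact ⟨h.1.pderiv, by rw [lap_pderiv, h.2, map_zero]⟩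

theorem pderiv_harmP_zero {p : Pol} (h : p ∈ harmP 0) (i : Fin 4) : pderiv i p = 0 := by
  rw [mem_harmP, ← totalDegree_zero_iff_isHomogeneous, totalDegree_eq_zero_iff_eq_C] at h
  rw [h.1, pderiv_C]

theorem isHomogeneous_X_mul_pderiv {n : ℕ} {p : Pol} (h : p.IsHomogeneous n) (i j : Fin 4) :
    (X i * pderiv j p).IsHomogeneous n := by
  obtain _ | n := n
  · rw [pderiv_harmP_zero (mem_harmP.2 ⟨h, ?_⟩), mul_zero]
    · exact isHomogeneous_zero _ _ _
    · rw [← totalDegree_zero_iff_isHomogeneous, totalDegree_eq_zero_iff_eq_C] at h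
      rw [h]
      simp [lap_apply]
  · have := (isHomogeneous_X ℝ i).mul (h.pderiv (i := j))
    rwa [add_comm, Nat.add_sub_cancel] at this

theorem lv_mem_harmP {n : ℕ} {p : Pol} (h : p ∈ harmP n) :
    lv1 p ∈ harmP n ∧ lv2 p ∈ harmP n ∧ lv3 p ∈ harmP n := by
  rw [mem_harmP] at h
  have h1 := isHomogeneous_X_mul_pderiv h.1
  have h0 := fun i => lap_pderiv i p
  simp only [h.2, map_zero] at h0
  simp only [mem_harmP, lv1_apply, lv2_apply, lv3_apply, map_add, map_sub, lap_X_mul, h0]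
  refine ⟨⟨(((h1 _ _).sub (h1 _ _)).add (h1 _ _)).sub (h1 _ _), ?_⟩,
    ⟨(((h1 _ _).sub (h1 _ _)).add (h1 _ _)).sub (h1 _ _), ?_⟩,
    ⟨(((h1 _ _).sub (h1 _ _)).add (h1 _ _)).sub (h1 _ _), ?_⟩⟩
  · rw [pderiv_comm' 0 1, pderiv_comm' 2 3]; ring
  · rw [pderiv_comm' 0 2, pderiv_comm' 3 1]; ring
  · rw [pderiv_comm' 0 3, pderiv_comm' 1 2]; ring

theorem lv_sq {n : ℕ} {p : Pol} (h : p ∈ harmP n) :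
    lv1 (lv1 p) + lv2 (lv2 p) + lv3 (lv3 p) = -((n : Pol) * (n + 2)) * p := by
  rw [mem_harmP] at h
  have hE := euler h.1
  have hj : ∀ j, pderiv j (X 0 * pderiv 0 p + X 1 * pderiv 1 p + X 2 * pderiv 2 p +
    X 3 * pderiv 3 p) = (n : Pol) * pderiv j p := fun j => by
      rw [hE, ← nsmul_eq_mul, ← nsmul_eq_mul, map_nsmul]
  have h0 := hj 0
  have h1 := hj 1
  have h2 := hj 2
  have h3 := hj 3
  have hl := h.2
  simp [pderiv_X] at h0 h1 h2 h3
  simp only [lap_apply] at hl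
  simp [lv1_apply, lv2_apply, lv3_apply, pderiv_X]
  simp only [pderiv_comm' 1 0, pderiv_comm' 2 0, pderiv_comm' 3 0, pderiv_comm' 2 1,
    pderiv_comm' 3 1, pderiv_comm' 3 2] at *
  linear_combination (X 0 ^ 2 + X 1 ^ 2 + X 2 ^ 2 + X 3 ^ 2) * hl - X 0 * h0 - X 1 * h1
    - X 2 * h2 - X 3 * h3 - (n + 2 : Pol) * hE

theorem lap_rsq_mul {n : ℕ} {p : Pol} (h : p ∈ harmP n) :
    lap (rsq * p) = (4 * n + 8 : Pol) * p := by
  rw [mem_harmP] at h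
  have hE := euler h.1
  have hl := h.2
  simp only [lap_apply] at hl
  simp [lap_apply, rsq, pderiv_X]
  linear_combination (X 0 ^ 2 + X 1 ^ 2 + X 2 ^ 2 + X 3 ^ 2) * hl + 4 * hE

theorem exists_X_mul {n : ℕ} {p : Pol} (h : p ∈ harmP n) (a : Fin 4) :
    ∃ w, w = ((2 * (n + 1) : ℝ)⁻¹) • pderiv a p ∧ w ∈ harmP (n - 1) ∧ (n = 0 → w = 0) ∧
      X a * p - rsq * w ∈ harmP (n + 1) := by
  refine ⟨_, rfl, (harmP _).smul_mem _ (pderiv_mem_harmP h a), ?_, ?_⟩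
  · rintro rfl
    rw [pderiv_harmP_zero h, smul_zero]
  · have hw := pderiv_mem_harmP h a
    obtain _ | n := n
    · rw [pderiv_harmP_zero h, smul_zero, mul_zero, sub_zero, mem_harmP, lap_X_mul,
        pderiv_harmP_zero h, (mem_harmP.1 h).2]
      rw [add_comm]
      exact ⟨(isHomogeneous_X ℝ a).mul (mem_harmP.1 h).1, by simp⟩
    · have hr : rsq.IsHomogeneous 2 := by
        have := fun i : Fin 4 => (isHomogeneous_X ℝ i).mul (isHomogeneous_X ℝ i)
        exact (((this 0).add (this 1)).add (this 2)).add (this 3)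
      rw [Nat.add_sub_cancel] at hw
      rw [mem_harmP, mul_smul_comm]
      refine ⟨?_, ?_⟩
      · refine IsHomogeneous.sub ?_ ?_
        · have := (isHomogeneous_X ℝ a).mul (mem_harmP.1 h).1
          rwa [add_comm] at this
        · rw [← mem_homogeneousSubmodule]
          refine Submodule.smul_mem _ _ ?_
          have := hr.mul (mem_harmP.1 hw).1
          rw [mem_homogeneousSubmodule]
          rwa [show 2 + n = n + 1 + 1 by ring] at this
      · rw [map_sub, map_smul, lap_rsq_mul hw, lap_X_mul, (mem_harmP.1 h).2]
        have h2 : (4 * n + 8 : Pol) = C (4 * n + 8 : ℝ) := by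
          rw [C_add, C_mul]; rfl
        have h3 : (2 : Pol) = C (2 : ℝ) := rfl
        rw [h2, h3, C_mul', C_mul', smul_smul, mul_zero, zero_add, ← sub_smul]
        have : (2 : ℝ) - (2 * (((n + 1 : ℕ) : ℝ) + 1))⁻¹ * (4 * n + 8) = 0 := by
          push_cast
          field_simp
          ring
        rw [this, zero_smul]

end QPol

end Harmonic

section Dirac

open MvPolynomial

namespace QPol

/-- The quaternionic polynomial with given components. -/
def mk4 (a b c d : Pol) : QPol := ⟨a, b, c, d⟩

@[simp] theorem mk4_re (a b c d : Pol) : (mk4 a b c d).re = a := rfl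

@[simp] theorem mk4_imI (a b c d : Pol) : (mk4 a b c d).imI = b := rfl

@[simp] theorem mk4_imJ (a b c d : Pol) : (mk4 a b c d).imJ = c := rfl

@[simp] theorem mk4_imK (a b c d : Pol) : (mk4 a b c d).imK = d := rfl

/-- The operator `h ↦ h + i ∂₁h + j ∂₂h + k ∂₃h`, with `∂ₐ` the derivatives along
`x ↦ i x, j x, k x`. -/
def dir : QPol →ₗ[ℝ] QPol where
  toFun h :=
    mk4 (h.re - lv1 h.imI - lv2 h.imJ - lv3 h.imK) (h.imI + lv1 h.re + lv2 h.imK - lv3 h.imJ)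
      (h.imJ - lv1 h.imK + lv2 h.re + lv3 h.imI) (h.imK + lv1 h.imJ - lv2 h.imI + lv3 h.re)
  map_add' h g := by
    ext1 <;> simp <;> ring
  map_smul' c h := by
    ext1 <;> simp <;> module

theorem dir_apply (h : QPol) : dir h =
    mk4 (h.re - lv1 h.imI - lv2 h.imJ - lv3 h.imK) (h.imI + lv1 h.re + lv2 h.imK - lv3 h.imJ)
      (h.imJ - lv1 h.imK + lv2 h.re + lv3 h.imI) (h.imK + lv1 h.imJ - lv2 h.imI + lv3 h.re) := rfl

/-- Harmonic homogeneous quaternionic polynomials. -/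
def harm (n : ℕ) : Submodule ℝ QPol where
  carrier := {h | h.re ∈ harmP n ∧ h.imI ∈ harmP n ∧ h.imJ ∈ harmP n ∧ h.imK ∈ harmP n}
  add_mem' := fun h g => ⟨add_mem h.1 g.1, add_mem h.2.1 g.2.1, add_mem h.2.2.1 g.2.2.1,
    add_mem h.2.2.2 g.2.2.2⟩
  zero_mem' := ⟨zero_mem _, zero_mem _, zero_mem _, zero_mem _⟩
  smul_mem' := fun c _ h => ⟨Submodule.smul_mem _ c h.1, Submodule.smul_mem _ c h.2.1,
    Submodule.smul_mem _ c h.2.2.1, Submodule.smul_mem _ c h.2.2.2⟩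

theorem mem_harm {n : ℕ} {h : QPol} : h ∈ harm n ↔
    h.re ∈ harmP n ∧ h.imI ∈ harmP n ∧ h.imJ ∈ harmP n ∧ h.imK ∈ harmP n := Iff.rfl

instance (n : ℕ) : FiniteDimensional ℝ (harm n) := by
  let f : harm n →ₗ[ℝ] (harmP n × harmP n) × (harmP n × harmP n) :=
    { toFun := fun h => ((⟨_, h.2.1⟩, ⟨_, h.2.2.1⟩), (⟨_, h.2.2.2.1⟩, ⟨_, h.2.2.2.2⟩))
      map_add' := fun _ _ => rfl
      map_smul' := fun _ _ => rfl }
  refine FiniteDimensional.of_injective f fun h g hfg => ?_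
  exact Subtype.ext (QuaternionAlgebra.ext (congrArg (fun z => (z.1.1 : Pol)) hfg)
    (congrArg (fun z => (z.1.2 : Pol)) hfg) (congrArg (fun z => (z.2.1 : Pol)) hfg)
    (congrArg (fun z => (z.2.2 : Pol)) hfg))

theorem dir_mem_harm {n : ℕ} {h : QPol} (hh : h ∈ harm n) : dir h ∈ harm n := by
  obtain ⟨h0, h1, h2, h3⟩ := hh
  have k0 := lv_mem_harmP h0
  have k1 := lv_mem_harmP h1
  have k2 := lv_mem_harmP h2
  have k3 := lv_mem_harmP h3
  exact ⟨sub_mem (sub_mem (sub_mem h0 k1.1) k2.2.1) k3.2.2,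
    sub_mem (add_mem (add_mem h1 k0.1) k3.2.1) k2.2.2,
    add_mem (add_mem (sub_mem h2 k3.1) k0.2.1) k1.2.2,
    add_mem (sub_mem (add_mem h3 k2.1) k1.2.1) k0.2.2⟩

theorem star_mem_harm {n : ℕ} {h : QPol} (hh : h ∈ harm n) : star h ∈ harm n := by
  obtain ⟨h0, h1, h2, h3⟩ := hh
  refine ⟨?_, ?_, ?_, ?_⟩
  · simpa using h0
  · simpa using h1
  · simpa using h2
  · simpa using h3

theorem dir_dir {n : ℕ} {h : QPol} (hh : h ∈ harm n) :
    dir (dir h) = ((n + 1 : ℝ) ^ 2) • h := by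
  obtain ⟨h0, h1, h2, h3⟩ := hh
  have k0 := lv_sq h0
  have k1 := lv_sq h1
  have k2 := lv_sq h2
  have k3 := lv_sq h3
  have hc : ∀ p : Pol, ((n + 1 : ℝ) ^ 2) • p = (n + 1 : Pol) ^ 2 * p := fun p => by
    rw [← C_mul', C_pow, C_add]; rfl
  ext1 <;> simp only [Quaternion.re_smul, Quaternion.imI_smul, Quaternion.imJ_smul,
    Quaternion.imK_smul, hc] <;> simp only [dir_apply, mk4_re, mk4_imI, mk4_imJ, mk4_imK, map_add, map_sub,
    lv12, lv23, lv31] <;> [linear_combination -k0; linear_combination -k1;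
    linear_combination -k2; linear_combination -k3]

/-- The pointwise inner product. -/
def pr (h g : QPol) : Pol := h.re * g.re + h.imI * g.imI + h.imJ * g.imJ + h.imK * g.imK

theorem pr_dir (h g : QPol) : ∃ p q r : Pol,
    pr (dir h) g = pr h (dir g) + lv1 p + lv2 q + lv3 r := by
  refine ⟨-pr h (mk4 0 1 0 0 * g), -pr h (mk4 0 0 1 0 * g), -pr h (mk4 0 0 0 1 * g), ?_⟩
  simp [pr, dir_apply, Derivation.leibniz]
  ring

theorem dir_smul (p : Pol) (h : QPol) :
    dir (p • h) = p • dir h + mk4 0 (lv1 p) (lv2 p) (lv3 p) * h := by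
  ext1 <;> simp [dir_apply, Derivation.leibniz] <;> ring

theorem lv_rsq : lv1 rsq = 0 ∧ lv2 rsq = 0 ∧ lv3 rsq = 0 := by
  refine ⟨?_, ?_, ?_⟩ <;> simp [rsq, lv1_X, lv2_X, lv3_X] <;> ring

theorem dir_rsq_smul (h : QPol) : dir (rsq • h) = rsq • dir h := by
  rw [dir_smul, lv_rsq.1, lv_rsq.2.1, lv_rsq.2.2]
  have : mk4 0 0 0 0 = 0 := rfl
  rw [this, zero_mul, add_zero]

/-- The identity function. -/
def xq : QPol := mk4 (X 0) (X 1) (X 2) (X 3)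

/-- Constant functions. -/
def cst (c : Quaternion ℝ) : QPol := mk4 (C c.re) (C c.imI) (C c.imJ) (C c.imK)

theorem dir_mul_xq (h : QPol) : dir (h * xq) = (dir h - h - (2 : ℝ) • star h) * xq := by
  have h2 : ∀ p : Pol, (2 : ℝ) • p = 2 * p := fun p => by rw [← C_mul']; rfl
  ext1 <;> simp [dir_apply, xq, Derivation.leibniz, lv1_X, lv2_X, lv3_X, h2] <;> ring

theorem dir_mul_cst (h : QPol) (c : Quaternion ℝ) : dir (h * cst c) = dir h * cst c := by
  ext1 <;> simp [dir_apply, cst, Derivation.leibniz] <;> ring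

theorem mul_cst_mem_harm {n : ℕ} {h : QPol} (hh : h ∈ harm n) (c : Quaternion ℝ) :
    h * cst c ∈ harm n := by
  obtain ⟨h0, h1, h2, h3⟩ := hh
  have k : ∀ (p : Pol) (r : ℝ), p ∈ harmP n → p * C r ∈ harmP n := fun p r hp => by
    rw [mul_comm, C_mul']; exact Submodule.smul_mem _ _ hp
  rw [mem_harm]
  simp only [cst, mk4_re, mk4_imI, mk4_imJ, mk4_imK, Quaternion.re_mul,
    Quaternion.imI_mul, Quaternion.imJ_mul, Quaternion.imK_mul]
  exact ⟨sub_mem (sub_mem (sub_mem (k _ _ h0) (k _ _ h1)) (k _ _ h2)) (k _ _ h3),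
    sub_mem (add_mem (add_mem (k _ _ h0) (k _ _ h1)) (k _ _ h2)) (k _ _ h3),
    add_mem (add_mem (sub_mem (k _ _ h0) (k _ _ h1)) (k _ _ h2)) (k _ _ h3),
    add_mem (sub_mem (add_mem (k _ _ h0) (k _ _ h1)) (k _ _ h2)) (k _ _ h3)⟩

/-- The eigenspaces of `dir` on harmonic homogeneous polynomials. -/
def eig (l : ℤ) : Submodule ℝ QPol :=
  harm (l.natAbs - 1) ⊓ LinearMap.ker (dir - (l : ℝ) • LinearMap.id)

theorem mem_eig {l : ℤ} {h : QPol} :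
    h ∈ eig l ↔ h ∈ harm (l.natAbs - 1) ∧ dir h = (l : ℝ) • h := by
  simp [eig, sub_eq_zero]

theorem eig_zero : eig 0 = ⊥ := by
  rw [eq_bot_iff]
  intro h hh
  rw [mem_eig] at hh
  have := dir_dir hh.1
  rw [hh.2] at this
  rw [map_smul, hh.2, Int.cast_zero, zero_smul ℝ h, smul_zero] at this
  have h2 : h = (1 : ℝ) • h := (one_smul ℝ h).symm
  rw [h2]
  simpa using this.symm

instance (l : ℤ) : FiniteDimensional ℝ (eig l) := Submodule.finiteDimensional_inf_left _ _

theorem mul_cst_mem_eig {l : ℤ} {h : QPol} (hh : h ∈ eig l) (c : Quaternion ℝ) :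
    h * cst c ∈ eig l := by
  rw [mem_eig] at *
  refine ⟨mul_cst_mem_harm hh.1 c, ?_⟩
  rw [dir_mul_cst, hh.2]
  ext1 <;> simp [smul_sub, smul_add]

theorem exists_eig_add {n : ℕ} {h : QPol} (hh : h ∈ harm n) :
    ∃ u ∈ eig (n + 1), ∃ w ∈ eig (-(n + 1)), h = u + w := by
  have hn : (n + 1 : ℝ) ≠ 0 := by positivity
  have h1 : ((n + 1 : ℤ)).natAbs - 1 = n := by omega
  have h2 : (-(n + 1 : ℤ)).natAbs - 1 = n := by omega
  refine ⟨(2 : ℝ)⁻¹ • h + ((2 : ℝ)⁻¹ * (n + 1 : ℝ)⁻¹) • dir h, ?_,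
    (2 : ℝ)⁻¹ • h - ((2 : ℝ)⁻¹ * (n + 1 : ℝ)⁻¹) • dir h, ?_, ?_⟩
  · rw [mem_eig, h1]
    refine ⟨add_mem (Submodule.smul_mem _ _ hh) (Submodule.smul_mem _ _ (dir_mem_harm hh)), ?_⟩
    rw [map_add, map_smul, map_smul, dir_dir hh, smul_add, smul_smul, smul_smul, smul_smul, add_comm]
    push_cast
    congr 2 <;> field_simp
  · rw [mem_eig, h2]
    refine ⟨sub_mem (Submodule.smul_mem _ _ hh) (Submodule.smul_mem _ _ (dir_mem_harm hh)), ?_⟩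
    rw [map_sub, map_smul, map_smul, dir_dir hh, smul_sub, smul_smul, smul_smul, smul_smul]
    push_cast
    have e : (2 : ℝ)⁻¹ * (n + 1 : ℝ)⁻¹ * (n + 1) ^ 2 = (n + 1) * 2⁻¹ := by field_simp
    rw [e, show -((n : ℝ) + 1) * (2⁻¹ * (n + 1 : ℝ)⁻¹) = -2⁻¹ by field_simp]
    module
  · module

theorem exists_X_smul {n : ℕ} {h : QPol} (hh : h ∈ harm n) (a : Fin 4) :
    ∃ u ∈ harm (n + 1), ∃ w ∈ harm (n - 1), (n = 0 → w = 0) ∧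
      (X a : Pol) • h = u + rsq • w := by
  obtain ⟨h0, h1, h2, h3⟩ := hh
  obtain ⟨w0, -, k0, l0, m0⟩ := exists_X_mul h0 a
  obtain ⟨w1, -, k1, l1, m1⟩ := exists_X_mul h1 a
  obtain ⟨w2, -, k2, l2, m2⟩ := exists_X_mul h2 a
  obtain ⟨w3, -, k3, l3, m3⟩ := exists_X_mul h3 a
  refine ⟨(X a : Pol) • h - rsq • mk4 w0 w1 w2 w3, ⟨m0, m1, m2, m3⟩, mk4 w0 w1 w2 w3,
    ⟨k0, k1, k2, k3⟩, fun hn => ?_, ?_⟩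
  · rw [l0 hn, l1 hn, l2 hn, l3 hn]; rfl
  · rw [sub_add_cancel]

theorem exists_eig_X_smul {n : ℕ} {h : QPol} (hh : h ∈ harm n) (a : Fin 4) :
    ∃ y₁ ∈ eig (n + 2), ∃ y₂ ∈ eig (-(n + 2)), ∃ y₃ ∈ eig n, ∃ y₄ ∈ eig (-n),
      (X a : Pol) • h = y₁ + y₂ + rsq • (y₃ + y₄) := by
  obtain ⟨u, hu, w, hw, h0, he⟩ := exists_X_smul hh a
  obtain ⟨y₁, h₁, y₂, h₂, rfl⟩ := exists_eig_add hu
  have e : ((n + 1 : ℕ) : ℤ) + 1 = n + 2 := by push_cast; ring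
  rw [e] at h₁ h₂
  rcases Nat.eq_zero_or_pos n with rfl | hn
  · rw [h0 rfl] at he
    exact ⟨y₁, h₁, y₂, h₂, 0, zero_mem _, 0, zero_mem _, by rw [he, add_zero]⟩
  · obtain ⟨y₃, h₃, y₄, h₄, rfl⟩ := exists_eig_add hw
    have e : ((n - 1 : ℕ) : ℤ) + 1 = n := by omega
    rw [e] at h₃ h₄
    exact ⟨y₁, h₁, y₂, h₂, y₃, h₃, y₄, h₄, he⟩

end QPol

end Dirac

section LTwo

open MeasureTheory Quaternion

/-- The group of unit quaternions. -/
abbrev S3 := Metric.sphere (0 : Quaternion ℝ) 1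

/-- The compact group `S¹ × S¹ × S³`. -/
def TTS := Circle × Circle × S3

namespace TTS

instance : TopologicalSpace TTS := inferInstanceAs (TopologicalSpace (Circle × Circle × S3))

instance : Group TTS := inferInstanceAs (Group (Circle × Circle × S3))

instance : IsTopologicalGroup TTS := inferInstanceAs (IsTopologicalGroup (Circle × Circle × S3))

instance : CompactSpace TTS := by
  have : ProperSpace (Quaternion ℝ) := FiniteDimensional.proper ℝ _
  exact inferInstanceAs (CompactSpace (Circle × Circle × S3))

instance : T2Space TTS := inferInstanceAs (T2Space (Circle × Circle × S3))

instance : SecondCountableTopology TTS := by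
  have : ProperSpace (Quaternion ℝ) := FiniteDimensional.proper ℝ _
  exact inferInstanceAs (SecondCountableTopology (Circle × Circle × S3))

instance : MeasurableSpace TTS := borel TTS

instance : BorelSpace TTS := ⟨rfl⟩

/-- Haar measure. -/
def vol : Measure TTS := Measure.haar

instance : IsFiniteMeasure vol := inferInstanceAs (IsFiniteMeasure (Measure.haar (G := TTS)))

instance : vol.IsMulLeftInvariant :=
  inferInstanceAs (Measure.haar (G := TTS)).IsMulLeftInvariant

instance : vol.Regular := inferInstanceAs (Measure.haar (G := TTS)).Regular

instance : vol.IsOpenPosMeasure := inferInstanceAs (Measure.haar (G := TTS)).IsOpenPosMeasure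

/-- Quaternion valued square integrable functions. -/
abbrev HH := Lp (Quaternion ℝ) 2 vol

instance : InnerProductSpace ℝ HH := inferInstance

instance : CompleteSpace HH := inferInstance

/-- The inclusion of continuous functions. -/
def toH : C(TTS, Quaternion ℝ) →L[ℝ] HH := ContinuousMap.toLp 2 vol ℝ

theorem coeFn_toH (f : C(TTS, Quaternion ℝ)) : toH f =ᵐ[vol] f :=
  ContinuousMap.coeFn_toLp vol f

theorem denseRange_toH : DenseRange toH :=
  ContinuousMap.toLp_denseRange _ _ _ (by norm_num)

theorem toH_injective : Function.Injective toH := ContinuousMap.toLp_injective vol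

theorem inner_toH (f g : C(TTS, Quaternion ℝ)) : ⟪toH f, toH g⟫ = ∫ x, ⟪f x, g x⟫ ∂vol := by
  rw [L2.inner_def]
  refine integral_congr_ae ?_
  filter_upwards [coeFn_toH f, coeFn_toH g] with x hf hg
  rw [hf, hg]

theorem clm_ext_toH {G : Type*} [NormedAddCommGroup G] [NormedSpace ℝ G] {A B : HH →L[ℝ] G}
    (h : ∀ f, A (toH f) = B (toH f)) : A = B :=
  DFunLike.coe_injective (denseRange_toH.equalizer A.continuous B.continuous (funext h))

theorem inner_ext_toH {A B C D : HH →L[ℝ] HH}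
    (h : ∀ f g, ⟪A (toH f), B (toH g)⟫ = ⟪C (toH f), D (toH g)⟫) (x y : HH) :
    ⟪A x, B y⟫ = ⟪C x, D y⟫ := by
  have h1 : ∀ g x, ⟪A x, B (toH g)⟫ = ⟪C x, D (toH g)⟫ := by
    intro g x
    have : (innerSL ℝ (B (toH g))) ∘L A = (innerSL ℝ (D (toH g))) ∘L C := by
      refine clm_ext_toH fun f => ?_
      simpa only [ContinuousLinearMap.comp_apply, innerSL_apply_apply,
        real_inner_comm] using h f g
    simpa only [ContinuousLinearMap.comp_apply, innerSL_apply_apply,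
      real_inner_comm] using congrArg (fun T => T x) this
  have : (innerSL ℝ (A x)) ∘L B = (innerSL ℝ (C x)) ∘L D := by
    refine clm_ext_toH fun g => ?_
    simpa only [ContinuousLinearMap.comp_apply, innerSL_apply_apply] using h1 g x
  simpa only [ContinuousLinearMap.comp_apply, innerSL_apply_apply]
    using congrArg (fun T => T y) this

/-- Right multiplication by a continuous function. -/
def opR : C(TTS, Quaternion ℝ) →L[ℝ] HH →L[ℝ] HH :=
  ((ContinuousLinearMap.mul ℝ (Quaternion ℝ)).flip.holderL vol ⊤ 2 2) ∘L
    ContinuousMap.toLp ⊤ vol ℝ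

/-- Left multiplication by a continuous function. -/
def opL : C(TTS, Quaternion ℝ) →L[ℝ] HH →L[ℝ] HH :=
  ((ContinuousLinearMap.mul ℝ (Quaternion ℝ)).holderL vol ⊤ 2 2) ∘L
    ContinuousMap.toLp ⊤ vol ℝ

theorem opR_toH (q f : C(TTS, Quaternion ℝ)) : opR q (toH f) = toH (f * q) := by
  refine Lp.ext ?_
  filter_upwards [coeFn_toH f, coeFn_toH (f * q), ContinuousMap.coeFn_toLp (p := ⊤) (𝕜 := ℝ) vol q,
    (ContinuousLinearMap.mul ℝ (Quaternion ℝ)).flip.coeFn_holder (r := 2)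
      (ContinuousMap.toLp ⊤ vol ℝ q) (toH f)] with x h1 h2 h3 h4
  rw [h2]
  refine h4.trans ?_
  rw [h1, h3]
  rfl

theorem opL_toH (q f : C(TTS, Quaternion ℝ)) : opL q (toH f) = toH (q * f) := by
  refine Lp.ext ?_
  filter_upwards [coeFn_toH f, coeFn_toH (q * f), ContinuousMap.coeFn_toLp (p := ⊤) (𝕜 := ℝ) vol q,
    (ContinuousLinearMap.mul ℝ (Quaternion ℝ)).coeFn_holder (r := 2)
      (ContinuousMap.toLp ⊤ vol ℝ q) (toH f)] with x h1 h2 h3 h4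
  rw [h2]
  refine h4.trans ?_
  rw [h1, h3]
  rfl

theorem opR_mul (p q : C(TTS, Quaternion ℝ)) : opR (p * q) = opR q ∘L opR p :=
  clm_ext_toH fun f => by
    rw [ContinuousLinearMap.comp_apply, opR_toH, opR_toH, opR_toH, mul_assoc]

theorem opR_mul_apply (p q : C(TTS, Quaternion ℝ)) (x : HH) :
    opR (p * q) x = opR q (opR p x) := by rw [opR_mul]; rfl

theorem opR_one : opR 1 = 1 := clm_ext_toH fun f => by rw [opR_toH, mul_one]; rfl

theorem inner_opR (q : C(TTS, Quaternion ℝ)) (x y : HH) :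
    ⟪opR q x, y⟫ = ⟪x, opR (star q) y⟫ := by
  refine inner_ext_toH (A := opR q) (B := 1) (C := 1) (D := opR (star q)) (fun f g => ?_) x y
  rw [one_apply_eq_self, one_apply_eq_self, opR_toH, opR_toH, inner_toH, inner_toH]
  refine integral_congr_ae (.of_forall fun x => ?_)
  simp [Quaternion.inner_def, mul_assoc]

/-- Evaluation of a polynomial at a quaternion. -/
def evP (v : Quaternion ℝ) : MvPolynomial (Fin 4) ℝ →ₐ[ℝ] ℝ :=
  MvPolynomial.aeval ![v.re, v.imI, v.imJ, v.imK]

/-- Evaluation of a quaternionic polynomial. -/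
def evQ (v : Quaternion ℝ) (h : QPol) : Quaternion ℝ :=
  ⟨evP v h.re, evP v h.imI, evP v h.imJ, evP v h.imK⟩

section

variable (v : Quaternion ℝ) (h g : QPol)

@[simp] theorem evQ_re : (evQ v h).re = evP v h.re := rfl

@[simp] theorem evQ_imI : (evQ v h).imI = evP v h.imI := rfl

@[simp] theorem evQ_imJ : (evQ v h).imJ = evP v h.imJ := rfl

@[simp] theorem evQ_imK : (evQ v h).imK = evP v h.imK := rfl

theorem evQ_add : evQ v (h + g) = evQ v h + evQ v g := by ext <;> simp

theorem evQ_mul : evQ v (h * g) = evQ v h * evQ v g := by ext <;> simp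

theorem evQ_smul (c : ℝ) : evQ v (c • h) = c • evQ v h := by ext <;> simp

theorem evQ_psmul (p : Pol) : evQ v (p • h) = evP v p • evQ v h := by ext <;> simp

theorem evP_X (a : Fin 4) : evP v (MvPolynomial.X a) = ![v.re, v.imI, v.imJ, v.imK] a := by
  simp [evP]

theorem evQ_xq : evQ v QPol.xq = v := by
  ext <;> simp [QPol.xq, evP]

theorem evQ_cst (c : Quaternion ℝ) : evQ v (QPol.cst c) = c := by
  ext <;> simp [QPol.cst, evP]

theorem evP_rsq (hv : v ∈ S3) : evP v QPol.rsq = 1 := by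
  have : normSq v = 1 := by
    rw [normSq_eq_norm_mul_self, mem_sphere_zero_iff_norm.1 hv, one_mul]
  rw [normSq_def'] at this
  simp only [QPol.rsq, map_add, map_mul, evP_X]
  simpa [pow_two] using this

theorem inner_evQ : ⟪evQ v h, evQ v g⟫ = evP v (QPol.pr h g) := by
  simp [Quaternion.inner_def, QPol.pr]

end

theorem continuous_evP (p : Pol) : Continuous fun v => evP v p := by
  induction p using MvPolynomial.induction_on with
  | C r => simpa [evP] using continuous_const
  | add p q hp hq => simp only [map_add]; exact hp.add hq
  | mul_X p a hp =>
    simp only [map_mul]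
    refine hp.mul ?_
    simp only [evP_X]
    fin_cases a
    · exact continuous_re
    · exact continuous_imI
    · exact continuous_imJ
    · exact continuous_imK

theorem continuous_quaternion {Y : Type*} [TopologicalSpace Y] {f : Y → Quaternion ℝ}
    (h0 : Continuous fun y => (f y).re) (h1 : Continuous fun y => (f y).imI)
    (h2 : Continuous fun y => (f y).imJ) (h3 : Continuous fun y => (f y).imK) :
    Continuous f := by
  rw [← linearIsometryEquivTuple.toHomeomorph.comp_continuous_iff]
  refine (PiLp.continuous_toLp 2 _).comp (continuous_pi fun i => ?_)
  fin_cases i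
  · exact h0
  · exact h1
  · exact h2
  · exact h3

theorem continuous_evQ (h : QPol) : Continuous fun v => evQ v h :=
  continuous_quaternion (continuous_evP _) (continuous_evP _) (continuous_evP _) (continuous_evP _)

theorem continuous_coeComplex : Continuous fun z : ℂ => (z : Quaternion ℝ) :=
  continuous_quaternion Complex.continuous_re Complex.continuous_im continuous_const
    continuous_const

end TTS

end LTwo

section Decomposition

open MeasureTheory Quaternion

namespace TTS

/-- The quaternion with given components. -/
def hq (a b c d : ℝ) : Quaternion ℝ := ⟨a, b, c, d⟩

@[simp] theorem hq_re (a b c d : ℝ) : (hq a b c d).re = a := rfl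

@[simp] theorem hq_imI (a b c d : ℝ) : (hq a b c d).imI = b := rfl

@[simp] theorem hq_imJ (a b c d : ℝ) : (hq a b c d).imJ = c := rfl

@[simp] theorem hq_imK (a b c d : ℝ) : (hq a b c d).imK = d := rfl

theorem hasDerivAt_evP {v : ℝ → Quaternion ℝ} (D : Derivation ℝ Pol Pol)
    (h : ∀ t a, HasDerivAt (fun t => evP (v t) (MvPolynomial.X a)) (evP (v t) (D (MvPolynomial.X a))) t)
    (p : Pol) (t : ℝ) : HasDerivAt (fun t => evP (v t) p) (evP (v t) (D p)) t := by
  induction p using MvPolynomial.induction_on with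
  | C r =>
    have e : D (MvPolynomial.C r) = 0 := Derivation.map_algebraMap D r
    rw [e, map_zero]
    have : (fun t => evP (v t) (MvPolynomial.C r)) = fun _ => r := by
      funext t; simp [evP]
    rw [this]
    exact hasDerivAt_const _ _
  | add p q hp hq =>
    simp only [map_add]
    exact hp.add hq
  | mul_X p a hp =>
    simp only [map_mul, Derivation.leibniz, map_add, smul_eq_mul]
    refine (hp.mul (h t a)).congr_deriv ?_
    ring

/-- The point `(ω₁, ω₂, x)`. -/
def pt (z₁ z₂ : Circle) (x : S3) : TTS := (z₁, z₂, x)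

/-- The polynomial function on the last factor. -/
def lastP (p : Pol) : C(TTS, ℝ) :=
  ⟨fun x => evP (x.2.2 : Quaternion ℝ) p,
    (continuous_evP p).comp (continuous_subtype_val.comp (continuous_snd.comp continuous_snd))⟩

theorem integrable_cont {E : Type*} [NormedAddCommGroup E] (f : C(TTS, E)) : Integrable f vol :=
  f.continuous.integrable_of_hasCompactSupport (HasCompactSupport.of_compactSpace f)

theorem integral_deriv_eq_zero (D : Derivation ℝ Pol Pol) (e : Quaternion ℝ) (he : ‖e‖ = 1)
    (hre : e.re = 0)
    (hD : ∀ (v : Quaternion ℝ) (a : Fin 4), evP v (D (MvPolynomial.X a)) =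
      ![(e * v).re, (e * v).imI, (e * v).imJ, (e * v).imK] a) (p : Pol) :
    ∫ x, lastP (D p) x ∂vol = 0 := by
  have hee : e * e = -1 := by
    have h1 : star e = -e := by ext <;> simp [hre]
    have h2 : star e * e = 1 := by
      rw [Quaternion.star_mul_self, normSq_eq_norm_mul_self, he]; simp
    rw [h1, neg_mul] at h2
    rw [← h2, neg_neg]
  let g : ℝ → Quaternion ℝ := fun t => (Real.cos t : Quaternion ℝ) + (Real.sin t : Quaternion ℝ) * e
  have hg : ∀ t, g t ∈ S3 := fun t => by
    have h1 : star e = -e := by ext <;> simp [hre]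
    have h2 : normSq (g t) = 1 := by
      have h3 : e.imI ^ 2 + e.imJ ^ 2 + e.imK ^ 2 = 1 := by
        have := normSq_eq_norm_mul_self e
        rw [he, normSq_def', hre] at this
        linarith
      rw [normSq_def']
      simp [g, hre]
      linear_combination Real.sin_sq_add_cos_sq t + (Real.sin t) ^ 2 * h3
    rw [normSq_eq_norm_mul_self] at h2
    rw [mem_sphere_zero_iff_norm]
    nlinarith [norm_nonneg (g t)]
  let G : ℝ → TTS := fun t => pt 1 1 ⟨g t, hg t⟩
  have hGx : ∀ (t : ℝ) (x : TTS), ((G t * x).2.2 : Quaternion ℝ) = g t * x.2.2 := fun t x => rfl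
  have hder : ∀ (x : TTS) (t : ℝ), HasDerivAt (fun t => lastP p (G t * x)) (lastP (D p) (G t * x)) t := by
    intro x t
    refine hasDerivAt_evP (v := fun t => g t * x.2.2) D (fun t a => ?_) p t
    have key : ∀ a b : ℝ, HasDerivAt (fun t => Real.cos t * a + Real.sin t * b)
        (Real.cos t * b - Real.sin t * a) t := fun a b => by
      refine (((Real.hasDerivAt_cos t).mul_const a).add
        ((Real.hasDerivAt_sin t).mul_const b)).congr_deriv ?_
      ring
    obtain ⟨w, hw⟩ : ∃ w : Quaternion ℝ, w = (x.2.2 : Quaternion ℝ) := ⟨_, rfl⟩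
    rw [← hw]
    have h1 : ∀ t, g t * w = Real.cos t • w + Real.sin t • (e * w) := fun t => by
      rw [add_mul, Quaternion.coe_mul_eq_smul, mul_assoc, Quaternion.coe_mul_eq_smul]
    have h2 : e * (g t * w) = Real.cos t • (e * w) - Real.sin t • w := by
      rw [h1, mul_add, mul_smul_comm, mul_smul_comm, ← mul_assoc, hee, neg_one_mul, smul_neg,
        sub_eq_add_neg]
    rw [hD]
    rw [h2]
    simp only [evP_X, h1]
    fin_cases a
    · exact key w.re (e * w).re
    · exact key w.imI (e * w).imI
    · exact key w.imJ (e * w).imJ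
    · exact key w.imK (e * w).imK
  have hsum : ∀ t, ∫ x, lastP p (G t * x) ∂vol = ∫ x, lastP p x ∂vol := fun t =>
    integral_mul_left_eq_self _ _
  have hm := hasDerivAt_integral_of_dominated_loc_of_deriv_le (μ := vol) (x₀ := (0 : ℝ))
    (s := univ) (F := fun t x => lastP p (G t * x)) (F' := fun t x => lastP (D p) (G t * x))
    (bound := fun _ => ‖lastP (D p)‖) Filter.univ_mem
    (.of_forall fun t => ?_) ?_ ?_ (.of_forall fun x t _ => ?_) (integrable_const _)
    (.of_forall fun x t _ => hder x t)
  · have h0 := hm.2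
    simp only [hsum] at h0
    have := h0.unique (hasDerivAt_const _ _)
    rw [← this]
    exact (integral_mul_left_eq_self _ _).symm
  · exact ((lastP p).continuous.comp (continuous_const_mul _)).aestronglyMeasurable
  · exact integrable_cont ((lastP p).comp ⟨_, continuous_const_mul (G 0)⟩)
  · exact ((lastP (D p)).continuous.comp (continuous_const_mul _)).aestronglyMeasurable
  · exact ContinuousMap.norm_coe_le_norm _ _

theorem integral_lv (p : Pol) : ∫ x, lastP (QPol.lv1 p) x ∂vol = 0 ∧
    ∫ x, lastP (QPol.lv2 p) x ∂vol = 0 ∧ ∫ x, lastP (QPol.lv3 p) x ∂vol = 0 := by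
  have hn : ∀ e : Quaternion ℝ, normSq e = 1 → ‖e‖ = 1 := fun e he => by
    rw [normSq_eq_norm_mul_self] at he
    nlinarith [norm_nonneg e]
  refine ⟨integral_deriv_eq_zero QPol.lv1 (hq 0 1 0 0) (hn _ ?_) rfl (fun v a => ?_) p,
    integral_deriv_eq_zero QPol.lv2 (hq 0 0 1 0) (hn _ ?_) rfl (fun v a => ?_) p,
    integral_deriv_eq_zero QPol.lv3 (hq 0 0 0 1) (hn _ ?_) rfl (fun v a => ?_) p⟩
  · simp [normSq_def']
  · fin_cases a <;> simp [QPol.lv1_X, evP]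
  · simp [normSq_def']
  · fin_cases a <;> simp [QPol.lv2_X, evP]
  · simp [normSq_def']
  · fin_cases a <;> simp [QPol.lv3_X, evP]

theorem integral_pr_dir (h g : QPol) :
    ∫ x, lastP (QPol.pr (QPol.dir h) g) x ∂vol = ∫ x, lastP (QPol.pr h (QPol.dir g)) x ∂vol := by
  obtain ⟨p, q, r, e⟩ := QPol.pr_dir h g
  have hs : ∀ x, lastP (QPol.pr (QPol.dir h) g) x = lastP (QPol.pr h (QPol.dir g)) x +
      lastP (QPol.lv1 p) x + lastP (QPol.lv2 q) x + lastP (QPol.lv3 r) x := fun x => by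
    simp [lastP, e]
  simp only [hs]
  rw [integral_add, integral_add, integral_add, (integral_lv p).1, (integral_lv q).2.1,
    (integral_lv r).2.2, add_zero, add_zero, add_zero]
  · exact integrable_cont _
  · exact integrable_cont _
  · exact integrable_cont (lastP _ + lastP _)
  · exact integrable_cont _
  · exact integrable_cont (lastP _ + lastP _ + lastP _)
  · exact integrable_cont _

/-- The quaternion valued polynomial function on the last factor. -/
def lastQ (h : QPol) : C(TTS, Quaternion ℝ) :=
  ⟨fun x => evQ (x.2.2 : Quaternion ℝ) h,
    (continuous_evQ h).comp (continuous_subtype_val.comp (continuous_snd.comp continuous_snd))⟩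

theorem continuous_circle_coe : Continuous fun z : Circle => (z : ℂ) := continuous_subtype_val

/-- The character of the torus, as a function with quaternion values. -/
def chr (k : ℤ × ℤ) : C(TTS, Quaternion ℝ) :=
  ⟨fun x => (((x.1 ^ k.1 * x.2.1 ^ k.2 : Circle) : ℂ) : Quaternion ℝ),
    continuous_coeComplex.comp <| continuous_circle_coe.comp <|
      ((continuous_zpow k.1).comp continuous_fst).mul
        ((continuous_zpow k.2).comp (continuous_fst.comp continuous_snd))⟩

/-- The function `x ↦ h(x) ω₁ ^ k₁ ω₂ ^ k₂`, as an element of `HH`. -/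
def bas (k : ℤ × ℤ) : QPol →ₗ[ℝ] HH where
  toFun h := toH (lastQ h * chr k)
  map_add' h g := by
    rw [← map_add, ← add_mul]
    congr 2
    ext1 x
    exact evQ_add _ _ _
  map_smul' c h := by
    rw [RingHom.id_apply, ← map_smul, ← smul_mul_assoc]
    congr 2
    ext1 x
    exact evQ_smul _ _ _

theorem bas_apply (k : ℤ × ℤ) (h : QPol) : bas k h = toH (lastQ h * chr k) := rfl

theorem lastQ_mul (h g : QPol) : lastQ (h * g) = lastQ h * lastQ g := by
  ext1 x
  exact evQ_mul _ _ _

theorem lastQ_rsq (h : QPol) : lastQ (QPol.rsq • h) = lastQ h := by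
  ext1 x
  exact (evQ_psmul _ _ _).trans (by rw [evP_rsq _ x.2.2.2, one_smul]; rfl)

theorem bas_rsq (k : ℤ × ℤ) (h : QPol) : bas k (QPol.rsq • h) = bas k h := by
  rw [bas_apply, bas_apply, lastQ_rsq]

theorem chr_mul_circle (k : ℤ × ℤ) (x : TTS) (z : Circle) : chr k x * ((z : ℂ) : Quaternion ℝ) =
    (((x.1 ^ k.1 * x.2.1 ^ k.2 * z : Circle) : ℂ) : Quaternion ℝ) := by
  rw [Circle.coe_mul _ z, coeComplex_mul]
  rfl

theorem chr_add (k l : ℤ × ℤ) : chr (k + l) = chr k * chr l := by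
  ext1 x
  refine Eq.trans ?_ (chr_mul_circle k x (x.1 ^ l.1 * x.2.1 ^ l.2)).symm
  have : x.1 ^ (k + l).1 * x.2.1 ^ (k + l).2 =
      x.1 ^ k.1 * x.2.1 ^ k.2 * (x.1 ^ l.1 * x.2.1 ^ l.2) := by
    rw [Prod.fst_add, Prod.snd_add, zpow_add, zpow_add, mul_mul_mul_comm]
  rw [← this]
  rfl

theorem chr_zero : chr 0 = 1 := by
  ext1 x
  simp [chr]

theorem inner_mul_unit (a b c : Quaternion ℝ) (hc : c * star c = 1) : ⟪a * c, b * c⟫ = ⟪a, b⟫ := by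
  rw [Quaternion.inner_def, Quaternion.inner_def, star_mul, mul_assoc, ← mul_assoc c, hc, one_mul]

theorem circle_mul_star (z : Circle) : ((z : ℂ) : Quaternion ℝ) * star ((z : ℂ) : Quaternion ℝ) = 1 := by
  rw [Quaternion.self_mul_star, normSq_def']
  have := Circle.normSq_coe z
  rw [Complex.normSq_apply] at this
  have : (z : ℂ).re ^ 2 + (z : ℂ).im ^ 2 = 1 := by rw [← this]; ring
  simp [this]

theorem inner_bas_same (k : ℤ × ℤ) (h g : QPol) :
    ⟪bas k h, bas k g⟫ = ∫ x, lastP (QPol.pr h g) x ∂vol := by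
  rw [bas_apply, bas_apply, inner_toH]
  refine integral_congr_ae (.of_forall fun x => ?_)
  exact (inner_mul_unit _ _ _ (circle_mul_star _)).trans (inner_evQ _ _ _)

theorem exists_zpow_eq_neg_one {m : ℤ} (hm : m ≠ 0) : ∃ z : Circle, ((z ^ m : Circle) : ℂ) = -1 := by
  refine ⟨Circle.exp (Real.pi / m), ?_⟩
  rw [Circle.coe_zpow, Circle.coe_exp, ← Complex.exp_int_mul, ← Complex.exp_pi_mul_I]
  have : (m : ℂ) ≠ 0 := by exact_mod_cast hm
  congr 1
  push_cast
  field_simp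

theorem inner_bas_ne {k l : ℤ × ℤ} (hkl : k ≠ l) (h g : QPol) : ⟪bas k h, bas l g⟫ = 0 := by
  obtain ⟨z₁, z₂, hz⟩ : ∃ z₁ z₂ : Circle,
      ((z₁ ^ (k.1 - l.1) * z₂ ^ (k.2 - l.2) : Circle) : ℂ) = -1 := by
    by_cases h1 : k.1 - l.1 = 0
    · obtain ⟨z, hz⟩ := exists_zpow_eq_neg_one (m := k.2 - l.2) fun h2 => hkl <| by
        ext <;> omega
      exact ⟨1, z, by rw [one_zpow, one_mul, hz]⟩
    · obtain ⟨z, hz⟩ := exists_zpow_eq_neg_one h1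
      exact ⟨z, 1, by rw [one_zpow, mul_one, hz]⟩
  have hc : ∀ k x, chr k (pt z₁ z₂ 1 * x) =
      chr k x * (((z₁ ^ k.1 * z₂ ^ k.2 : Circle) : ℂ) : Quaternion ℝ) := by
    intro k x
    rw [chr_mul_circle]
    have : (z₁ * x.1) ^ k.1 * (z₂ * x.2.1) ^ k.2 =
        x.1 ^ k.1 * x.2.1 ^ k.2 * (z₁ ^ k.1 * z₂ ^ k.2) := by
      rw [mul_zpow, mul_zpow]
      exact (mul_mul_mul_comm _ _ _ _).trans (mul_comm _ _)
    rw [← this]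
    rfl
  have hk : (((z₁ ^ k.1 * z₂ ^ k.2 : Circle) : ℂ) : Quaternion ℝ) =
      -(((z₁ ^ l.1 * z₂ ^ l.2 : Circle) : ℂ) : Quaternion ℝ) := by
    have : z₁ ^ k.1 * z₂ ^ k.2 =
        (z₁ ^ (k.1 - l.1) * z₂ ^ (k.2 - l.2)) * (z₁ ^ l.1 * z₂ ^ l.2) := by
      rw [mul_mul_mul_comm, ← zpow_add, ← zpow_add, sub_add_cancel, sub_add_cancel]
    rw [this, Circle.coe_mul (z₁ ^ (k.1 - l.1) * z₂ ^ (k.2 - l.2)), hz]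
    ext <;> simp
  have hl : ∀ h x, lastQ h (pt z₁ z₂ 1 * x) = lastQ h x := fun h x => by
    have : (1 : S3) * x.2.2 = x.2.2 := one_mul _
    change evQ (((1 : S3) * x.2.2 : S3) : Quaternion ℝ) h = _
    rw [this]
    rfl
  rw [bas_apply, bas_apply, inner_toH]
  have h1 := integral_mul_left_eq_self (μ := vol)
    (fun x => ⟪(lastQ h * chr k) x, (lastQ g * chr l) x⟫) (pt z₁ z₂ 1)
  have h2 : ∀ x, ⟪(lastQ h * chr k) (pt z₁ z₂ 1 * x), (lastQ g * chr l) (pt z₁ z₂ 1 * x)⟫ =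
      -⟪(lastQ h * chr k) x, (lastQ g * chr l) x⟫ := fun x => by
    rw [ContinuousMap.mul_apply, ContinuousMap.mul_apply, hc, hc, hl, hl, hk, mul_neg, mul_neg,
      inner_neg_left, ← mul_assoc, ← mul_assoc, inner_mul_unit _ _ _ (circle_mul_star _)]
    rfl
  simp only [h2] at h1
  rw [integral_neg] at h1
  linarith

end TTS

end Decomposition

section Decomposition

open MeasureTheory Quaternion

namespace TTS

/-- Real functions as quaternion valued functions. -/
def toQ : C(TTS, ℝ) →ₐ[ℝ] C(TTS, Quaternion ℝ) :=
  (Algebra.ofId ℝ (Quaternion ℝ)).compLeftContinuous ℝ (continuous_algebraMap ℝ (Quaternion ℝ))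

theorem toQ_apply (f : C(TTS, ℝ)) (x : TTS) : toQ f x = (f x : Quaternion ℝ) := rfl

theorem continuous_toQ : Continuous toQ :=
  ContinuousMap.continuous_postcomp
    (⟨algebraMap ℝ (Quaternion ℝ), continuous_algebraMap ℝ (Quaternion ℝ)⟩ :
      C(ℝ, Quaternion ℝ))

theorem toQ_comm (f : C(TTS, ℝ)) (q : C(TTS, Quaternion ℝ)) : toQ f * q = q * toQ f := by
  ext1 x
  exact (Quaternion.coe_commutes _ _)

/-- Constant functions. -/
def cc (c : Quaternion ℝ) : C(TTS, Quaternion ℝ) := ContinuousMap.const _ c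

theorem cc_apply (c : Quaternion ℝ) (x : TTS) : cc c x = c := rfl

/-- The quaternion `i`. -/
def qi : Quaternion ℝ := hq 0 1 0 0

/-- The quaternion `j`. -/
def qj : Quaternion ℝ := hq 0 0 1 0

/-- The real part of a character. -/
def chRe (k : ℤ × ℤ) : C(TTS, ℝ) := ⟨fun x => (chr k x).re, continuous_re.comp (chr k).continuous⟩

/-- The imaginary part of a character. -/
def chIm (k : ℤ × ℤ) : C(TTS, ℝ) :=
  ⟨fun x => (chr k x).imI, continuous_imI.comp (chr k).continuous⟩

theorem chr_neg (k : ℤ × ℤ) : chr (-k) = star (chr k) := by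
  have h1 : chr k * chr (-k) = 1 := by rw [← chr_add, add_neg_cancel, chr_zero]
  have h2 : star (chr k) * chr k = 1 := by
    ext1 x
    have := circle_mul_star (x.1 ^ k.1 * x.2.1 ^ k.2)
    rw [Quaternion.self_mul_star, ← Quaternion.star_mul_self] at this
    exact this
  exact (left_inv_eq_right_inv h2 h1).symm

theorem toQ_chRe (k : ℤ × ℤ) : toQ (chRe k) = (2 : ℝ)⁻¹ • (chr k + chr (-k)) := by
  rw [chr_neg]
  ext1 x
  rw [toQ_apply]
  ext <;> simp [chRe, chr] <;> ring

theorem toQ_chIm (k : ℤ × ℤ) : toQ (chIm k) = (2 : ℝ)⁻¹ • ((chr (-k) - chr k) * cc qi) := by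
  rw [chr_neg]
  ext1 x
  rw [toQ_apply]
  ext <;> simp [chIm, chr, cc_apply, qi] <;> ring

theorem chr_mul_qi (k : ℤ × ℤ) : chr k * cc qi = cc qi * chr k := by
  ext1 x
  ext <;> simp [chr, cc_apply, qi]

theorem chr_mul_qj (k : ℤ × ℤ) : chr k * cc qj = cc qj * chr (-k) := by
  rw [chr_neg]
  ext1 x
  ext <;> simp [chr, cc_apply, qj] <;> ring

theorem mem_subalgebra_of_generators (A : Subalgebra ℝ C(TTS, ℝ)) (hc : IsClosed (A : Set C(TTS, ℝ)))
    (hco : ∀ a, lastP (MvPolynomial.X a) ∈ A) (hch : ∀ k, chRe k ∈ A ∧ chIm k ∈ A) (f : C(TTS, ℝ)) :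
    f ∈ A := by
  have hs : A.SeparatesPoints := by
    intro x y hxy
    by_contra! hcon
    have hA : ∀ f ∈ A, f x = f y := fun f hf => hcon f ⟨f, hf, rfl⟩
    have h4 : (x.2.2 : Quaternion ℝ) = y.2.2 := by
      have := fun a => hA _ (hco a)
      simp only [lastP, ContinuousMap.coe_mk, evP_X] at this
      exact QuaternionAlgebra.ext (this 0) (this 1) (this 2) (this 3)
    have hz : ∀ k, chr k x = chr k y := fun k => by
      have h1 := hA _ (hch k).1
      have h2 := hA _ (hch k).2
      exact QuaternionAlgebra.ext h1 h2 rfl rfl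
    have inj : ∀ z w : Circle, ((z : ℂ) : Quaternion ℝ) = ((w : ℂ) : Quaternion ℝ) → z = w :=
      fun z w h => Circle.ext (Complex.ext (congrArg (fun q => q.re) h) (congrArg (fun q => q.imI) h))
    have h1 := inj _ _ (hz (1, 0))
    have h2 := inj _ _ (hz (0, 1))
    simp only [zpow_one, zpow_zero, mul_one, one_mul] at h1 h2
    exact hxy (Prod.ext h1 (Prod.ext h2 (Subtype.ext h4)))
  have := ContinuousMap.subalgebra_topologicalClosure_eq_top_of_separatesPoints A hs
  have h2 : f ∈ A.topologicalClosure := this ▸ Algebra.mem_top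
  have h3 : f ∈ closure (A : Set C(TTS, ℝ)) := h2
  rwa [hc.closure_eq] at h3

/-- The summands in the decomposition of `HH`. -/
def VV (l : ℤ × (ℤ × ℤ)) : Submodule ℝ HH := (QPol.eig l.1).map (bas l.2)

theorem bas_mem_VV {m : ℤ} {h : QPol} (hh : h ∈ QPol.eig m) (k : ℤ × ℤ) : bas k h ∈ VV (m, k) :=
  Submodule.mem_map_of_mem hh

theorem inner_bas_dir (k : ℤ × ℤ) (h g : QPol) :
    ⟪bas k (QPol.dir h), bas k g⟫ = ⟪bas k h, bas k (QPol.dir g)⟫ := by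
  rw [inner_bas_same, inner_bas_same, integral_pr_dir]

theorem orthogonal_VV : OrthogonalFamily ℝ (fun l => VV l) fun l => (VV l).subtypeₗᵢ := by
  rintro ⟨m, k⟩ ⟨n, l⟩ hne ⟨_, h, hh, rfl⟩ ⟨_, g, hg, rfl⟩
  change ⟪bas k h, bas l g⟫ = 0
  by_cases hkl : k = l
  · subst hkl
    have hmn : (m : ℝ) ≠ n := fun e => hne (by rw [Int.cast_injective e])
    have := inner_bas_dir k h g
    rw [(QPol.mem_eig.1 hh).2, (QPol.mem_eig.1 hg).2, map_smul, map_smul, inner_smul_left,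
      inner_smul_right] at this
    have h2 : ((m : ℝ) - n) * ⟪bas k h, bas k g⟫ = 0 := by
      rw [sub_mul, sub_eq_zero]; exact this
    exact (mul_eq_zero.1 h2).resolve_left (sub_ne_zero.2 hmn)
  · exact inner_bas_ne hkl h g

theorem opR_chr_bas (l k : ℤ × ℤ) (h : QPol) : opR (chr l) (bas k h) = bas (k + l) h := by
  rw [bas_apply, bas_apply, opR_toH, mul_assoc, chr_add]

theorem lastQ_cst (c : Quaternion ℝ) : lastQ (QPol.cst c) = cc c := by
  ext1 x
  exact evQ_cst _ _

theorem opR_qi_bas (k : ℤ × ℤ) (h : QPol) : opR (cc qi) (bas k h) = bas k (h * QPol.cst qi) := by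
  rw [bas_apply, bas_apply, opR_toH, mul_assoc, chr_mul_qi, lastQ_mul, lastQ_cst, mul_assoc]

theorem opR_qj_bas (k : ℤ × ℤ) (h : QPol) :
    opR (cc qj) (bas k h) = bas (-k) (h * QPol.cst qj) := by
  rw [bas_apply, bas_apply, opR_toH, mul_assoc, chr_mul_qj, lastQ_mul, lastQ_cst, mul_assoc]

theorem opR_lastP_bas (p : Pol) (k : ℤ × ℤ) (h : QPol) :
    opR (toQ (lastP p)) (bas k h) = bas k (p • h) := by
  rw [bas_apply, bas_apply, opR_toH, mul_assoc, ← toQ_comm, ← mul_assoc, ← toQ_comm]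
  congr 2
  ext1 x
  exact (Quaternion.coe_mul_eq_smul _ _).trans (evQ_psmul _ _ _).symm

theorem mem_closure_VV_of_mapsTo (T : HH →L[ℝ] HH)
    (hT : ∀ m k, ∀ h ∈ QPol.eig m, T (bas k h) ∈ (⨆ l, VV l).topologicalClosure) {x : HH}
    (hx : x ∈ (⨆ l, VV l).topologicalClosure) : T x ∈ (⨆ l, VV l).topologicalClosure := by
  have h1 : (⨆ l, VV l) ≤ (⨆ l, VV l).topologicalClosure.comap T.toLinearMap := by
    refine iSup_le fun l => ?_
    rintro _ ⟨h, hh, rfl⟩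
    exact hT l.1 l.2 h hh
  have h2 : IsClosed ((⨆ l, VV l).topologicalClosure.comap T.toLinearMap : Set HH) :=
    (Submodule.isClosed_topologicalClosure _).preimage T.continuous
  exact Submodule.topologicalClosure_minimal _ h1 h2 hx

theorem mem_closure_VV {m : ℤ} {h : QPol} (hh : h ∈ QPol.eig m) (k : ℤ × ℤ) :
    bas k h ∈ (⨆ l, VV l).topologicalClosure :=
  Submodule.le_topologicalClosure _ (Submodule.mem_iSup_of_mem _ (bas_mem_VV hh k))

theorem opR_qi_mem {x : HH} (hx : x ∈ (⨆ l, VV l).topologicalClosure) :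
    opR (cc qi) x ∈ (⨆ l, VV l).topologicalClosure :=
  mem_closure_VV_of_mapsTo _ (fun m k h hh => by
    rw [opR_qi_bas]; exact mem_closure_VV (QPol.mul_cst_mem_eig hh _) k) hx

theorem opR_qj_mem {x : HH} (hx : x ∈ (⨆ l, VV l).topologicalClosure) :
    opR (cc qj) x ∈ (⨆ l, VV l).topologicalClosure :=
  mem_closure_VV_of_mapsTo _ (fun m k h hh => by
    rw [opR_qj_bas]; exact mem_closure_VV (QPol.mul_cst_mem_eig hh _) _) hx

theorem opR_chr_mem (l : ℤ × ℤ) {x : HH} (hx : x ∈ (⨆ l, VV l).topologicalClosure) :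
    opR (chr l) x ∈ (⨆ l, VV l).topologicalClosure :=
  mem_closure_VV_of_mapsTo _ (fun m k h hh => by
    rw [opR_chr_bas]; exact mem_closure_VV hh _) hx

theorem opR_toQ_mem (f : C(TTS, ℝ)) {x : HH} (hx : x ∈ (⨆ l, VV l).topologicalClosure) :
    opR (toQ f) x ∈ (⨆ l, VV l).topologicalClosure := by
  set S := (⨆ l, VV l).topologicalClosure with hS
  let A : Subalgebra ℝ C(TTS, ℝ) :=
    { carrier := {f | ∀ x ∈ S, opR (toQ f) x ∈ S}
      mul_mem' := fun {f g} hf hg x hx => by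
        rw [map_mul, opR_mul_apply]; exact hg _ (hf _ hx)
      add_mem' := fun {f g} hf hg x hx => by
        rw [map_add, map_add]; exact add_mem (hf _ hx) (hg _ hx)
      algebraMap_mem' := fun r x hx => by
        rw [AlgHom.commutes, Algebra.algebraMap_eq_smul_one, map_smul, opR_one]
        exact S.smul_mem _ hx }
  have hc : IsClosed (A : Set C(TTS, ℝ)) := by
    have : (A : Set C(TTS, ℝ)) = ⋂ x ∈ S, (fun f => opR (toQ f) x) ⁻¹' S := by
      ext f
      simp [A]
    rw [this]
    refine isClosed_biInter fun x hx => IsClosed.preimage ?_ (Submodule.isClosed_topologicalClosure _)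
    exact (ContinuousLinearMap.apply ℝ HH x).continuous.comp (opR.continuous.comp continuous_toQ)
  refine mem_subalgebra_of_generators A hc (fun a x hx => ?_) (fun k => ⟨fun x hx => ?_, fun x hx => ?_⟩) f x hx
  · refine mem_closure_VV_of_mapsTo _ (fun m k h hh => ?_) hx
    rw [opR_lastP_bas]
    obtain ⟨y₁, h₁, y₂, h₂, y₃, h₃, y₄, h₄, e⟩ := QPol.exists_eig_X_smul (QPol.mem_eig.1 hh).1 a
    rw [e, map_add, map_add, bas_rsq, map_add]
    exact add_mem (add_mem (mem_closure_VV h₁ k) (mem_closure_VV h₂ k))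
      (add_mem (mem_closure_VV h₃ k) (mem_closure_VV h₄ k))
  · rw [toQ_chRe, map_smul, map_add]
    exact S.smul_mem _ (add_mem (opR_chr_mem _ hx) (opR_chr_mem _ hx))
  · rw [toQ_chIm, map_smul, smul_apply, opR_mul_apply, map_sub, sub_apply]
    exact S.smul_mem _ (opR_qi_mem (sub_mem (opR_chr_mem _ hx) (opR_chr_mem _ hx)))

theorem one_mem_harm : (1 : QPol) ∈ QPol.harm 0 := by
  have h1 : (1 : Pol) ∈ QPol.harmP 0 := by
    rw [QPol.mem_harmP]
    refine ⟨MvPolynomial.isHomogeneous_one _ _, ?_⟩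
    simp [QPol.lap_apply]
  exact ⟨h1, zero_mem _, zero_mem _, zero_mem _⟩

theorem exists_components (q : C(TTS, Quaternion ℝ)) : ∃ a b c d : C(TTS, ℝ),
    q = toQ a + toQ b * cc qi + (toQ c + toQ d * cc qi) * cc qj := by
  refine ⟨⟨_, continuous_re.comp q.continuous⟩, ⟨_, continuous_imI.comp q.continuous⟩,
    ⟨_, continuous_imJ.comp q.continuous⟩, ⟨_, continuous_imK.comp q.continuous⟩, ?_⟩
  ext1 x
  ext <;> simp [toQ_apply, cc_apply, qi, qj]

theorem total_VV : ⊤ ≤ (⨆ l, VV l).topologicalClosure := by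
  have h1 : toH 1 ∈ (⨆ l, VV l).topologicalClosure := by
    have : toH 1 = bas 0 1 := by
      rw [bas_apply, chr_zero, mul_one]
      congr 1
      ext1 x
      have := evQ_cst (x.2.2 : Quaternion ℝ) 1
      have e : QPol.cst 1 = 1 := by ext1 <;> simp [QPol.cst]
      rw [e] at this
      exact this.symm
    obtain ⟨u, hu, w, hw, e⟩ := QPol.exists_eig_add one_mem_harm
    rw [this, e, map_add]
    exact add_mem (mem_closure_VV hu 0) (mem_closure_VV hw 0)
  have h2 : ∀ q, toH q ∈ (⨆ l, VV l).topologicalClosure := fun q => by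
    obtain ⟨a, b, c, d, e⟩ := exists_components q
    have h3 : ∀ f, toH (toQ f) ∈ (⨆ l, VV l).topologicalClosure := fun f => by
      have := opR_toQ_mem f h1
      rwa [opR_toH, one_mul] at this
    have h4 : ∀ a b, toH (toQ a + toQ b * cc qi) ∈ (⨆ l, VV l).topologicalClosure := fun a b => by
      rw [map_add, ← opR_toH]
      exact add_mem (h3 a) (opR_qi_mem (h3 b))
    rw [e, map_add, ← opR_toH (cc qj)]
    exact add_mem (h4 a b) (opR_qj_mem (h4 c d))
  intro x _
  have := denseRange_toH x
  refine closure_minimal ?_ (Submodule.isClosed_topologicalClosure _) this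
  rintro _ ⟨q, rfl⟩
  exact h2 q

instance (l : ℤ × (ℤ × ℤ)) : FiniteDimensional ℝ (VV l) :=
  inferInstanceAs (FiniteDimensional ℝ ((QPol.eig l.1).map (bas l.2)))

/-- The decomposition of `HH`. -/
def dec : Dec (ℤ × (ℤ × ℤ)) HH where
  V := VV
  fin := inferInstance
  orth := orthogonal_VV
  total := total_VV

end TTS

end Decomposition

section Symbols

open MeasureTheory Quaternion Filter Topology

namespace TTS

/-- The set of labels of the summands. -/
abbrev Lab := ℤ × (ℤ × ℤ)

/-- The label as a vector, shifted by `m` in the last two coordinates. -/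
def lv (m : ℝ × ℝ) (l : Lab) : EuclideanSpace ℝ (Fin 3) :=
  !₂[(l.1 : ℝ), l.2.1 + m.1, l.2.2 + m.2]

/-- The normalized coordinates of the label. -/
def sy (m : ℝ × ℝ) (a : Fin 3) (l : Lab) : ℝ := (‖lv m l‖⁻¹ • lv m l) a

theorem sy_eq (m : ℝ × ℝ) (a : Fin 3) (l : Lab) : sy m a l = ‖lv m l‖⁻¹ * lv m l a := rfl

theorem abs_sy_le (m : ℝ × ℝ) (a : Fin 3) (l : Lab) : |sy m a l| ≤ 1 := by
  refine (PiLp.norm_apply_le (‖lv m l‖⁻¹ • lv m l) a).trans ?_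
  rw [norm_smul, norm_inv, norm_norm]
  exact inv_mul_le_one

theorem sy_bdd (m : ℝ × ℝ) (a : Fin 3) : ∃ C, ∀ l, |sy m a l| ≤ C := ⟨1, abs_sy_le m a⟩

theorem norm_normalize_sub_le {E : Type*} [NormedAddCommGroup E] [NormedSpace ℝ E] (x : E) {y : E}
    (hy : y ≠ 0) : ‖‖x‖⁻¹ • x - ‖y‖⁻¹ • y‖ ≤ 2 * ‖x - y‖ * ‖y‖⁻¹ := by
  have hy' : 0 < ‖y‖ := norm_pos_iff.2 hy
  rcases eq_or_ne x 0 with rfl | hx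
  · simp [norm_smul, hy'.ne']
  have hx' : 0 < ‖x‖ := norm_pos_iff.2 hx
  have h1 : ‖x‖⁻¹ • x - ‖y‖⁻¹ • y = (‖x‖⁻¹ - ‖y‖⁻¹) • x + ‖y‖⁻¹ • (x - y) := by module
  rw [h1]
  refine (norm_add_le _ _).trans ?_
  rw [norm_smul, norm_smul, norm_inv, norm_norm]
  have h2 : ‖‖x‖⁻¹ - ‖y‖⁻¹‖ * ‖x‖ = |‖y‖ - ‖x‖| * ‖y‖⁻¹ := by
    have : ‖x‖⁻¹ - ‖y‖⁻¹ = (‖y‖ - ‖x‖) * (‖y‖⁻¹ * ‖x‖⁻¹) := by field_simp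
    rw [this, Real.norm_eq_abs, abs_mul, abs_of_pos (show 0 < ‖y‖⁻¹ * ‖x‖⁻¹ by positivity)]
    field_simp
  rw [h2]
  have h3 := abs_norm_sub_norm_le y x
  rw [norm_sub_rev] at h3
  have : 0 < ‖y‖⁻¹ := inv_pos.2 hy'
  nlinarith

theorem norm_lv_sq (m : ℝ × ℝ) (l : Lab) :
    ‖lv m l‖ ^ 2 = (l.1 : ℝ) ^ 2 + (l.2.1 + m.1) ^ 2 + (l.2.2 + m.2) ^ 2 := by
  rw [EuclideanSpace.norm_sq_eq]
  simp [lv, Fin.sum_univ_three]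

theorem tendsto_norm_lv (m : ℝ × ℝ) : Tendsto (fun l => ‖lv m l‖) cofinite atTop := by
  rw [tendsto_atTop]
  intro C
  obtain ⟨N, hN⟩ := exists_nat_gt (|C| + |m.1| + |m.2|)
  rw [eventually_cofinite]
  refine ((Set.finite_Icc (-N : ℤ) N).prod
    ((Set.finite_Icc (-N : ℤ) N).prod (Set.finite_Icc (-N : ℤ) N))).subset ?_
  intro l hl
  simp only [mem_ofPred_eq, not_le] at hl
  have hl' : ‖lv m l‖ ≤ |C| := hl.le.trans (le_abs_self _)
  have h := fun a => (PiLp.norm_apply_le (lv m l) a).trans hl'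
  have h0 : |(l.1 : ℝ)| ≤ |C| := h 0
  have h1 : |(l.2.1 : ℝ) + m.1| ≤ |C| := h 1
  have h2 : |(l.2.2 : ℝ) + m.2| ≤ |C| := h 2
  have key : ∀ k : ℤ, |(k : ℝ)| ≤ N → k ∈ Icc (-N : ℤ) N := fun k hk => by
    rw [abs_le] at hk
    exact ⟨by exact_mod_cast hk.1, by exact_mod_cast hk.2⟩
  have a1 := abs_nonneg m.1
  have a2 := abs_nonneg m.2
  have t1 : |(l.2.1 : ℝ)| ≤ |(l.2.1 : ℝ) + m.1| + |m.1| := by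
    simpa using abs_sub (l.2.1 + m.1 : ℝ) m.1
  have t2 : |(l.2.2 : ℝ)| ≤ |(l.2.2 : ℝ) + m.2| + |m.2| := by
    simpa using abs_sub (l.2.2 + m.2 : ℝ) m.2
  exact ⟨key _ (by linarith), key _ (by linarith), key _ (by linarith)⟩

/-- If the labels are displaced by a bounded amount relative to `g` then the symbol changes by an
amount tending to zero. -/
theorem tendsto_sy_sub (m m' : ℝ × ℝ) (a : Fin 3) (s : Lab → Lab) (g : Lab → ℝ) (C : ℝ)
    (hs : ∀ l, ‖lv m' (s l) - lv m l‖ * |g l| ≤ C) :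
    Tendsto (fun l => (sy m' a (s l) - sy m a l) * g l) cofinite (𝓝 0) := by
  have h1 : Tendsto (fun l => 2 * C * ‖lv m l‖⁻¹) cofinite (𝓝 0) := by
    simpa using (tendsto_norm_lv m).inv_tendsto_atTop.const_mul (2 * C)
  refine squeeze_zero_norm' ?_ h1
  filter_upwards [(tendsto_norm_lv m).eventually_gt_atTop 0] with l hl
  have h2 := (PiLp.norm_apply_le (‖lv m' (s l)‖⁻¹ • lv m' (s l) - ‖lv m l‖⁻¹ • lv m l) a).trans
    (norm_normalize_sub_le (lv m' (s l)) (norm_pos_iff.1 hl))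
  have h3 : ‖sy m' a (s l) - sy m a l‖ ≤ 2 * ‖lv m' (s l) - lv m l‖ * ‖lv m l‖⁻¹ := h2
  rw [norm_mul, Real.norm_eq_abs (g l)]
  calc _ ≤ 2 * ‖lv m' (s l) - lv m l‖ * ‖lv m l‖⁻¹ * |g l| := by gcongr
    _ = 2 * (‖lv m' (s l) - lv m l‖ * |g l|) * ‖lv m l‖⁻¹ := by ring
    _ ≤ _ := by gcongr; exact hs l

/-- The zero order operator with symbol `sy m a`. -/
def ph (m : ℝ × ℝ) (a : Fin 3) : HH →L[ℝ] HH := dec.diag (sy m a)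

theorem ph_apply (m : ℝ × ℝ) (a : Fin 3) {l : Lab} {x : HH} (hx : x ∈ VV l) :
    ph m a x = sy m a l • x := dec.diag_apply (sy_bdd m a) hx

theorem ph_bas (m : ℝ × ℝ) (a : Fin 3) {n : ℤ} {h : QPol} (hh : h ∈ QPol.eig n) (k : ℤ × ℤ) :
    ph m a (bas k h) = sy m a (n, k) • bas k h := ph_apply m a (bas_mem_VV hh k)

/-- To check the equality of operators, it is enough to do it on the basic functions. -/
theorem clm_ext_bas {G : Type*} [NormedAddCommGroup G] [NormedSpace ℝ G] {A B : HH →L[ℝ] G}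
    (h : ∀ n k, ∀ h ∈ QPol.eig n, A (bas k h) = B (bas k h)) : A = B :=
  dec.clm_ext fun l _ ⟨g, hg, e⟩ => e ▸ h l.1 l.2 g hg

theorem ph_comp_ph (m m' : ℝ × ℝ) (a b : Fin 3) (x : HH) :
    ph m a (ph m' b x) = ph m' b (ph m a x) := by
  have : ph m a ∘L ph m' b = ph m' b ∘L ph m a := clm_ext_bas fun n k h hh => by
    simp only [ContinuousLinearMap.comp_apply, ph_bas _ _ hh, map_smul]
    exact smul_comm _ _ _
  exact congrArg (fun T => T x) this

theorem ph_opR_qi (m : ℝ × ℝ) (a : Fin 3) (x : HH) :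
    ph m a (opR (cc qi) x) = opR (cc qi) (ph m a x) := by
  have : ph m a ∘L opR (cc qi) = opR (cc qi) ∘L ph m a := clm_ext_bas fun n k h hh => by
    simp only [ContinuousLinearMap.comp_apply, ph_bas _ _ hh, map_smul, opR_qi_bas]
    rw [ph_bas _ _ (QPol.mul_cst_mem_eig hh _)]
  exact congrArg (fun T => T x) this

theorem inner_ph (m : ℝ × ℝ) (a : Fin 3) (x y : HH) : ⟪ph m a x, y⟫ = ⟪x, ph m a y⟫ :=
  dec.inner_diag _ x y

theorem isCompactOperator_ph_sub (m m' : ℝ × ℝ) (a : Fin 3) :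
    IsCompactOperator (ph m' a - ph m a) := by
  have h1 : ph m' a - ph m a = dec.diag fun l => sy m' a l - sy m a l :=
    dec.clm_ext fun l x hx => by
      have hb : ∃ C, ∀ l, |sy m' a l - sy m a l| ≤ C :=
        ⟨1 + 1, fun l => (abs_sub _ _).trans (add_le_add (abs_sy_le _ _ _) (abs_sy_le _ _ _))⟩
      rw [dec.diag_apply hb hx, sub_smul, sub_apply, ph_apply _ _ hx, ph_apply _ _ hx]
  rw [h1]
  refine dec.isCompactOperator_diag ?_
  have h2 : ∀ l, lv m' l - lv m l = !₂[0, m'.1 - m.1, m'.2 - m.2] := fun l => by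
    ext i; fin_cases i <;> simp [lv]
  simpa using tendsto_sy_sub m m' a id (fun _ => 1) ‖!₂[0, m'.1 - m.1, m'.2 - m.2]‖
    fun l => by rw [id, h2]; simp

end TTS

end Symbols

section Commutators

open MeasureTheory Quaternion Filter Topology

namespace TTS

/-- The functions whose multiplication operators commute with `T` up to compact operators. -/
def cmt (T : HH →L[ℝ] HH) : Submodule ℝ C(TTS, Quaternion ℝ) where
  carrier := {q | IsCompactOperator (T ∘L opR q - opR q ∘L T)}
  add_mem' {p q} hp hq := by
    change IsCompactOperator _
    have : T ∘L opR (p + q) - opR (p + q) ∘L T =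
        (T ∘L opR p - opR p ∘L T) + (T ∘L opR q - opR q ∘L T) := by
      ext1 x
      simp only [map_add, add_apply, sub_apply, ContinuousLinearMap.comp_apply]
      abel
    rw [this]
    exact IsCompactOperator.add hp hq
  zero_mem' := by
    change IsCompactOperator _
    have : T ∘L opR 0 - opR 0 ∘L T = 0 := by ext1 x; simp
    rw [this]
    exact isCompactOperator_zero
  smul_mem' c q hq := by
    change IsCompactOperator _
    have : T ∘L opR (c • q) - opR (c • q) ∘L T = c • (T ∘L opR q - opR q ∘L T) := by
      ext1 x
      simp only [map_smul, smul_apply, sub_apply, ContinuousLinearMap.comp_apply, smul_sub]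
    rw [this]
    exact IsCompactOperator.smul hq c

theorem mem_cmt {T : HH →L[ℝ] HH} {q : C(TTS, Quaternion ℝ)} :
    q ∈ cmt T ↔ IsCompactOperator (T ∘L opR q - opR q ∘L T) := Iff.rfl

theorem mul_mem_cmt {T : HH →L[ℝ] HH} {p q : C(TTS, Quaternion ℝ)} (hp : p ∈ cmt T)
    (hq : q ∈ cmt T) : p * q ∈ cmt T := by
  have : T ∘L opR (p * q) - opR (p * q) ∘L T =
      (T ∘L opR q - opR q ∘L T) ∘L opR p + opR q ∘L (T ∘L opR p - opR p ∘L T) := by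
    ext1 x
    simp only [opR_mul, add_apply, sub_apply, ContinuousLinearMap.comp_apply, map_sub]
    abel
  rw [mem_cmt, this]
  have h1 := IsCompactOperator.comp_clm (mem_cmt.1 hq) (opR p)
  have h2 := IsCompactOperator.clm_comp (mem_cmt.1 hp) (opR q)
  exact IsCompactOperator.add h1 h2

theorem mem_cmt_of_comm {T : HH →L[ℝ] HH} {q : C(TTS, Quaternion ℝ)}
    (h : ∀ x, T (opR q x) = opR q (T x)) : q ∈ cmt T := by
  have : T ∘L opR q - opR q ∘L T = 0 := by
    ext1 x
    exact sub_eq_zero.2 (h x)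
  rw [mem_cmt, this]
  exact isCompactOperator_zero

theorem isClosed_cmt (T : HH →L[ℝ] HH) : IsClosed (cmt T : Set C(TTS, Quaternion ℝ)) := by
  have h : Continuous fun q => T ∘L opR q - opR q ∘L T :=
    (continuous_const.clm_comp opR.continuous).sub (opR.continuous.clm_comp continuous_const)
  exact isClosed_setOfPred_isCompactOperator.preimage h

theorem chr_mem_cmt (e : ℤ × ℤ) (m : ℝ × ℝ) (a : Fin 3) : chr e ∈ cmt (ph m a) := by
  refine dec.isCompactOperator_comm_diag (B := opR (chr e)) (fun l => (l.1, l.2 + e))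
    (fun l x hx => ?_) (fun _ => 1) (fun l x hx => (one_smul _ _).symm) (sy_bdd m a) ?_
  · obtain ⟨h, hh, rfl⟩ := hx
    rw [opR_chr_bas]
    exact bas_mem_VV hh _
  · refine tendsto_sy_sub m m a _ _ ‖(!₂[0, (e.1 : ℝ), e.2] : EuclideanSpace ℝ (Fin 3))‖ fun l => ?_
    have : lv m (l.1, l.2 + e) - lv m l = !₂[0, (e.1 : ℝ), e.2] := by
      ext i; fin_cases i <;> simp [lv]
    rw [this, abs_one, mul_one]

/-- The sign and the residue modulo three of the first component of a label. -/
def cls (n : ℤ) : Bool × ZMod 3 := (decide (0 < n), (n : ZMod 3))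

/-- The candidates for the eigenvalues appearing after the multiplication by a coordinate. -/
def Cand (n k : ℤ) : Prop := k = n + 1 ∨ k = n - 1 ∨ k = -n + 1 ∨ k = -n - 1

theorem exists_cand (n : ℤ) (γ : Bool × ZMod 3) :
    ∃ k, Cand n k ∧ ∀ j, Cand n j → j ≠ 0 → cls j = γ → j = k := by
  by_cases h : ∃ k, Cand n k ∧ k ≠ 0 ∧ cls k = γ
  · obtain ⟨k, hk, h0, hγ⟩ := h
    refine ⟨k, hk, fun j hj hj0 hjγ => ?_⟩
    rw [← hγ] at hjγ
    obtain ⟨h1, h2⟩ := Prod.ext_iff.1 hjγ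
    have h1' : 0 < j ↔ 0 < k := by simpa [cls] using h1
    have h2' := (ZMod.intCast_eq_intCast_iff_dvd_sub _ _ _).1 h2
    unfold Cand at *
    push_cast at h2'
    omega
  · exact ⟨n + 1, Or.inl rfl, fun j hj h0 hγ => (h ⟨j, hj, h0, hγ⟩).elim⟩

theorem Cand.ne {n k : ℤ} (h : Cand n k) : k ≠ n := by
  unfold Cand at h
  omega

/-- The projection to the part of given class. -/
def prc (γ : Bool × ZMod 3) : HH →L[ℝ] HH := dec.diag fun l => if cls l.1 = γ then 1 else 0

theorem prc_bas (γ : Bool × ZMod 3) {n : ℤ} {h : QPol} (hh : h ∈ QPol.eig n) (k : ℤ × ℤ) :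
    prc γ (bas k h) = if cls n = γ then bas k h else 0 := by
  have hb : ∃ C : ℝ, ∀ l : Lab, |(if cls l.1 = γ then 1 else 0 : ℝ)| ≤ C :=
    ⟨1, fun l => by split_ifs <;> simp⟩
  rw [prc, dec.diag_apply hb (bas_mem_VV hh k)]
  split_ifs <;> simp

theorem sum_prc : ∑ γ, prc γ = 1 := clm_ext_bas fun n k h hh => by
  rw [sum_apply, one_apply_eq_self]
  simp only [prc_bas _ hh]
  simp

theorem prc_ph (γ : Bool × ZMod 3) (m : ℝ × ℝ) (a : Fin 3) (x : HH) :
    prc γ (ph m a x) = ph m a (prc γ x) := by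
  have : prc γ ∘L ph m a = ph m a ∘L prc γ := clm_ext_bas fun n k h hh => by
    simp only [ContinuousLinearMap.comp_apply, ph_bas _ _ hh, map_smul, prc_bas _ hh]
    split_ifs
    · rw [ph_bas _ _ hh]
    · simp
  exact congrArg (fun T => T x) this

/-- The coefficient of the commutator of the Dirac operator with a coordinate. -/
def dco (a : Fin 4) : QPol :=
  QPol.mk4 0 (QPol.lv1 (MvPolynomial.X a)) (QPol.lv2 (MvPolynomial.X a))
    (QPol.lv3 (MvPolynomial.X a))

theorem opL_bas (g h : QPol) (k : ℤ × ℤ) : opL (lastQ g) (bas k h) = bas k (g * h) := by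
  rw [bas_apply, bas_apply, opL_toH, lastQ_mul, mul_assoc]

/-- The action of a coordinate on the eigenfunctions. -/
theorem exists_coordinate_action (a : Fin 4) {n : ℤ} {h : QPol} (hh : h ∈ QPol.eig n) (k : ℤ × ℤ) :
    ∃ (j : Fin 4 → ℤ) (y : Fin 4 → QPol), (∀ i, y i ∈ QPol.eig (j i)) ∧
      (∀ i, y i = 0 ∨ Cand n (j i)) ∧
      opR (toQ (lastP (MvPolynomial.X a))) (bas k h) = ∑ i, bas k (y i) ∧
      opL (lastQ (dco a)) (bas k h) = ∑ i, ((j i : ℝ) - n) • bas k (y i) := by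
  rcases eq_or_ne n 0 with rfl | hn
  · rw [QPol.eig_zero, Submodule.mem_bot] at hh
    subst hh
    exact ⟨0, 0, fun i => zero_mem _, fun i => Or.inl rfl, by simp, by simp⟩
  have hn' : (n.natAbs : ℤ) - 1 = (n.natAbs - 1 : ℕ) := by
    have := Int.natAbs_pos.2 hn
    omega
  obtain ⟨y₁, h₁, y₂, h₂, y₃, h₃, y₄, h₄, e⟩ := QPol.exists_eig_X_smul (QPol.mem_eig.1 hh).1 a
  set N : ℕ := n.natAbs - 1 with hN
  refine ⟨![N + 2, -(N + 2), N, -N], ![y₁, y₂, y₃, y₄], ?_, ?_, ?_, ?_⟩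
  · intro i; fin_cases i
    exacts [h₁, h₂, h₃, h₄]
  · intro i
    right
    unfold Cand
    fin_cases i <;> simp <;> omega
  · rw [opR_lastP_bas, e, map_add, map_add, bas_rsq, map_add, Fin.sum_univ_four]
    simp [add_assoc]
  · have h5 : dco a * h = QPol.dir ((MvPolynomial.X a : Pol) • h) -
        (n : ℝ) • ((MvPolynomial.X a : Pol) • h) := by
      rw [QPol.dir_smul, (QPol.mem_eig.1 hh).2, smul_comm (MvPolynomial.X a : Pol) (n : ℝ) h,
        add_sub_cancel_left]
      rfl
    have h6 := (QPol.mem_eig.1 h₁).2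
    have h7 := (QPol.mem_eig.1 h₂).2
    have h8 := (QPol.mem_eig.1 h₃).2
    have h9 := (QPol.mem_eig.1 h₄).2
    have h10 : QPol.dir (y₁ + y₂ + QPol.rsq • (y₃ + y₄)) = QPol.dir y₁ + QPol.dir y₂ +
        QPol.rsq • (QPol.dir y₃ + QPol.dir y₄) := by
      rw [map_add, map_add, QPol.dir_rsq_smul, map_add]
    have h11 : bas k (QPol.dir (y₁ + y₂ + QPol.rsq • (y₃ + y₄))) = bas k (QPol.dir y₁) +
        bas k (QPol.dir y₂) + (bas k (QPol.dir y₃) + bas k (QPol.dir y₄)) := by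
      rw [h10, map_add, map_add, bas_rsq, map_add]
    have h12 : bas k ((n : ℝ) • (y₁ + y₂ + QPol.rsq • (y₃ + y₄))) =
        (n : ℝ) • (bas k y₁ + bas k y₂ + (bas k y₃ + bas k y₄)) := by
      rw [LinearMap.map_smul, map_add, map_add, bas_rsq, map_add]
    rw [opL_bas, h5, e, map_sub, h11, h12, h6, h7, h8, h9, LinearMap.map_smul, LinearMap.map_smul,
      LinearMap.map_smul, LinearMap.map_smul, Fin.sum_univ_four]
    simp only [Matrix.cons_val]
    push_cast
    module

theorem coordinate_mem_cmt (b : Fin 4) (m : ℝ × ℝ) (a : Fin 3) :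
    toQ (lastP (MvPolynomial.X b)) ∈ cmt (ph m a) := by
  set A := opR (toQ (lastP (MvPolynomial.X b))) with hA
  set B := opL (lastQ (dco b)) with hB
  have h1 : ∀ γ γ', IsCompactOperator (ph m a ∘L (prc γ' ∘L A ∘L prc γ) -
      (prc γ' ∘L A ∘L prc γ) ∘L ph m a) := by
    intro γ γ'
    choose t ht ht' using fun n => exists_cand n γ'
    have key : ∀ (n : ℤ) (k : ℤ × ℤ), ∀ h ∈ QPol.eig n,
        prc γ' (A (bas k h)) ∈ VV (t n, k) ∧
        prc γ' (B (bas k h)) = ((t n : ℝ) - n) • prc γ' (A (bas k h)) := by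
      intro n k h hh
      obtain ⟨j, y, hy, hc, h1, h2⟩ := exists_coordinate_action b hh k
      rw [hA, hB, h1, h2, map_sum, map_sum, Finset.smul_sum]
      have h3 : ∀ i, prc γ' (bas k (y i)) = 0 ∨ j i = t n ∧ prc γ' (bas k (y i)) = bas k (y i) := by
        intro i
        rw [prc_bas _ (hy i)]
        by_cases h0 : y i = 0
        · simp [h0]
        by_cases hγ : cls (j i) = γ'
        · refine Or.inr ⟨ht' n _ ((hc i).resolve_left h0) (fun h => h0 ?_) hγ, if_pos hγ⟩
          have := hy i
          rwa [h, QPol.eig_zero, Submodule.mem_bot] at this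
        · exact Or.inl (if_neg hγ)
      refine ⟨sum_mem fun i _ => ?_, Finset.sum_congr rfl fun i _ => ?_⟩
      · rcases h3 i with h | ⟨h, h'⟩
        · rw [h]; exact zero_mem _
        · rw [h', ← h]; exact bas_mem_VV (hy i) k
      · rcases h3 i with h | ⟨h, -⟩
        · rw [map_smul, h, smul_zero, smul_zero]
        · rw [map_smul, h]
    have hne : ∀ n, (t n : ℝ) - n ≠ 0 := fun n =>
      sub_ne_zero.2 (Int.cast_injective.ne (ht n).ne)
    refine dec.isCompactOperator_comm_diag (B := prc γ' ∘L B ∘L prc γ) (fun l => (t l.1, l.2))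
      ?_ (fun l => ((t l.1 : ℝ) - l.1)⁻¹) ?_ (sy_bdd m a) ?_
    · rintro ⟨n, k⟩ _ ⟨h, hh, rfl⟩
      simp only [ContinuousLinearMap.comp_apply, prc_bas γ hh]
      split_ifs
      · exact (key n k h hh).1
      · rw [map_zero, map_zero]; exact zero_mem _
    · rintro ⟨n, k⟩ _ ⟨h, hh, rfl⟩
      simp only [ContinuousLinearMap.comp_apply, prc_bas γ hh]
      split_ifs
      · rw [(key n k h hh).2, smul_smul, inv_mul_cancel₀ (hne n), one_smul]
      · simp
    · refine tendsto_sy_sub m m a _ _ 1 fun l => ?_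
      have : lv m (t l.1, l.2) - lv m l = EuclideanSpace.single 0 ((t l.1 : ℝ) - l.1) := by
        ext i; fin_cases i <;> simp [lv]
      rw [this, PiLp.norm_single, Real.norm_eq_abs, abs_inv,
        mul_inv_cancel₀ (abs_ne_zero.2 (hne _))]
  set C := ph m a ∘L A - A ∘L ph m a with hC
  have h2 : C = ∑ γ, ∑ γ', prc γ' ∘L C ∘L prc γ := by
    ext1 x
    have h3 : ∀ z, ∑ γ, prc γ z = z := fun z => by
      have := congrArg (fun T => T z) sum_prc
      rwa [sum_apply, one_apply_eq_self] at this
    simp only [sum_apply, ContinuousLinearMap.comp_apply, h3, ← map_sum]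
  have h4 : ∀ γ γ', prc γ' ∘L C ∘L prc γ = ph m a ∘L (prc γ' ∘L A ∘L prc γ) -
      (prc γ' ∘L A ∘L prc γ) ∘L ph m a := fun γ γ' => by
    ext1 x
    simp only [hC, sub_apply, ContinuousLinearMap.comp_apply, prc_ph, map_sub]
  simp only [← h4] at h1
  rw [mem_cmt, ← hC, h2]
  exact Submodule.sum_mem (compactOperator (RingHom.id ℝ) HH HH)
    fun γ _ => Submodule.sum_mem _ fun γ' _ => h1 γ γ'

theorem qi_mem_cmt (m : ℝ × ℝ) (a : Fin 3) : cc qi ∈ cmt (ph m a) :=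
  mem_cmt_of_comm fun x => ph_opR_qi m a x

theorem toQ_mem_cmt (m : ℝ × ℝ) (a : Fin 3) (f : C(TTS, ℝ)) : toQ f ∈ cmt (ph m a) := by
  let A : Subalgebra ℝ C(TTS, ℝ) :=
    { carrier := {f | toQ f ∈ cmt (ph m a)}
      mul_mem' := fun {f g} hf hg => by
        change toQ (f * g) ∈ cmt (ph m a)
        rw [map_mul]; exact mul_mem_cmt hf hg
      add_mem' := fun {f g} hf hg => by
        change toQ (f + g) ∈ cmt (ph m a)
        rw [map_add]; exact add_mem hf hg
      algebraMap_mem' := fun r => by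
        change toQ _ ∈ cmt (ph m a)
        rw [AlgHom.commutes, Algebra.algebraMap_eq_smul_one]
        refine Submodule.smul_mem _ _ (mem_cmt_of_comm fun x => ?_)
        rw [opR_one]; rfl }
  refine mem_subalgebra_of_generators A ((isClosed_cmt _).preimage continuous_toQ)
    (fun b => coordinate_mem_cmt b m a) (fun k => ⟨?_, ?_⟩) f
  · change toQ _ ∈ cmt (ph m a)
    rw [toQ_chRe]
    exact Submodule.smul_mem _ _ (add_mem (chr_mem_cmt _ _ _) (chr_mem_cmt _ _ _))
  · change toQ _ ∈ cmt (ph m a)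
    rw [toQ_chIm]
    exact Submodule.smul_mem _ _
      (mul_mem_cmt (sub_mem (chr_mem_cmt _ _ _) (chr_mem_cmt _ _ _)) (qi_mem_cmt _ _))

theorem mem_cmt_of_generators {T : HH →L[ℝ] HH} (hT : ∀ f, toQ f ∈ cmt T) (hi : cc qi ∈ cmt T)
    (hj : cc qj ∈ cmt T) (q : C(TTS, Quaternion ℝ)) : q ∈ cmt T := by
  obtain ⟨a, b, c, d, rfl⟩ := exists_components q
  exact add_mem (add_mem (hT a) (mul_mem_cmt (hT b) hi))
    (mul_mem_cmt (add_mem (hT c) (mul_mem_cmt (hT d) hi)) hj)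

theorem ph_zero_zero_mem (q : C(TTS, Quaternion ℝ)) : q ∈ cmt (ph 0 0) := by
  refine mem_cmt_of_generators (toQ_mem_cmt _ _) (qi_mem_cmt _ _) (mem_cmt_of_comm fun x => ?_) q
  have : ph 0 0 ∘L opR (cc qj) = opR (cc qj) ∘L ph 0 0 := clm_ext_bas fun n k h hh => by
    simp only [ContinuousLinearMap.comp_apply, ph_bas _ _ hh, map_smul, opR_qj_bas]
    rw [ph_bas _ _ (QPol.mul_cst_mem_eig hh _)]
    congr 1
    simp [sy_eq, lv, EuclideanSpace.norm_eq, Fin.sum_univ_three]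
  exact congrArg (fun T => T x) this

/-- The product of `ph` with the complex structure. -/
def rp (m : ℝ × ℝ) (a : Fin 3) : HH →L[ℝ] HH := opR (cc qi) ∘L ph m a

theorem rp_apply (m : ℝ × ℝ) (a : Fin 3) (x : HH) : rp m a x = opR (cc qi) (ph m a x) := rfl

theorem qi_qj : cc qi * cc qj = -(cc qj * cc qi) := by
  ext1 x
  ext <;> simp [cc_apply, qi, qj]

theorem rp_mem {a : Fin 3} (ha : a ≠ 0) (q : C(TTS, Quaternion ℝ)) : q ∈ cmt (rp 0 a) := by
  refine mem_cmt_of_generators (fun f => ?_) (mem_cmt_of_comm fun x => ?_)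
    (mem_cmt_of_comm fun x => ?_) q
  · have h := toQ_mem_cmt 0 a f
    have : rp 0 a ∘L opR (toQ f) - opR (toQ f) ∘L rp 0 a =
        opR (cc qi) ∘L (ph 0 a ∘L opR (toQ f) - opR (toQ f) ∘L ph 0 a) := by
      ext1 x
      simp only [sub_apply, ContinuousLinearMap.comp_apply, map_sub, rp_apply, ← opR_mul_apply,
        toQ_comm]
    rw [mem_cmt, this]
    exact IsCompactOperator.clm_comp (mem_cmt.1 h) (opR (cc qi))
  · rw [rp_apply, rp_apply, ph_opR_qi]
  · have : rp 0 a ∘L opR (cc qj) = opR (cc qj) ∘L rp 0 a := clm_ext_bas (G := HH) fun n k h hh => by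
      simp only [ContinuousLinearMap.comp_apply, ph_bas _ _ hh, map_smul, rp_apply]
      rw [← opR_mul_apply, qi_qj, opR_qj_bas, ph_bas _ _ (QPol.mul_cst_mem_eig hh _), map_smul,
        ← opR_qj_bas, map_neg, neg_apply, opR_mul_apply, smul_neg, ← neg_smul]
      congr 1
      fin_cases a
      · exact (ha rfl).elim
      all_goals simp [sy_eq, lv, EuclideanSpace.norm_eq, Fin.sum_univ_three]
    exact congrArg (fun T => T x) this

end TTS

end Commutators

section Index

open MeasureTheory Quaternion Filter Topology

section

variable {E : Type*} [NormedAddCommGroup E] [InnerProductSpace ℝ E]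

theorem blk_comp_diag (a b c d r : E →L[ℝ] E) :
    blk a b c d ∘L blk r 0 0 r = blk (a ∘L r) (b ∘L r) (c ∘L r) (d ∘L r) := by
  ext1 ⟨x, y⟩
  simp [blk_apply]

theorem diag_comp_blk (a b c d r : E →L[ℝ] E) :
    blk r 0 0 r ∘L blk a b c d = blk (r ∘L a) (r ∘L b) (r ∘L c) (r ∘L d) := by
  ext1 ⟨x, y⟩
  simp [blk_apply]

/-- The diagonal action of an isometry on the square of a space. -/
def diagI (A B : E →L[ℝ] E) (h1 : ∀ x, A (B x) = x) (h2 : ∀ x, B (A x) = x)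
    (hA : ∀ x, ‖A x‖ = ‖x‖) : Sqr E ≃ₗᵢ[ℝ] Sqr E where
  toFun := blk A 0 0 A
  map_add' := map_add _
  map_smul' := map_smul _
  invFun := blk B 0 0 B
  left_inv := by
    rintro ⟨x, y⟩
    change blk _ _ _ _ (blk _ _ _ _ (WithLp.toLp 2 (x, y))) = _
    simp [blk_apply, h2]
  right_inv := by
    rintro ⟨x, y⟩
    change blk _ _ _ _ (blk _ _ _ _ (WithLp.toLp 2 (x, y))) = _
    simp [blk_apply, h1]
  norm_map' := by
    rintro ⟨x, y⟩
    change ‖blk _ _ _ _ (WithLp.toLp 2 (x, y))‖ = ‖WithLp.toLp 2 (x, y)‖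
    rw [blk_apply]
    simp [WithLp.prod_norm_eq_of_L2, hA]

end

namespace TTS

theorem qi_mul_qi : cc qi * cc qi = -1 := by
  ext1 x
  ext <;> simp [cc_apply, qi]

theorem star_qi : star (cc qi) = -cc qi := by
  ext1 x
  ext <;> simp [cc_apply, qi]

theorem rp_rp (m : ℝ × ℝ) (a b : Fin 3) (x : HH) : rp m a (rp m b x) = -ph m a (ph m b x) := by
  rw [rp_apply, rp_apply, ph_opR_qi, ← opR_mul_apply, qi_mul_qi, map_neg, opR_one]
  rfl

theorem rp_ph (m : ℝ × ℝ) (a b : Fin 3) (x : HH) : rp m a (ph m b x) = ph m b (rp m a x) := by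
  rw [rp_apply, rp_apply, ph_opR_qi, ph_comp_ph]

theorem inner_rp (m : ℝ × ℝ) (a : Fin 3) (x y : HH) : ⟪rp m a x, y⟫ = -⟪x, rp m a y⟫ := by
  rw [rp_apply, rp_apply, inner_opR, star_qi, map_neg, neg_apply, inner_neg_right, inner_ph,
    ph_opR_qi]

theorem lv_ne_zero {m : ℝ × ℝ} {l : Lab} (h : l.1 ≠ 0) : lv m l ≠ 0 := fun h0 => by
  have : (l.1 : ℝ) = 0 := congrArg (fun v : EuclideanSpace ℝ (Fin 3) => v 0) h0
  exact h (by exact_mod_cast this)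

theorem sum_ph_sq (m : ℝ × ℝ) (x : HH) :
    ph m 0 (ph m 0 x) + ph m 1 (ph m 1 x) + ph m 2 (ph m 2 x) = x := by
  have : ph m 0 ∘L ph m 0 + ph m 1 ∘L ph m 1 + ph m 2 ∘L ph m 2 = 1 :=
    clm_ext_bas fun n k h hh => by
      rcases eq_or_ne n 0 with rfl | hn
      · rw [QPol.eig_zero, Submodule.mem_bot] at hh
        simp [hh]
      have h1 : ‖lv m (n, k)‖ ≠ 0 := norm_ne_zero_iff.2 (lv_ne_zero hn)
      simp only [add_apply, ContinuousLinearMap.comp_apply, ph_bas _ _ hh, map_smul, smul_smul,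
        ← add_smul]
      rw [one_apply_eq_self]
      have : sy m 0 (n, k) * sy m 0 (n, k) + sy m 1 (n, k) * sy m 1 (n, k) +
          sy m 2 (n, k) * sy m 2 (n, k) = 1 := by
        simp only [sy_eq]
        field_simp
        rw [norm_lv_sq]
        rfl
      rw [this, one_smul]
  exact congrArg (fun T => T x) this

/-- The complex structures defined by the phase of the Dirac operator. -/
def Jop (m : ℝ × ℝ) : Sqr HH →L[ℝ] Sqr HH :=
  blk (rp m 1) (rp m 2 - ph m 0) (rp m 2 + ph m 0) (-rp m 1)

theorem isCS_Jop (m : ℝ × ℝ) : IsCS (Jop m) := by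
  refine IsCS.blk (fun x => ?_) (fun x => ?_) (fun x => ?_) (fun x => ?_) (inner_rp m 1)
    (fun x y => ?_) (fun x y => ?_)
  · have := sum_ph_sq m x
    simp only [sub_apply, add_apply, map_add, rp_rp, rp_ph]
    refine Eq.trans ?_ (congrArg Neg.neg this)
    abel
  · simp only [sub_apply, neg_apply, map_sub, map_neg, rp_rp, rp_ph, ph_comp_ph m m 1 2]
    abel
  · simp only [add_apply, neg_apply, map_add, rp_rp, rp_ph, ph_comp_ph m m 1 2]
    abel
  · have := sum_ph_sq m x
    simp only [sub_apply, add_apply, neg_apply, map_neg, map_sub, rp_rp, rp_ph]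
    refine Eq.trans ?_ (congrArg Neg.neg this)
    abel
  · rw [neg_apply, neg_apply, inner_neg_left, inner_neg_right, inner_rp]
  · rw [sub_apply, add_apply, inner_sub_left, inner_add_right, inner_rp, inner_ph]
    ring

theorem isCompactOperator_Jop_sub (m : ℝ × ℝ) : IsCompactOperator (Jop 0 - Jop m) := by
  have h1 : ∀ a, IsCompactOperator (rp 0 a - rp m a) := fun a => by
    have : rp 0 a - rp m a = opR (cc qi) ∘L (ph 0 a - ph m a) := by
      ext1 x
      simp only [sub_apply, rp_apply, ContinuousLinearMap.comp_apply, map_sub]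
    rw [this]
    exact IsCompactOperator.clm_comp (isCompactOperator_ph_sub m 0 a) (opR (cc qi))
  have h0 := isCompactOperator_ph_sub m 0 0
  rw [Jop, Jop, blk_sub]
  refine isCompactOperator_blk (h1 1) ?_ ?_ ?_
  · have : rp 0 2 - ph 0 0 - (rp m 2 - ph m 0) = (rp 0 2 - rp m 2) - (ph 0 0 - ph m 0) := by abel
    rw [this]
    exact IsCompactOperator.sub (h1 2) h0
  · have : rp 0 2 + ph 0 0 - (rp m 2 + ph m 0) = (rp 0 2 - rp m 2) + (ph 0 0 - ph m 0) := by abel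
    rw [this]
    exact IsCompactOperator.add (h1 2) h0
  · have : -rp 0 1 - -rp m 1 = -(rp 0 1 - rp m 1) := by abel
    rw [this]
    exact IsCompactOperator.neg (h1 1)

/-- Unit quaternion valued functions. -/
abbrev UU := unitary C(TTS, Quaternion ℝ)

theorem opR_star_opR (q : UU) (x : HH) : opR (star (q : C(TTS, Quaternion ℝ))) (opR q x) = x := by
  rw [← opR_mul_apply, Unitary.mul_star_self_of_mem q.2, opR_one]
  rfl

theorem opR_opR_star (q : UU) (x : HH) : opR q (opR (star (q : C(TTS, Quaternion ℝ))) x) = x := by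
  rw [← opR_mul_apply, Unitary.star_mul_self_of_mem q.2, opR_one]
  rfl

theorem norm_opR (q : UU) (x : HH) : ‖opR q x‖ = ‖x‖ := by
  have : ‖opR q x‖ ^ 2 = ‖x‖ ^ 2 := by
    rw [← real_inner_self_eq_norm_sq, inner_opR, opR_star_opR, real_inner_self_eq_norm_sq]
  exact (sq_eq_sq₀ (norm_nonneg _) (norm_nonneg _)).1 this

/-- The diagonal action of a unit quaternion valued function by right multiplication. -/
def mulI (q : UU) : Sqr HH ≃ₗᵢ[ℝ] Sqr HH :=
  diagI (opR q) (opR (star (q : C(TTS, Quaternion ℝ)))) (opR_opR_star q) (opR_star_opR q)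
    (norm_opR q)

theorem coe_mulI (q : UU) : (mulI q : Sqr HH →L[ℝ] Sqr HH) = blk (opR q) 0 0 (opR q) := rfl

theorem coe_mulI_symm (q : UU) : ((mulI q).symm : Sqr HH →L[ℝ] Sqr HH) =
    blk (opR (star (q : C(TTS, Quaternion ℝ)))) 0 0 (opR (star (q : C(TTS, Quaternion ℝ)))) := rfl

/-- Conjugation by a unit quaternion valued function. -/
def qcj (q : UU) (T : HH →L[ℝ] HH) : HH →L[ℝ] HH :=
  opR (star (q : C(TTS, Quaternion ℝ))) ∘L T ∘L opR q

theorem qcj_apply (q : UU) (T : HH →L[ℝ] HH) (x : HH) :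
    qcj q T x = opR (star (q : C(TTS, Quaternion ℝ))) (T (opR q x)) := rfl

theorem cconj_mulI (q : UU) (a b c d : HH →L[ℝ] HH) :
    cconj (mulI q) (blk a b c d) = blk (qcj q a) (qcj q b) (qcj q c) (qcj q d) := by
  rw [cconj, coe_mulI, coe_mulI_symm, blk_comp_diag, diag_comp_blk]
  rfl

theorem isCompactOperator_sub_qcj {T : HH →L[ℝ] HH} (q : UU)
    (h : (q : C(TTS, Quaternion ℝ)) ∈ cmt T) : IsCompactOperator (T - qcj q T) := by
  have : T - qcj q T = -(opR (star (q : C(TTS, Quaternion ℝ))) ∘L (T ∘L opR q - opR q ∘L T)) := by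
    ext1 x
    simp only [sub_apply, neg_apply, ContinuousLinearMap.comp_apply, map_sub, opR_star_opR,
      qcj_apply]
    abel
  rw [this]
  exact IsCompactOperator.neg (IsCompactOperator.clm_comp (mem_cmt.1 h) (opR (star q.1)))

theorem isCompactOperator_sub_cconj (q : UU) :
    IsCompactOperator (Jop 0 - cconj (mulI q) (Jop 0)) := by
  have h0 := isCompactOperator_sub_qcj q (ph_zero_zero_mem q.1)
  have h1 := isCompactOperator_sub_qcj q (rp_mem (a := 1) (by decide) q.1)
  have h2 := isCompactOperator_sub_qcj q (rp_mem (a := 2) (by decide) q.1)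
  rw [Jop, cconj_mulI, blk_sub]
  refine isCompactOperator_blk h1 ?_ ?_ ?_
  · have : rp 0 2 - ph 0 0 - qcj q (rp 0 2 - ph 0 0) =
        (rp 0 2 - qcj q (rp 0 2)) - (ph 0 0 - qcj q (ph 0 0)) := by
      ext1 x
      simp only [sub_apply, qcj_apply, map_sub]
      abel
    rw [this]
    exact IsCompactOperator.sub h2 h0
  · have : rp 0 2 + ph 0 0 - qcj q (rp 0 2 + ph 0 0) =
        (rp 0 2 - qcj q (rp 0 2)) + (ph 0 0 - qcj q (ph 0 0)) := by
      ext1 x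
      simp only [sub_apply, add_apply, qcj_apply, map_add]
      abel
    rw [this]
    exact IsCompactOperator.add h2 h0
  · have : -rp 0 1 - qcj q (-rp 0 1) = -(rp 0 1 - qcj q (rp 0 1)) := by
      ext1 x
      simp only [sub_apply, neg_apply, qcj_apply, map_neg]
      abel
    rw [this]
    exact IsCompactOperator.neg h1

/-- The index of a unit quaternion valued function, an invariant modulo four. -/
def nn (q : UU) : ℕ := cidx (Jop 0) (mulI q)

theorem nn_modEq (m : ℝ × ℝ) (q : UU) :
    Module.finrank ℝ (LinearMap.ker (Jop m + cconj (mulI q) (Jop m)).toLinearMap) ≡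
      nn q [MOD 4] :=
  cidx_congr (isCS_Jop 0) (isCS_Jop m) (isCompactOperator_Jop_sub m) (isCompactOperator_sub_cconj q)

theorem nn_mul (p q : UU) : nn (p * q) ≡ nn p + nn q [MOD 4] := by
  have h : mulI (p * q) = (mulI p).trans (mulI q) := by
    ext1 ⟨x, y⟩
    change blk (opR (p * q : UU)) 0 0 (opR (p * q : UU)) (WithLp.toLp 2 (x, y)) =
      blk (opR q) 0 0 (opR q) (blk (opR p) 0 0 (opR p) (WithLp.toLp 2 (x, y)))
    have e : ∀ z, opR (p * q : UU) z = opR q (opR p z) := opR_mul_apply p.1 q.1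
    simp only [blk_apply, e, zero_apply, add_zero, zero_add]
  rw [nn, h, add_comm]
  exact cidx_mul (isCS_Jop 0) (isCompactOperator_sub_cconj q) (isCompactOperator_sub_cconj p)

theorem nn_one : nn 1 ≡ 0 [MOD 4] := by
  have h := nn_mul 1 1
  rw [one_mul] at h
  exact (Nat.ModEq.add_left_cancel' (nn 1) (by simpa using h)).symm

theorem nn_eq_of_path (q : unitInterval → UU) (hq : Continuous q) : nn (q 0) ≡ nn (q 1) [MOD 4] := by
  have h1 : Continuous fun t => opR (q t : C(TTS, Quaternion ℝ)) :=
    opR.continuous.comp (continuous_subtype_val.comp hq)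
  have h2 : Continuous fun t => opR (star (q t : C(TTS, Quaternion ℝ))) :=
    opR.continuous.comp (continuous_subtype_val.comp hq).star
  refine cidx_eq_of_path (isCS_Jop 0) (fun t => mulI (q t)) ?_ ?_
    fun t => isCompactOperator_sub_cconj _
  · simp only [coe_mulI]
    exact continuous_blk h1 continuous_const continuous_const h1
  · simp only [coe_mulI_symm]
    exact continuous_blk h2 continuous_const continuous_const h2

end TTS

end Index

section Kernel

open MeasureTheory Quaternion Filter Topology

section

variable {E : Type*} [NormedAddCommGroup E] [InnerProductSpace ℝ E]

/-- The kernel equation for a Dirac type operator forces the vanishing of both parts. -/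
theorem kernel_equation {K L A B : E →L[ℝ] E} (hK : ∀ x y, ⟪K x, y⟫ = -⟪x, K y⟫)
    (hL : ∀ x y, ⟪L x, y⟫ = -⟪x, L y⟫) (hKL : ∀ x, K (L x) = L (K x))
    (hKA : ∀ x, K (A x) = A (K x)) (hLA : ∀ x, L (A x) = A (L x))
    (hKB : ∀ x, K (B x) = B (K x)) (hLB : ∀ x, L (B x) = B (L x))
    (hA : ∀ x y, ⟪A x, y⟫ = ⟪x, A y⟫) (hB : ∀ x, 0 ≤ ⟪B x, x⟫) (hB' : ∀ x, ⟪B x, x⟫ = 0 → x = 0)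
    {y z : E} (h1 : K (B y) + (L (B z) - A z) = 0) (h2 : L (B y) + A y - K (B z) = 0) :
    (K (K y) + L (L y) = 0 ∧ A y = 0) ∧ (K (K z) + L (L z) = 0 ∧ A z = 0) := by
  have e1 : B (K y + L z) = A z := by
    rw [map_add, ← hKB, ← hLB]
    rw [← add_sub_assoc] at h1
    exact sub_eq_zero.1 h1
  have e2 : B (L y - K z) = -A y := by
    rw [map_sub, ← hKB, ← hLB, eq_neg_iff_add_eq_zero, ← h2]
    abel
  have sk : ∀ T : E →L[ℝ] E, (∀ x y, ⟪T x, y⟫ = -⟪x, T y⟫) → (∀ x, T (A x) = A (T x)) →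
      ∀ x y, ⟪A x, T y⟫ = -⟪A y, T x⟫ := fun T hT hTA x y => by
    rw [hA, ← hTA, real_inner_comm, hT]
  have s1 := sk K hK hKA z y
  have s2 := sk L hL hLA z z
  have s3 := sk L hL hLA y y
  have e3 : ⟪B (K y + L z), K y + L z⟫ + ⟪B (L y - K z), L y - K z⟫ = 0 := by
    rw [e1, e2, inner_add_right, inner_neg_left, inner_sub_right]
    linarith
  have p1 := hB (K y + L z)
  have p2 := hB (L y - K z)
  have u1 : K y + L z = 0 := hB' _ (by linarith)
  have u2 : L y - K z = 0 := hB' _ (by linarith)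
  have v1 : K y = -L z := eq_neg_of_add_eq_zero_left u1
  have v2 : L y = K z := sub_eq_zero.1 u2
  refine ⟨⟨?_, ?_⟩, ?_, ?_⟩
  · rw [v1, v2, map_neg, hKL, neg_add_cancel]
  · rw [u2, map_zero] at e2
    exact neg_eq_zero.1 e2.symm
  · have v3 : L z = -K y := by rw [v1, neg_neg]
    rw [← v2, v3, map_neg, hKL, add_neg_cancel]
  · rw [u1, map_zero] at e1
    exact e1.symm

theorem Dec.diag_comp_sqrt {ι H : Type*} [NormedAddCommGroup H] [InnerProductSpace ℝ H]
    [CompleteSpace H] (d : Dec ι H) {γ : ι → ℝ} (h0 : ∀ i, 0 ≤ γ i) (h1 : ∀ i, γ i ≤ 1) (x : H) :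
    d.diag (fun i => √(γ i)) (d.diag (fun i => √(γ i)) x) = d.diag γ x := by
  have b1 : ∃ C, ∀ i, |γ i| ≤ C := ⟨1, fun i => by rw [abs_of_nonneg (h0 i)]; exact h1 i⟩
  have b2 : ∃ C, ∀ i, |√(γ i)| ≤ C :=
    ⟨1, fun i => by rw [abs_of_nonneg (Real.sqrt_nonneg _)]; exact Real.sqrt_le_one.2 (h1 i)⟩
  have : d.diag (fun i => √(γ i)) ∘L d.diag (fun i => √(γ i)) = d.diag γ :=
    d.clm_ext fun i x hx => by
      rw [ContinuousLinearMap.comp_apply, d.diag_apply b2 hx, map_smul, d.diag_apply b2 hx,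
        d.diag_apply b1 hx, smul_smul, Real.mul_self_sqrt (h0 i)]
  exact congrArg (fun T => T x) this

theorem Dec.inner_diag_self_nonneg {ι H : Type*} [NormedAddCommGroup H] [InnerProductSpace ℝ H]
    [CompleteSpace H] (d : Dec ι H) {γ : ι → ℝ} (h0 : ∀ i, 0 ≤ γ i) (h1 : ∀ i, γ i ≤ 1) (x : H) :
    0 ≤ ⟪d.diag γ x, x⟫ := by
  rw [← d.diag_comp_sqrt h0 h1, d.inner_diag]
  exact real_inner_self_nonneg

theorem Dec.inner_eq_zero_of_inner_diag {ι H : Type*} [NormedAddCommGroup H]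
    [InnerProductSpace ℝ H] [CompleteSpace H] (d : Dec ι H) {γ : ι → ℝ} (h0 : ∀ i, 0 ≤ γ i)
    (h1 : ∀ i, γ i ≤ 1) {x : H} (hx : ⟪d.diag γ x, x⟫ = 0) {i : ι} (hi : 0 < γ i) {y : H}
    (hy : y ∈ d.V i) : ⟪y, x⟫ = 0 := by
  rw [← d.diag_comp_sqrt h0 h1, d.inner_diag, inner_self_eq_zero] at hx
  have b2 : ∃ C, ∀ i, |√(γ i)| ≤ C :=
    ⟨1, fun i => by rw [abs_of_nonneg (Real.sqrt_nonneg _)]; exact Real.sqrt_le_one.2 (h1 i)⟩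
  have : ⟪d.diag (fun i => √(γ i)) y, x⟫ = 0 := by rw [d.inner_diag, hx, inner_zero_right]
  rw [d.diag_apply b2 hy, inner_smul_left] at this
  exact (mul_eq_zero.1 this).resolve_left (Real.sqrt_pos.2 hi).ne'

end

namespace TTS

/-- The function `a + χ b j` for `a + b j` in the three-sphere and a character `χ`. -/
def qm (m : ℤ × ℤ) : C(TTS, Quaternion ℝ) :=
  toQ (lastP (MvPolynomial.X 0)) + toQ (lastP (MvPolynomial.X 1)) * cc qi +
    (toQ (lastP (MvPolynomial.X 2)) + toQ (lastP (MvPolynomial.X 3)) * cc qi) * (chr m * cc qj)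

/-- The shift of the labels associated to `m`. -/
def hf (m : ℤ × ℤ) : ℝ × ℝ := ((m.1 : ℝ) / 2, (m.2 : ℝ) / 2)

/-- The square of the norm of the shifted label in the last two coordinates. -/
def wsq (m k : ℤ × ℤ) : ℝ := (k.1 + (hf m).1) ^ 2 + (k.2 + (hf m).2) ^ 2

theorem wsq_nonneg (m k : ℤ × ℤ) : 0 ≤ wsq m k := by unfold wsq; positivity

/-- The bounded transform of the shifted label. -/
def tsy (m : ℤ × ℤ) (a : Fin 3) (l : Lab) : ℝ := lv (hf m) l a / √(1 + wsq m l.2)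

/-- The quotient of the two normalizations. -/
def bsy (m : ℤ × ℤ) (l : Lab) : ℝ := if l.1 = 0 then 1 else √(1 + wsq m l.2) / ‖lv (hf m) l‖

theorem tsy_bdd (m : ℤ × ℤ) {a : Fin 3} (ha : a ≠ 0) : ∃ C, ∀ l, |tsy m a l| ≤ C := by
  refine ⟨1, fun l => ?_⟩
  have h := wsq_nonneg m l.2
  have h1 : 0 < √(1 + wsq m l.2) := Real.sqrt_pos.2 (by linarith)
  rw [tsy, abs_div, abs_of_pos h1, div_le_one h1]
  refine Real.abs_le_sqrt ?_
  unfold wsq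
  have s1 := sq_nonneg ((l.2.1 : ℝ) + (hf m).1)
  have s2 := sq_nonneg ((l.2.2 : ℝ) + (hf m).2)
  fin_cases a
  · exact (ha rfl).elim
  · change ((l.2.1 : ℝ) + (hf m).1) ^ 2 ≤ _
    linarith
  · change ((l.2.2 : ℝ) + (hf m).2) ^ 2 ≤ _
    linarith

theorem bsy_pos (m : ℤ × ℤ) (l : Lab) : 0 < bsy m l := by
  unfold bsy
  have h := wsq_nonneg m l.2
  split_ifs with h0
  · norm_num
  · exact div_pos (Real.sqrt_pos.2 (by linarith)) (norm_pos_iff.2 (lv_ne_zero h0))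

theorem bsy_le (m : ℤ × ℤ) (l : Lab) : bsy m l ≤ 1 := by
  unfold bsy
  split_ifs with h0
  · exact le_rfl
  · refine (div_le_one (norm_pos_iff.2 (lv_ne_zero h0))).2 (Real.sqrt_le_iff.2 ⟨norm_nonneg _, ?_⟩)
    rw [norm_lv_sq]
    have h1 : (1 : ℝ) ≤ (l.1 : ℝ) ^ 2 := by
      have : (1 : ℤ) ≤ l.1 ^ 2 := (pow_pos (abs_pos.2 h0) 2).trans_eq (sq_abs _)
      exact_mod_cast this
    unfold wsq
    linarith

theorem bsy_bdd (m : ℤ × ℤ) : ∃ C, ∀ l, |bsy m l| ≤ C :=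
  ⟨1, fun l => by rw [abs_of_pos (bsy_pos m l)]; exact bsy_le m l⟩

/-- The bounded transform of the torus part of the Dirac operator. -/
def kp (m : ℤ × ℤ) (a : Fin 3) : HH →L[ℝ] HH := opR (cc qi) ∘L dec.diag (tsy m a)

/-- The positive operator relating the two normalizations. -/
def bp (m : ℤ × ℤ) : HH →L[ℝ] HH := dec.diag (bsy m)

theorem kp_bas (m : ℤ × ℤ) {a : Fin 3} (ha : a ≠ 0) {n : ℤ} {h : QPol} (hh : h ∈ QPol.eig n)
    (k : ℤ × ℤ) : kp m a (bas k h) = tsy m a (n, k) • bas k (h * QPol.cst qi) := by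
  rw [kp, ContinuousLinearMap.comp_apply, dec.diag_apply (tsy_bdd m ha) (bas_mem_VV hh k), map_smul,
    opR_qi_bas]

theorem bp_bas (m : ℤ × ℤ) {n : ℤ} {h : QPol} (hh : h ∈ QPol.eig n) (k : ℤ × ℤ) :
    bp m (bas k h) = bsy m (n, k) • bas k h :=
  dec.diag_apply (bsy_bdd m) (bas_mem_VV hh k)

theorem mul_cst_mul_cst (h : QPol) (c d : Quaternion ℝ) :
    h * QPol.cst c * QPol.cst d = h * QPol.cst (c * d) := by
  rw [mul_assoc]
  congr 1
  refine QuaternionAlgebra.ext ?_ ?_ ?_ ?_ <;>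
  simp [QPol.cst]

theorem mul_cst_neg (h : QPol) (c : Quaternion ℝ) : h * QPol.cst (-c) = -(h * QPol.cst c) := by
  refine QuaternionAlgebra.ext ?_ ?_ ?_ ?_ <;>
  simp [QPol.cst] <;> ring

theorem mul_cst_one (h : QPol) : h * QPol.cst 1 = h := by
  refine QuaternionAlgebra.ext ?_ ?_ ?_ ?_ <;>
  simp [QPol.cst]

theorem qi_qi : qi * qi = -1 := by ext <;> simp [qi]

theorem qj_qi : qj * qi = -(qi * qj) := by ext <;> simp [qi, qj]

theorem cst_qi_qi (h : QPol) : h * QPol.cst qi * QPol.cst qi = -h := by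
  rw [mul_cst_mul_cst, qi_qi, mul_cst_neg, mul_cst_one]

theorem kp_kp_bas (m : ℤ × ℤ) {a b : Fin 3} (ha : a ≠ 0) (hb : b ≠ 0) {n : ℤ} {h : QPol}
    (hh : h ∈ QPol.eig n) (k : ℤ × ℤ) :
    kp m a (kp m b (bas k h)) = -((tsy m a (n, k) * tsy m b (n, k)) • bas k h) := by
  rw [kp_bas m hb hh, map_smul, kp_bas m ha (QPol.mul_cst_mem_eig hh _), cst_qi_qi, map_neg,
    smul_neg, smul_neg, smul_smul, mul_comm]

theorem kp_comm (m : ℤ × ℤ) (x : HH) : kp m 1 (kp m 2 x) = kp m 2 (kp m 1 x) := by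
  have : kp m 1 ∘L kp m 2 = kp m 2 ∘L kp m 1 := clm_ext_bas fun n k h hh => by
    rw [ContinuousLinearMap.comp_apply, ContinuousLinearMap.comp_apply,
      kp_kp_bas m (by decide) (by decide) hh, kp_kp_bas m (by decide) (by decide) hh, mul_comm]
  exact congrArg (fun T => T x) this

theorem kp_ph (m : ℤ × ℤ) {a : Fin 3} (ha : a ≠ 0) (x : HH) :
    kp m a (ph (hf m) 0 x) = ph (hf m) 0 (kp m a x) := by
  have : kp m a ∘L ph (hf m) 0 = ph (hf m) 0 ∘L kp m a := clm_ext_bas fun n k h hh => by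
    rw [ContinuousLinearMap.comp_apply, ContinuousLinearMap.comp_apply, ph_bas _ _ hh, map_smul,
      kp_bas m ha hh, map_smul, ph_bas _ _ (QPol.mul_cst_mem_eig hh _), smul_comm]
  exact congrArg (fun T => T x) this

theorem kp_bp (m : ℤ × ℤ) {a : Fin 3} (ha : a ≠ 0) (x : HH) :
    kp m a (bp m x) = bp m (kp m a x) := by
  have : kp m a ∘L bp m = bp m ∘L kp m a := clm_ext_bas fun n k h hh => by
    rw [ContinuousLinearMap.comp_apply, ContinuousLinearMap.comp_apply, bp_bas _ hh, map_smul,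
      kp_bas m ha hh, map_smul, bp_bas _ (QPol.mul_cst_mem_eig hh _), smul_comm]
  exact congrArg (fun T => T x) this

theorem rp_hf (m : ℤ × ℤ) {a : Fin 3} (ha : a ≠ 0) (x : HH) :
    rp (hf m) a x = kp m a (bp m x) := by
  have : rp (hf m) a = kp m a ∘L bp m := clm_ext_bas fun n k h hh => by
    rcases eq_or_ne n 0 with rfl | hn
    · rw [QPol.eig_zero, Submodule.mem_bot] at hh
      rw [hh, map_zero, map_zero, map_zero]
    rw [ContinuousLinearMap.comp_apply, bp_bas _ hh, map_smul, kp_bas m ha hh, rp_apply,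
      ph_bas _ _ hh, map_smul, opR_qi_bas, smul_smul]
    congr 1
    have h1 : ‖lv (hf m) (n, k)‖ ≠ 0 := norm_ne_zero_iff.2 (lv_ne_zero hn)
    have h2 : √(1 + wsq m k) ≠ 0 := (Real.sqrt_pos.2 (by have := wsq_nonneg m k; linarith)).ne'
    rw [sy_eq, bsy, tsy, if_neg hn]
    field_simp
  exact congrArg (fun T => T x) this

theorem inner_kp (m : ℤ × ℤ) {a : Fin 3} (ha : a ≠ 0) (x y : HH) :
    ⟪kp m a x, y⟫ = -⟪x, kp m a y⟫ := by
  have h1 : ∀ x, dec.diag (tsy m a) (opR (cc qi) x) = opR (cc qi) (dec.diag (tsy m a) x) := fun x => by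
    have : dec.diag (tsy m a) ∘L opR (cc qi) = opR (cc qi) ∘L dec.diag (tsy m a) :=
      clm_ext_bas fun n k h hh => by
        rw [ContinuousLinearMap.comp_apply, ContinuousLinearMap.comp_apply,
          dec.diag_apply (tsy_bdd m ha) (bas_mem_VV hh k), map_smul, opR_qi_bas,
          dec.diag_apply (tsy_bdd m ha) (bas_mem_VV (QPol.mul_cst_mem_eig hh _) k)]
    exact congrArg (fun T => T x) this
  rw [kp, ContinuousLinearMap.comp_apply, ContinuousLinearMap.comp_apply, inner_opR, star_qi, map_neg,
    neg_apply, inner_neg_right, dec.inner_diag, h1]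

/-- The functions commuting with a given operator. -/
def Cen (T : HH →L[ℝ] HH) (q : C(TTS, Quaternion ℝ)) : Prop := ∀ x, T (opR q x) = opR q (T x)

theorem Cen.add {T : HH →L[ℝ] HH} {p q : C(TTS, Quaternion ℝ)} (hp : Cen T p) (hq : Cen T q) :
    Cen T (p + q) := fun x => by
  rw [map_add, add_apply, add_apply, map_add, hp, hq]

theorem Cen.mul {T : HH →L[ℝ] HH} {p q : C(TTS, Quaternion ℝ)} (hp : Cen T p) (hq : Cen T q) :
    Cen T (p * q) := fun x => by
  rw [opR_mul_apply, opR_mul_apply, hq, hp]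

theorem Cen.of_comp {T : HH →L[ℝ] HH} {q : C(TTS, Quaternion ℝ)}
    (h : T ∘L opR q = opR q ∘L T) : Cen T q := fun x => congrArg (fun T => T x) h

theorem tsy_neg (m k : ℤ × ℤ) {a : Fin 3} (ha : a ≠ 0) (n : ℤ) :
    tsy m a (n, -(k + m)) = -tsy m a (n, k) := by
  have h1 : wsq m (-(k + m)) = wsq m k := by
    simp only [wsq, hf, Prod.fst_neg, Prod.snd_neg, Prod.fst_add, Prod.snd_add]
    push_cast
    ring
  have h2 : lv (hf m) (n, -(k + m)) a = -lv (hf m) (n, k) a := by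
    fin_cases a
    · exact (ha rfl).elim
    · change (((-(k.1 + m.1) : ℤ)) : ℝ) + m.1 / 2 = -((k.1 : ℝ) + m.1 / 2)
      push_cast
      ring
    · change (((-(k.2 + m.2) : ℤ)) : ℝ) + m.2 / 2 = -((k.2 : ℝ) + m.2 / 2)
      push_cast
      ring
  rw [tsy, tsy, h1, h2, neg_div]

theorem tsy_congr (m k : ℤ × ℤ) {a : Fin 3} (ha : a ≠ 0) (n n' : ℤ) :
    tsy m a (n, k) = tsy m a (n', k) := by
  fin_cases a
  · exact (ha rfl).elim
  · rfl
  · rfl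

theorem cen_kp_qm (m : ℤ × ℤ) {a : Fin 3} (ha : a ≠ 0) : Cen (kp m a) (qm m) := by
  have h1 : ∀ i, Cen (kp m a) (toQ (lastP (MvPolynomial.X i))) := fun i =>
    Cen.of_comp <| clm_ext_bas fun n k h hh => by
      obtain ⟨j, y, hy, -, e, -⟩ := exists_coordinate_action i hh k
      rw [ContinuousLinearMap.comp_apply, ContinuousLinearMap.comp_apply, kp_bas m ha hh, e, map_sum,
        map_smul, ← opR_qi_bas, ← opR_mul_apply, ← toQ_comm, opR_mul_apply, e, map_sum,
        Finset.smul_sum]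
      refine Finset.sum_congr rfl fun i _ => ?_
      rw [kp_bas m ha (hy i), opR_qi_bas, tsy_congr m k ha (j i) n]
  have h2 : Cen (kp m a) (cc qi) := Cen.of_comp <| clm_ext_bas fun n k h hh => by
    rw [ContinuousLinearMap.comp_apply, ContinuousLinearMap.comp_apply, kp_bas m ha hh, opR_qi_bas,
      kp_bas m ha (QPol.mul_cst_mem_eig hh _), map_smul, opR_qi_bas]
  have h3 : Cen (kp m a) (chr m * cc qj) := Cen.of_comp <| clm_ext_bas fun n k h hh => by
    rw [ContinuousLinearMap.comp_apply, ContinuousLinearMap.comp_apply, kp_bas m ha hh, opR_mul_apply,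
      opR_mul_apply, map_smul, opR_chr_bas, opR_qj_bas, kp_bas m ha (QPol.mul_cst_mem_eig hh _),
      tsy_neg m k ha, map_smul, opR_chr_bas, opR_qj_bas, neg_smul, ← smul_neg, ← map_neg]
    rw [mul_cst_mul_cst, mul_cst_mul_cst, qj_qi, mul_cst_neg, neg_neg]
  unfold qm
  exact ((h1 0).add ((h1 1).mul h2)).add (((h1 2).add ((h1 3).mul h2)).mul h3)

theorem Cen.star {T : HH →L[ℝ] HH} {q : UU} (h : Cen T q) : Cen T (star (q : C(TTS, Quaternion ℝ))) :=
  fun x => by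
    have := h (opR (Star.star (q : C(TTS, Quaternion ℝ))) x)
    rw [opR_opR_star] at this
    rw [this, opR_star_opR]

theorem Cen.qcj_comm {T S : HH →L[ℝ] HH} {q : UU} (h : Cen T q) (hS : ∀ x, T (S x) = S (T x)) (x : HH) :
    T (qcj q S x) = qcj q S (T x) := by
  rw [qcj_apply, qcj_apply, h.star, hS, h]

theorem inner_qcj (q : UU) (T : HH →L[ℝ] HH) (x y : HH) :
    ⟪qcj q T x, y⟫ = ⟪T (opR q x), opR q y⟫ := by
  rw [qcj_apply, inner_opR, star_star]

theorem mem_unitary_of_normSq {q : C(TTS, Quaternion ℝ)} (h : ∀ x, normSq (q x) = 1) :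
    q ∈ unitary C(TTS, Quaternion ℝ) := by
  refine Unitary.mem_iff.2 ⟨?_, ?_⟩ <;> ext1 x
  · exact (Quaternion.star_mul_self _).trans (by rw [h]; rfl)
  · exact (Quaternion.self_mul_star _).trans (by rw [h]; rfl)

theorem qm_apply (m : ℤ × ℤ) (x : TTS) :
    qm m x = hq (x.2.2 : Quaternion ℝ).re (x.2.2 : Quaternion ℝ).imI
      ((x.2.2 : Quaternion ℝ).imJ * ((x.1 ^ m.1 * x.2.1 ^ m.2 : Circle) : ℂ).re -
        (x.2.2 : Quaternion ℝ).imK * ((x.1 ^ m.1 * x.2.1 ^ m.2 : Circle) : ℂ).im)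
      ((x.2.2 : Quaternion ℝ).imJ * ((x.1 ^ m.1 * x.2.1 ^ m.2 : Circle) : ℂ).im +
        (x.2.2 : Quaternion ℝ).imK * ((x.1 ^ m.1 * x.2.1 ^ m.2 : Circle) : ℂ).re) := by
  have h0 : lastP (MvPolynomial.X 0) x = (x.2.2 : Quaternion ℝ).re := by simp [lastP, evP]
  have h1 : lastP (MvPolynomial.X 1) x = (x.2.2 : Quaternion ℝ).imI := by simp [lastP, evP]
  have h2 : lastP (MvPolynomial.X 2) x = (x.2.2 : Quaternion ℝ).imJ := by simp [lastP, evP]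
  have h3 : lastP (MvPolynomial.X 3) x = (x.2.2 : Quaternion ℝ).imK := by simp [lastP, evP]
  change (lastP (MvPolynomial.X 0) x : Quaternion ℝ) + (lastP (MvPolynomial.X 1) x : Quaternion ℝ) * qi +
    ((lastP (MvPolynomial.X 2) x : Quaternion ℝ) + (lastP (MvPolynomial.X 3) x : Quaternion ℝ) * qi) *
      ((((x.1 ^ m.1 * x.2.1 ^ m.2 : Circle) : ℂ) : Quaternion ℝ) * qj) = _
  rw [h0, h1, h2, h3]
  generalize ((x.1 ^ m.1 * x.2.1 ^ m.2 : Circle) : ℂ) = w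
  have i0 : qi.re = 0 := rfl
  have i1 : qi.imI = 1 := rfl
  have i2 : qi.imJ = 0 := rfl
  have i3 : qi.imK = 0 := rfl
  have j0 : qj.re = 0 := rfl
  have j1 : qj.imI = 0 := rfl
  have j2 : qj.imJ = 1 := rfl
  have j3 : qj.imK = 0 := rfl
  ext <;> simp [i0, i1, i2, i3, j0, j1, j2, j3, hq]

theorem qm_mem (m : ℤ × ℤ) : qm m ∈ unitary C(TTS, Quaternion ℝ) :=
  mem_unitary_of_normSq fun x => by
    have h1 : normSq (x.2.2 : Quaternion ℝ) = 1 := by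
      rw [Quaternion.normSq_eq_norm_mul_self]
      simp
    have h2 : Complex.normSq ((x.1 ^ m.1 * x.2.1 ^ m.2 : Circle) : ℂ) = 1 := Circle.normSq_coe _
    rw [Quaternion.normSq_def'] at h1 ⊢
    rw [Complex.normSq_apply] at h2
    rw [qm_apply]
    simp only [hq]
    linear_combination h1 + ((x.2.2 : Quaternion ℝ).imJ ^ 2 + (x.2.2 : Quaternion ℝ).imK ^ 2) * h2

/-- The unit quaternion valued function `a + χ b j`. -/
def qM (m : ℤ × ℤ) : UU := ⟨qm m, qm_mem m⟩

/-- The vertical part of the kernel operator. -/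
def av (m : ℤ × ℤ) : HH →L[ℝ] HH := ph (hf m) 0 + qcj (qM m) (ph (hf m) 0)

theorem inner_av (m : ℤ × ℤ) (x y : HH) : ⟪av m x, y⟫ = ⟪x, av m y⟫ := by
  rw [av, add_apply, add_apply, inner_add_left, inner_add_right, inner_ph, inner_qcj, inner_ph,
    real_inner_comm (qcj _ _ y) x, inner_qcj, real_inner_comm (opR _ x)]

/-- The operator whose kernel computes the index. -/
def ker_op (m : ℤ × ℤ) : Sqr HH →L[ℝ] Sqr HH := Jop (hf m) + cconj (mulI (qM m)) (Jop (hf m))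

theorem ker_op_apply (m : ℤ × ℤ) (y z : HH) : ker_op m (WithLp.toLp 2 (y, z)) = WithLp.toLp 2
    (kp m 1 ((bp m + qcj (qM m) (bp m)) y) +
      (kp m 2 ((bp m + qcj (qM m) (bp m)) z) - av m z),
    (kp m 2 ((bp m + qcj (qM m) (bp m)) y) + av m y) -
      kp m 1 ((bp m + qcj (qM m) (bp m)) z)) := by
  have h : ∀ a : Fin 3, a ≠ 0 → ∀ x, rp (hf m) a x + qcj (qM m) (rp (hf m) a) x =
      kp m a ((bp m + qcj (qM m) (bp m)) x) := fun a ha x => by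
    rw [add_apply, map_add, qcj_apply, qcj_apply, rp_hf m ha, rp_hf m ha,
      Cen.star (q := qM m) (cen_kp_qm m ha)]
  rw [ker_op, Jop, cconj_mulI, add_apply, blk_apply, blk_apply, ← h 1 (by decide),
    ← h 1 (by decide), ← h 2 (by decide), ← h 2 (by decide)]
  simp only [av, qcj_apply, add_apply, sub_apply, neg_apply, map_add, map_sub, map_neg]
  rw [← WithLp.toLp_add, Prod.mk_add_mk]
  congr 2 <;> abel

theorem of_ker_op_eq_zero (m : ℤ × ℤ) {y z : HH} (h : ker_op m (WithLp.toLp 2 (y, z)) = 0) :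
    ((∀ k, wsq m k ≠ 0 → ∀ n, ∀ v ∈ VV (n, k), ⟪v, y⟫ = 0) ∧ av m y = 0) ∧
      ((∀ k, wsq m k ≠ 0 → ∀ n, ∀ v ∈ VV (n, k), ⟪v, z⟫ = 0) ∧ av m z = 0) := by
  rw [ker_op_apply] at h
  have h1 := congrArg (fun w : Sqr HH => (WithLp.ofLp w).1) h
  have h2 := congrArg (fun w : Sqr HH => (WithLp.ofLp w).2) h
  have c1 : Cen (kp m 1) (qM m) := cen_kp_qm m (by decide)
  have c2 : Cen (kp m 2) (qM m) := cen_kp_qm m (by decide)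
  have b0 : ∀ x, 0 ≤ ⟪bp m x, x⟫ :=
    dec.inner_diag_self_nonneg (fun l => (bsy_pos m l).le) (bsy_le m)
  have hA : ∀ a : Fin 3, a ≠ 0 → ∀ x, kp m a (av m x) = av m (kp m a x) := fun a ha x => by
    rw [av, add_apply, add_apply, map_add, kp_ph m ha,
      Cen.qcj_comm (q := qM m) (cen_kp_qm m ha) (kp_ph m ha)]
  have hB : ∀ a : Fin 3, a ≠ 0 → ∀ x, kp m a ((bp m + qcj (qM m) (bp m)) x) =
      (bp m + qcj (qM m) (bp m)) (kp m a x) := fun a ha x => by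
    rw [add_apply, add_apply, map_add, kp_bp m ha,
      Cen.qcj_comm (q := qM m) (cen_kp_qm m ha) (kp_bp m ha)]
  have key := kernel_equation (K := kp m 1) (L := kp m 2) (A := av m)
    (B := bp m + qcj (qM m) (bp m)) (inner_kp m (by decide)) (inner_kp m (by decide)) (kp_comm m)
    (hA 1 (by decide)) (hA 2 (by decide)) (hB 1 (by decide)) (hB 2 (by decide))
    (inner_av m)
    (fun x => by
      rw [add_apply, inner_add_left, inner_qcj]
      exact add_nonneg (b0 _) (b0 _))
    (fun x hx => by
      rw [add_apply, inner_add_left, inner_qcj] at hx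
      have hx' : ⟪bp m x, x⟫ = 0 := by linarith [b0 x, b0 (opR (qM m) x)]
      exact dec.eq_zero_of_orthogonal fun l v hv =>
        dec.inner_eq_zero_of_inner_diag (fun l => (bsy_pos m l).le) (bsy_le m) hx' (bsy_pos m l) hv)
    h1 h2
  have sq : ∀ l : Lab, tsy m 1 l * tsy m 1 l + tsy m 2 l * tsy m 2 l = wsq m l.2 / (1 + wsq m l.2) :=
    fun l => by
      have := wsq_nonneg m l.2
      rw [tsy, tsy, div_mul_div_comm, div_mul_div_comm, ← add_div, Real.mul_self_sqrt (by linarith)]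
      congr 1
      unfold wsq
      change ((l.2.1 : ℝ) + (hf m).1) * (l.2.1 + (hf m).1) + ((l.2.2 : ℝ) + (hf m).2) * (l.2.2 + (hf m).2) = _
      ring
  have s0 : ∀ l : Lab, 0 ≤ wsq m l.2 / (1 + wsq m l.2) := fun l => by
    have := wsq_nonneg m l.2
    positivity
  have s1 : ∀ l : Lab, wsq m l.2 / (1 + wsq m l.2) ≤ 1 := fun l => by
    have := wsq_nonneg m l.2
    exact (div_le_one (by linarith)).2 (by linarith)
  have hd : kp m 1 ∘L kp m 1 + kp m 2 ∘L kp m 2 =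
      -dec.diag (fun l => wsq m l.2 / (1 + wsq m l.2)) := clm_ext_bas fun n k h hh => by
    rw [add_apply, ContinuousLinearMap.comp_apply, ContinuousLinearMap.comp_apply,
      kp_kp_bas m (by decide) (by decide) hh, kp_kp_bas m (by decide) (by decide) hh, neg_apply,
      dec.diag_apply ⟨1, fun l => by rw [abs_of_nonneg (s0 l)]; exact s1 l⟩ (bas_mem_VV hh k),
      ← neg_add, ← add_smul, sq]
  have fin : ∀ y, kp m 1 (kp m 1 y) + kp m 2 (kp m 2 y) = 0 →
      ∀ k, wsq m k ≠ 0 → ∀ n, ∀ v ∈ VV (n, k), ⟪v, y⟫ = 0 := fun y hy k hk n v hv => by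
    have h3 : dec.diag (fun l => wsq m l.2 / (1 + wsq m l.2)) y = 0 := by
      have := congrArg (fun T => T y) hd
      rw [add_apply, ContinuousLinearMap.comp_apply, ContinuousLinearMap.comp_apply, hy,
        neg_apply] at this
      exact neg_eq_zero.1 this.symm
    refine dec.inner_eq_zero_of_inner_diag s0 s1 (i := (n, k)) (by rw [h3, inner_zero_left]) ?_ hv
    have := (wsq_nonneg m k).lt_of_ne' hk
    have h4 : 0 < 1 + wsq m k := by linarith
    exact div_pos this h4
  exact ⟨⟨fin y key.1.1, key.1.2⟩, fin z key.2.1, key.2.2⟩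

theorem nn_qM_of_odd {m : ℤ × ℤ} (hm : Odd m.1 ∨ Odd m.2) : nn (qM m) ≡ 0 [MOD 4] := by
  have hw : ∀ k, wsq m k ≠ 0 := fun k h0 => by
    have h1 : (2 * k.1 + m.1) ^ 2 + (2 * k.2 + m.2) ^ 2 = 0 := by
      have : (((2 * k.1 + m.1) ^ 2 + (2 * k.2 + m.2) ^ 2 : ℤ) : ℝ) = 4 * wsq m k := by
        unfold wsq hf
        push_cast
        ring
      rw [h0, mul_zero] at this
      exact_mod_cast this
    have h2 : 2 * k.1 + m.1 = 0 := by nlinarith [sq_nonneg (2 * k.1 + m.1), sq_nonneg (2 * k.2 + m.2)]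
    have h3 : 2 * k.2 + m.2 = 0 := by nlinarith [sq_nonneg (2 * k.1 + m.1), sq_nonneg (2 * k.2 + m.2)]
    rcases hm with ⟨a, ha⟩ | ⟨a, ha⟩ <;> omega
  refine (nn_modEq (hf m) (qM m)).symm.trans ?_
  have : LinearMap.ker (ker_op m).toLinearMap = ⊥ := by
    rw [LinearMap.ker_eq_bot']
    rintro ⟨y, z⟩ h
    obtain ⟨⟨hy, -⟩, hz, -⟩ := of_ker_op_eq_zero m h
    have y0 : y = 0 := dec.eq_zero_of_orthogonal fun l v hv => hy l.2 (hw _) l.1 v hv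
    have z0 : z = 0 := dec.eq_zero_of_orthogonal fun l v hv => hz l.2 (hw _) l.1 v hv
    rw [y0, z0]
    rfl
  have e : Module.finrank ℝ (LinearMap.ker (ker_op m).toLinearMap) = 0 := by
    rw [this]
    exact finrank_bot ℝ _
  exact e ▸ Nat.ModEq.refl _

end TTS

end Kernel

section Zero

open MeasureTheory Quaternion Filter Topology

namespace QPol

/-- The Dirac operator conjugated by the identity function. -/
def dd (h : QPol) : QPol := dir h - h - (2 : ℝ) • star h

theorem dir_mul_xq' (h : QPol) : dir (h * xq) = dd h * xq := dir_mul_xq h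

theorem dd_mem_harm {n : ℕ} {h : QPol} (hh : h ∈ harm n) : dd h ∈ harm n :=
  sub_mem (sub_mem (dir_mem_harm hh) hh) (Submodule.smul_mem _ _ (star_mem_harm hh))

theorem mul_xq (h : QPol) : h * xq = (MvPolynomial.X 0 : Pol) • (h * cst 1) +
    (MvPolynomial.X 1 : Pol) • (h * cst (TTS.hq 0 1 0 0)) +
    (MvPolynomial.X 2 : Pol) • (h * cst (TTS.hq 0 0 1 0)) +
    (MvPolynomial.X 3 : Pol) • (h * cst (TTS.hq 0 0 0 1)) := by
  ext1 <;> simp [xq, cst, TTS.hq] <;> ring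

end QPol

namespace TTS

/-- Generators of the space of functions with the eigenvalues `± N` and `± (N + 2)`. -/
def Gen (N : ℕ) (t : ℤ) (u : QPol) : Prop :=
  (t.natAbs = N ∨ t.natAbs = N + 2) ∧ QPol.dir u = (t : ℝ) • u ∧ bas 0 u ∈ VV (t, 0) ∧
    (t ≠ 0 ∨ bas 0 u = 0)

/-- The space of functions with the eigenvalues `± N` and `± (N + 2)`. -/
def Gd (N : ℕ) : Submodule ℝ QPol := Submodule.span ℝ {u | ∃ t, Gen N t u}

theorem gd_ext {N : ℕ} {f g : QPol →ₗ[ℝ] HH} (h : ∀ t u, Gen N t u → f u = g u) {u : QPol}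
    (hu : u ∈ Gd N) : f u = g u := by
  induction hu using Submodule.span_induction with
  | mem x hx => exact h _ _ hx.choose_spec
  | zero => rw [map_zero, map_zero]
  | add x y _ _ hx hy => rw [map_add, map_add, hx, hy]
  | smul a x _ hx => rw [LinearMap.map_smul, LinearMap.map_smul, hx]

theorem gen_of_eig {N : ℕ} {t : ℤ} {u : QPol} (ht : t.natAbs = N ∨ t.natAbs = N + 2)
    (hu : u ∈ QPol.eig t) : Gen N t u := by
  refine ⟨ht, (QPol.mem_eig.1 hu).2, bas_mem_VV hu 0, ?_⟩
  by_cases h : t = 0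
  · subst h
    rw [QPol.eig_zero, Submodule.mem_bot] at hu
    right
    rw [hu, map_zero]
  · exact Or.inl h

theorem gen_rsq {N : ℕ} {t : ℤ} {u : QPol} (h : Gen N t u) : Gen N t (QPol.rsq • u) := by
  refine ⟨h.1, ?_, ?_⟩
  · rw [QPol.dir_rsq_smul, h.2.1, smul_comm]
  · rw [bas_rsq]
    exact h.2.2

theorem X_smul_mem_gd {N : ℕ} {h : QPol} (hh : h ∈ QPol.harm N) (a : Fin 4) :
    (MvPolynomial.X a : Pol) • h ∈ Gd N := by
  obtain ⟨y₁, h1, y₂, h2, y₃, h3, y₄, h4, e⟩ := QPol.exists_eig_X_smul hh a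
  rw [e, smul_add]
  have m1 : y₁ ∈ Gd N := Submodule.subset_span ⟨_, gen_of_eig (Or.inr (by omega)) h1⟩
  have m2 : y₂ ∈ Gd N := Submodule.subset_span ⟨_, gen_of_eig (Or.inr (by omega)) h2⟩
  have m3 : QPol.rsq • y₃ ∈ Gd N :=
    Submodule.subset_span ⟨_, gen_rsq (gen_of_eig (Or.inl (by omega)) h3)⟩
  have m4 : QPol.rsq • y₄ ∈ Gd N :=
    Submodule.subset_span ⟨_, gen_rsq (gen_of_eig (Or.inl (by omega)) h4)⟩
  exact add_mem (add_mem m1 m2) (add_mem m3 m4)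

theorem mul_xq_mem_gd {N : ℕ} {h : QPol} (hh : h ∈ QPol.harm N) : h * QPol.xq ∈ Gd N := by
  rw [QPol.mul_xq]
  exact add_mem (add_mem (add_mem (X_smul_mem_gd (QPol.mul_cst_mem_harm hh _) _)
    (X_smul_mem_gd (QPol.mul_cst_mem_harm hh _) _)) (X_smul_mem_gd (QPol.mul_cst_mem_harm hh _) _))
    (X_smul_mem_gd (QPol.mul_cst_mem_harm hh _) _)

/-- The phase of the Dirac operator of the three-sphere. -/
abbrev sg : HH →L[ℝ] HH := ph (hf 0) 0

theorem sy_hf_zero (t : ℤ) : sy (hf 0) 0 (t, 0) = |(t : ℝ)|⁻¹ * t := by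
  have h : ‖lv (hf 0) (t, 0)‖ = |(t : ℝ)| := by
    rw [← abs_norm, ← sq_eq_sq_iff_abs_eq_abs, norm_lv_sq]
    simp [hf]
  rw [sy_eq, h]
  rfl

theorem sg_gen {N : ℕ} {t : ℤ} {u : QPol} (h : Gen N t u) : 
    sg (bas 0 u) = (|(t : ℝ)|⁻¹ * t) • bas 0 u := by
  rw [← sy_hf_zero]
  exact ph_apply _ _ h.2.2.1

theorem sg_gd {N : ℕ} {a b : ℝ} (h : ∀ t : ℤ, t ≠ 0 → (t.natAbs = N ∨ t.natAbs = N + 2) →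
    a * t + b * (t * (t * t)) = |(t : ℝ)|⁻¹ * t) {g : QPol} (hg : g ∈ Gd N) :
    sg (bas 0 g) = bas 0 (a • QPol.dir g + b • QPol.dir (QPol.dir (QPol.dir g))) := by
  have := gd_ext (f := sg.toLinearMap ∘ₗ bas 0)
    (g := bas 0 ∘ₗ (a • QPol.dir + b • (QPol.dir ∘ₗ QPol.dir ∘ₗ QPol.dir))) (fun t u hu => ?_) hg
  · exact this
  change sg (bas 0 u) = bas 0 (a • QPol.dir u + b • QPol.dir (QPol.dir (QPol.dir u)))
  rw [sg_gen hu, hu.2.1, LinearMap.map_smul, hu.2.1, LinearMap.map_smul, LinearMap.map_smul,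
    hu.2.1, smul_smul, smul_smul, smul_smul, smul_smul, map_add, LinearMap.map_smul, LinearMap.map_smul,
    ← add_smul]
  rcases hu.2.2.2 with h0 | h0
  · rw [← h t h0 hu.1]
    ring_nf
  · rw [h0, smul_zero, smul_zero]

theorem exists_interpolation (N : ℕ) : ∃ a b : ℝ, ∀ t : ℤ, t ≠ 0 →
    (t.natAbs = N ∨ t.natAbs = N + 2) → a * t + b * (t * (t * t)) = |(t : ℝ)|⁻¹ * t := by
  have red : ∃ a b : ℝ, ∀ n : ℕ, n ≠ 0 → (n = N ∨ n = N + 2) → a + b * (n * n) = (n : ℝ)⁻¹ := by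
    rcases eq_or_ne N 0 with rfl | hN
    · refine ⟨2⁻¹, 0, fun n h0 hn => ?_⟩
      have : n = 2 := by omega
      subst this
      norm_num
    · have hN' : (N : ℝ) ≠ 0 := by exact_mod_cast hN
      have hN2 : (N : ℝ) + 2 ≠ 0 := by positivity
      have hN1 : (N : ℝ) + 1 ≠ 0 := by positivity
      refine ⟨(N : ℝ)⁻¹ + (2 * N * (N + 2) * (N + 1) : ℝ)⁻¹ * (N * N), -(2 * N * (N + 2) * (N + 1) : ℝ)⁻¹,
        fun n h0 hn => ?_⟩
      rcases hn with rfl | rfl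
      · ring
      · push_cast
        field_simp
        ring
  obtain ⟨a, b, h⟩ := red
  refine ⟨a, b, fun t h0 ht => ?_⟩
  have := h t.natAbs (by omega) ht
  have e : ((t.natAbs : ℕ) : ℝ) = |(t : ℝ)| := by rw [Nat.cast_natAbs, Int.cast_abs]
  rw [e, abs_mul_abs_self] at this
  rw [← this]
  ring

theorem sg_sg_gd {N : ℕ} {g : QPol} (hg : g ∈ Gd N) : sg (sg (bas 0 g)) = bas 0 g := by
  refine gd_ext (f := sg.toLinearMap ∘ₗ sg.toLinearMap ∘ₗ bas 0) (g := bas 0) (fun t u hu => ?_) hg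
  change sg (sg (bas 0 u)) = bas 0 u
  rw [sg_gen hu, map_smul, sg_gen hu, smul_smul]
  rcases hu.2.2.2 with h0 | h0
  · have : |(t : ℝ)| ≠ 0 := abs_ne_zero.2 (by exact_mod_cast h0)
    have e : |(t : ℝ)|⁻¹ * t * (|(t : ℝ)|⁻¹ * t) = 1 := by
      field_simp
      rw [sq_abs]
    rw [e, one_smul]
  · rw [h0, smul_zero]

/-- The spectral gap constant. -/
def gap (N : ℕ) : ℕ := if N = 0 then 2 else N

theorem gap_le_inner {N : ℕ} {g : QPol} (hg : g ∈ Gd N) :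
    gap N * ‖bas 0 g‖ ^ 2 ≤ ⟪sg (bas 0 (QPol.dir g)), bas 0 g⟫ := by
  let δ : Lab → ℝ := fun l => max 0 (min 1 ((|(l.1 : ℝ)| - gap N) / (N + 2)))
  have d0 : ∀ l, 0 ≤ δ l := fun l => le_max_left _ _
  have d1 : ∀ l, δ l ≤ 1 := fun l => max_le zero_le_one (min_le_left _ _)
  have key : sg (bas 0 (QPol.dir g)) = (gap N : ℝ) • bas 0 g + (N + 2 : ℝ) • dec.diag δ (bas 0 g) := by
    refine gd_ext (f := sg.toLinearMap ∘ₗ bas 0 ∘ₗ QPol.dir)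
      (g := (gap N : ℝ) • bas 0 + (N + 2 : ℝ) • ((dec.diag δ).toLinearMap ∘ₗ bas 0))
      (fun t u hu => ?_) hg
    change sg (bas 0 (QPol.dir u)) = (gap N : ℝ) • bas 0 u + (N + 2 : ℝ) • dec.diag δ (bas 0 u)
    rw [hu.2.1, LinearMap.map_smul, map_smul, sg_gen hu, smul_smul,
      dec.diag_apply ⟨1, fun l => by rw [abs_of_nonneg (d0 l)]; exact d1 l⟩ hu.2.2.1, smul_smul, ← add_smul]
    rcases hu.2.2.2 with h0 | h0
    · congr 1
      have e : |(t : ℝ)| = t.natAbs := by rw [Nat.cast_natAbs, Int.cast_abs]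
      have hl : gap N ≤ t.natAbs := by
        unfold gap
        split_ifs <;> rcases hu.1 with h | h <;> omega
      have hl' : (gap N : ℝ) ≤ |(t : ℝ)| := by rw [e]; exact_mod_cast hl
      have hu' : |(t : ℝ)| ≤ N + 2 := by
        rw [e]
        have : t.natAbs ≤ N + 2 := by rcases hu.1 with h | h <;> omega
        exact_mod_cast this
      have hp : (0 : ℝ) < N + 2 := by positivity
      have : δ (t, 0) = (|(t : ℝ)| - gap N) / (N + 2) := by
        change max 0 (min 1 ((|(t : ℝ)| - gap N) / (N + 2))) = _
        rw [min_eq_right, max_eq_right]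
        · exact div_nonneg (by linarith) hp.le
        · rw [div_le_one hp]
          have : (0 : ℝ) ≤ gap N := Nat.cast_nonneg _
          linarith
      rw [this, mul_div_cancel₀ _ hp.ne', add_sub_cancel]
      have h1 : |(t : ℝ)| ≠ 0 := abs_ne_zero.2 (by exact_mod_cast h0)
      field_simp
      rw [sq_abs]
    · rw [h0, smul_zero, smul_zero]
  have h2 := dec.inner_diag_self_nonneg d0 d1 (bas 0 g)
  rw [key, inner_add_left, real_inner_smul_left, real_inner_smul_left, real_inner_self_eq_norm_sq]
  have : 0 ≤ (N + 2 : ℝ) * ⟪dec.diag δ (bas 0 g), bas 0 g⟫ := by positivity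
  linarith

end TTS

end Zero

section ZeroKernel

open MeasureTheory Quaternion Filter Topology

namespace TTS

theorem qm_zero : qm 0 = lastQ QPol.xq := by
  ext1 x
  rw [qm_apply]
  refine Eq.trans ?_ (evQ_xq (v := (x.2.2 : Quaternion ℝ))).symm
  refine QuaternionAlgebra.ext ?_ ?_ ?_ ?_ <;> simp

theorem opR_qM_zero_bas (h : QPol) : opR (qM 0 : C(TTS, Quaternion ℝ)) (bas 0 h) =
    bas 0 (h * QPol.xq) := by
  change opR (qm 0) _ = _
  rw [qm_zero, bas_apply, bas_apply, opR_toH, chr_zero, mul_one, mul_one, lastQ_mul]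

theorem sg_eig {N : ℕ} {u : QPol} (hu : u ∈ QPol.eig (N + 1)) : sg (bas 0 u) = bas 0 u := by
  have h := sg_gen (gen_of_eig (N := N + 1) (Or.inl (by omega)) hu)
  rw [h]
  have : (0 : ℝ) < ((N + 1 : ℤ) : ℝ) := by push_cast; positivity
  rw [abs_of_pos this, inv_mul_cancel₀ this.ne', one_smul]

theorem sg_eig_neg {N : ℕ} {u : QPol} (hu : u ∈ QPol.eig (-(N + 1))) :
    sg (bas 0 u) = -bas 0 u := by
  have h := sg_gen (gen_of_eig (N := N + 1) (Or.inl (by omega)) hu)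
  rw [h]
  have : ((-(N + 1 : ℤ) : ℤ) : ℝ) < 0 := by push_cast; linarith [N.cast_nonneg (α := ℝ)]
  rw [abs_of_neg this, inv_neg, neg_mul, inv_mul_cancel₀ this.ne, neg_smul, one_smul]

theorem sg_sg_bas {N : ℕ} {h : QPol} (hh : h ∈ QPol.harm N) : sg (sg (bas 0 h)) = bas 0 h := by
  obtain ⟨u, hu, w, hw, rfl⟩ := QPol.exists_eig_add hh
  rw [map_add, map_add, sg_eig hu, sg_eig_neg hw, map_add, map_neg, sg_eig hu, sg_eig_neg hw, neg_neg]

theorem exists_sg_bas {N : ℕ} {h : QPol} (hh : h ∈ QPol.harm N) :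
    ∃ g ∈ QPol.harm N, sg (bas 0 h) = bas 0 g := by
  obtain ⟨u, hu, w, hw, rfl⟩ := QPol.exists_eig_add hh
  refine ⟨u - w, ?_, ?_⟩
  · have h1 := (QPol.mem_eig.1 hu).1
    have h2 := (QPol.mem_eig.1 hw).1
    rw [show ((N + 1 : ℤ)).natAbs - 1 = N by omega] at h1
    rw [show (-(N + 1 : ℤ)).natAbs - 1 = N by omega] at h2
    exact sub_mem h1 h2
  · rw [map_add, map_add, sg_eig hu, sg_eig_neg hw, map_sub, sub_eq_add_neg]

/-- The conjugated phase. -/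
abbrev sgc : HH →L[ℝ] HH := qcj (qM 0) sg

theorem exists_sgc_bas {N : ℕ} {h : QPol} (hh : h ∈ QPol.harm N) :
    ∃ g ∈ QPol.harm N, sgc (bas 0 h) = bas 0 g := by
  obtain ⟨a, b, hab⟩ := exists_interpolation N
  refine ⟨a • QPol.dd h + b • QPol.dd (QPol.dd (QPol.dd h)), add_mem (Submodule.smul_mem _ _
    (QPol.dd_mem_harm hh)) (Submodule.smul_mem _ _ (QPol.dd_mem_harm (QPol.dd_mem_harm
    (QPol.dd_mem_harm hh)))), ?_⟩
  have e : ∀ (c : ℝ) (f : QPol), c • (f * QPol.xq) = (c • f) * QPol.xq := fun c f => by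
    refine QuaternionAlgebra.ext ?_ ?_ ?_ ?_ <;> simp [smul_sub, smul_add]
  rw [qcj_apply, opR_qM_zero_bas, sg_gd hab (mul_xq_mem_gd hh), QPol.dir_mul_xq', QPol.dir_mul_xq',
    QPol.dir_mul_xq', e, e, ← add_mul, ← opR_qM_zero_bas, opR_star_opR]

theorem sgc_sgc_bas {N : ℕ} {h : QPol} (hh : h ∈ QPol.harm N) : sgc (sgc (bas 0 h)) = bas 0 h := by
  rw [qcj_apply, qcj_apply, opR_opR_star, opR_qM_zero_bas, sg_sg_gd (mul_xq_mem_gd hh),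
    ← opR_qM_zero_bas, opR_star_opR]

theorem av_zero_apply (x : HH) : av 0 x = sg x + sgc x := rfl

theorem exists_av_bas {N : ℕ} {h : QPol} (hh : h ∈ QPol.harm N) :
    ∃ g ∈ QPol.harm N, av 0 (bas 0 h) = bas 0 g := by
  obtain ⟨g, hg, e⟩ := exists_sg_bas hh
  obtain ⟨f, hf, e'⟩ := exists_sgc_bas hh
  exact ⟨g + f, add_mem hg hf, by rw [av_zero_apply, e, e', map_add]⟩

theorem av_sg_bas {N : ℕ} {h : QPol} (hh : h ∈ QPol.harm N) (h0 : av 0 (bas 0 h) = 0) :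
    av 0 (sg (bas 0 h)) = 0 := by
  have : sgc (av 0 (bas 0 h)) = av 0 (sg (bas 0 h)) := by
    rw [av_zero_apply, av_zero_apply, map_add, sgc_sgc_bas hh, sg_sg_bas hh, add_comm]
  rw [← this, h0, map_zero]

theorem norm_bas_star (h : QPol) : ‖bas 0 (star h)‖ = ‖bas 0 h‖ := by
  have : ‖bas 0 (star h)‖ ^ 2 = ‖bas 0 h‖ ^ 2 := by
    rw [← real_inner_self_eq_norm_sq, ← real_inner_self_eq_norm_sq, inner_bas_same, inner_bas_same]
    congr 3
    simp [QPol.pr]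
  exact (sq_eq_sq₀ (norm_nonneg _) (norm_nonneg _)).1 this

theorem inner_bas_mul_xq (h g : QPol) :
    ⟪bas 0 (h * QPol.xq), bas 0 (g * QPol.xq)⟫ = ⟪bas 0 h, bas 0 g⟫ := by
  rw [← opR_qM_zero_bas, ← opR_qM_zero_bas, inner_opR, opR_star_opR]

theorem inner_star_le (h : QPol) : |⟪bas 0 (star h), bas 0 h⟫| ≤ ‖bas 0 h‖ ^ 2 := by
  have := abs_real_inner_le_norm (bas 0 (star h)) (bas 0 h)
  rwa [norm_bas_star, ← sq] at this

theorem gap_le_of_sgc {N : ℕ} {h : QPol} (hh : h ∈ QPol.harm N) {s : ℝ}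
    (hs : sgc (bas 0 h) = s • bas 0 h) :
    gap N * ‖bas 0 h‖ ^ 2 ≤ s * ⟪bas 0 (QPol.dd h), bas 0 h⟫ := by
  have h1 : sg (bas 0 (h * QPol.xq)) = s • bas 0 (h * QPol.xq) := by
    rw [← opR_qM_zero_bas, ← map_smul, ← hs, qcj_apply, opR_opR_star]
  have h2 := gap_le_inner (mul_xq_mem_gd hh)
  rwa [inner_ph, h1, real_inner_smul_right, QPol.dir_mul_xq', inner_bas_mul_xq,
    ← real_inner_self_eq_norm_sq, inner_bas_mul_xq, real_inner_self_eq_norm_sq] at h2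

theorem bas_eq_zero_of_av_neg {N : ℕ} {w : QPol} (hw : w ∈ QPol.eig (-(N + 1)))
    (h : av 0 (bas 0 w) = 0) : bas 0 w = 0 := by
  obtain ⟨h1, h2⟩ := QPol.mem_eig.1 hw
  rw [show (-(N + 1 : ℤ)).natAbs - 1 = N by omega] at h1
  rw [av_zero_apply, sg_eig_neg hw, neg_add_eq_zero] at h
  have h3 := gap_le_of_sgc h1 (s := 1) (by rw [one_smul]; exact h.symm)
  have h4 : QPol.dd w = (-(N + 2 : ℝ)) • w - (2 : ℝ) • star w := by
    rw [QPol.dd, h2]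
    push_cast
    module
  have h5 := abs_le.1 (inner_star_le w)
  rw [h4, map_sub, LinearMap.map_smul, LinearMap.map_smul, inner_sub_left, real_inner_smul_left,
    real_inner_smul_left, real_inner_self_eq_norm_sq] at h3
  have h6 : (1 : ℝ) ≤ gap N + N := by
    unfold gap
    split_ifs with h0
    · simp [h0]
    · have : (1 : ℝ) ≤ N := by exact_mod_cast Nat.one_le_iff_ne_zero.2 h0
      linarith
  have h7 : ‖bas 0 w‖ ^ 2 ≤ 0 := by nlinarith [sq_nonneg ‖bas 0 w‖]
  exact norm_eq_zero.1 (pow_eq_zero_iff two_ne_zero |>.1 (le_antisymm h7 (sq_nonneg _)))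

theorem bas_star_eq {N : ℕ} {u : QPol} (hu : u ∈ QPol.eig (N + 1))
    (h : av 0 (bas 0 u) = 0) : bas 0 (star u) = bas 0 u ∧ (bas 0 u = 0 ∨ N ≤ 1) := by
  obtain ⟨h1, h2⟩ := QPol.mem_eig.1 hu
  rw [show ((N + 1 : ℤ)).natAbs - 1 = N by omega] at h1
  rw [av_zero_apply, sg_eig hu] at h
  have h3 := gap_le_of_sgc h1 (s := -1) (by rw [neg_one_smul]; exact eq_neg_of_add_eq_zero_right h)
  have h4 : QPol.dd u = (N : ℝ) • u - (2 : ℝ) • star u := by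
    rw [QPol.dd, h2]
    push_cast
    module
  have h5 := abs_le.1 (inner_star_le u)
  rw [h4, map_sub, LinearMap.map_smul, LinearMap.map_smul, inner_sub_left, real_inner_smul_left,
    real_inner_smul_left, real_inner_self_eq_norm_sq] at h3
  have h6 : (2 : ℝ) ≤ gap N + N := by
    have : 2 ≤ gap N + N := by unfold gap; split_ifs <;> omega
    exact_mod_cast this
  constructor
  · have h7 : ‖bas 0 (star u) - bas 0 u‖ ^ 2 ≤ 0 := by
      rw [norm_sub_sq_real, norm_bas_star]
      nlinarith [sq_nonneg ‖bas 0 u‖]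
    exact sub_eq_zero.1 (norm_eq_zero.1
      (pow_eq_zero_iff two_ne_zero |>.1 (le_antisymm h7 (sq_nonneg _))))
  · by_cases hN : N ≤ 1
    · exact Or.inr hN
    left
    have h6 : (3 : ℝ) ≤ gap N + N := by
      have : 3 ≤ gap N + N := by unfold gap; split_ifs <;> omega
      exact_mod_cast this
    have h7 : ‖bas 0 u‖ ^ 2 ≤ 0 := by nlinarith [sq_nonneg ‖bas 0 u‖]
    exact norm_eq_zero.1 (pow_eq_zero_iff two_ne_zero |>.1 (le_antisymm h7 (sq_nonneg _)))

theorem exists_bas_eq_smul_of_av {N : ℕ} {u : QPol} (hu : u ∈ QPol.eig (N + 1))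
    (h : av 0 (bas 0 u) = 0) : ∃ c : ℝ, bas 0 u = c • bas 0 1 := by
  obtain ⟨hs, h0 | hN⟩ := bas_star_eq hu h
  · exact ⟨0, by rw [h0, zero_smul]⟩
  obtain ⟨h1, h2⟩ := QPol.mem_eig.1 hu
  rw [show ((N + 1 : ℤ)).natAbs - 1 = N by omega] at h1
  have hv : bas 0 (u + star u) = (2 : ℝ) • bas 0 u := by rw [map_add, hs, two_smul]
  obtain rfl | rfl : N = 0 ∨ N = 1 := by omega
  · obtain ⟨r, hr⟩ : ∃ r, u.re = MvPolynomial.C r := by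
      have h3 := (QPol.mem_harmP.1 h1.1).1
      exact ⟨_, MvPolynomial.totalDegree_eq_zero_iff_eq_C.1 (Nat.le_zero.1 h3.totalDegree_le)⟩
    refine ⟨r, ?_⟩
    have h4 : u + star u = (2 * r) • (1 : QPol) := by
      refine QuaternionAlgebra.ext ?_ ?_ ?_ ?_ <;> simp [hr, MvPolynomial.smul_eq_C_mul]
      rw [map_ofNat, two_mul]
    rw [h4, LinearMap.map_smul, mul_smul] at hv
    exact (smul_right_injective HH (two_ne_zero (α := ℝ)) hv).symm
  · have h3 : bas 0 (QPol.dir (star u)) = bas 0 (QPol.dir u) := by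
      have h4 : ∀ g, ⟪bas 0 (QPol.dir (star u)) - bas 0 (QPol.dir u), bas 0 g⟫ = 0 := fun g => by
        rw [inner_sub_left, inner_bas_dir, hs, inner_bas_dir, sub_self]
      have h5 := h4 (QPol.dir (star u) - QPol.dir u)
      rw [map_sub, inner_self_eq_zero] at h5
      exact sub_eq_zero.1 h5
    have h4 : bas 0 (QPol.dir (u + star u)) = (2 : ℝ) • bas 0 (u + star u) := by
      rw [hv, map_add, map_add, h3, h2, LinearMap.map_smul]
      push_cast
      module
    have h5 : ⟪bas 0 (QPol.dir (u + star u)), bas 0 (u + star u)⟫ =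
        ⟪bas 0 (u + star u), bas 0 (u + star u)⟫ := by
      rw [inner_bas_same, inner_bas_same]
      congr 3
      simp [QPol.pr, QPol.dir_apply]
    rw [h4, real_inner_smul_left, two_mul, add_eq_left, inner_self_eq_zero, hv] at h5
    refine ⟨0, ?_⟩
    rw [zero_smul]
    exact (smul_eq_zero.1 h5).resolve_left two_ne_zero

theorem exists_bas_eq_smul {N : ℕ} {h : QPol} (hh : h ∈ QPol.harm N)
    (h0 : av 0 (bas 0 h) = 0) : ∃ c : ℝ, bas 0 h = c • bas 0 1 := by
  have h1 := av_sg_bas hh h0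
  obtain ⟨u, hu, w, hw, rfl⟩ := QPol.exists_eig_add hh
  rw [map_add] at h0
  rw [map_add, map_add, sg_eig hu, sg_eig_neg hw] at h1
  have e1 : av 0 (bas 0 u) = 0 := by
    have : (2 : ℝ) • av 0 (bas 0 u) = av 0 (bas 0 u + bas 0 w) + av 0 (bas 0 u + -bas 0 w) := by
      rw [map_add, map_add, map_neg]
      module
    rw [h0, h1, add_zero] at this
    exact (smul_eq_zero.1 this).resolve_left two_ne_zero
  have e2 : av 0 (bas 0 w) = 0 := by rwa [map_add, e1, zero_add] at h0
  obtain ⟨c, hc⟩ := exists_bas_eq_smul_of_av hu e1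
  exact ⟨c, by rw [map_add, hc, bas_eq_zero_of_av_neg hw e2, add_zero]⟩

theorem eq_zero_of_av_zero {y : HH} (hy : av 0 y = 0)
    (hk : ∀ k, k ≠ 0 → ∀ n, ∀ v ∈ VV (n, k), ⟪v, y⟫ = 0) (h1 : ⟪bas 0 1, y⟫ = 0) : y = 0 := by
  have key : ∀ N, ∀ h ∈ QPol.harm N, ⟪bas 0 h, y⟫ = 0 := by
    intro N
    let W : Submodule ℝ HH := (QPol.harm N).map (bas 0)
    have : FiniteDimensional ℝ W := inferInstance
    have hp : ∀ v ∈ W, ⟪W.starProjection y, v⟫ = ⟪y, v⟫ := fun v hv => by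
      rw [Submodule.inner_starProjection_left_eq_right, Submodule.starProjection_eq_self_iff.2 hv]
    have hmem : W.starProjection y ∈ W := Submodule.starProjection_apply_mem _ _
    obtain ⟨h, hh, e⟩ := hmem
    obtain ⟨g, hg, e'⟩ := exists_av_bas hh
    have h0 : av 0 (bas 0 h) = 0 := by
      obtain ⟨f, hf, e''⟩ := exists_av_bas hg
      rw [← inner_self_eq_zero (𝕜 := ℝ)]
      rw [inner_av]
      have : av 0 (av 0 (bas 0 h)) ∈ W := by
        rw [e', e'']
        exact Submodule.mem_map_of_mem hf
      rw [e, hp _ (by rwa [e] at this), ← e, ← inner_av, hy, inner_zero_left]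
    obtain ⟨c, hc⟩ := exists_bas_eq_smul hh h0
    have hz : W.starProjection y = 0 := by
      rw [← inner_self_eq_zero (𝕜 := ℝ), hp _ (Submodule.starProjection_apply_mem _ _), ← e, hc,
        real_inner_smul_right, real_inner_comm, h1, mul_zero]
    intro f hf
    rw [real_inner_comm, ← hp _ (Submodule.mem_map_of_mem hf), hz, inner_zero_left]
  refine dec.eq_zero_of_orthogonal ?_
  rintro ⟨n, k⟩ v hv
  by_cases h0 : k = 0
  · subst h0
    obtain ⟨h, hh, rfl⟩ := hv
    exact key _ h (QPol.mem_eig.1 hh).1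
  · exact hk k h0 n v hv

theorem one_mem_eig : (1 : QPol) ∈ QPol.eig 1 := by
  refine QPol.mem_eig.2 ⟨one_mem_harm, ?_⟩
  rw [QPol.dir_apply]
  refine QuaternionAlgebra.ext ?_ ?_ ?_ ?_ <;> simp

theorem av_bas_one : av 0 (bas 0 1) = 0 := by
  have h1 : sg (bas 0 1) = bas 0 1 := sg_eig (N := 0) (by simpa using one_mem_eig)
  have h2 : QPol.dir QPol.xq = (-2 : ℝ) • QPol.xq := by
    have := QPol.dir_mul_xq' 1
    rw [one_mul] at this
    rw [this, QPol.dd, (QPol.mem_eig.1 one_mem_eig).2]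
    refine QuaternionAlgebra.ext ?_ ?_ ?_ ?_ <;> simp [QPol.xq]
  have h3 : QPol.xq ∈ Gd 0 := by
    have := mul_xq_mem_gd one_mem_harm
    rwa [one_mul] at this
  have h4 : sg (bas 0 QPol.xq) = -bas 0 QPol.xq := by
    rw [sg_gd (a := 2⁻¹) (b := 0) (fun t h0 ht => ?_) h3, h2, map_add,
      LinearMap.map_smul, LinearMap.map_smul, LinearMap.map_smul, zero_smul, add_zero, smul_smul]
    · norm_num
    · obtain rfl | rfl : t = 2 ∨ t = -2 := by omega
      · norm_num
      · norm_num
  rw [av_zero_apply, h1, qcj_apply, opR_qM_zero_bas, one_mul, h4, map_neg]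
  have : bas 0 QPol.xq = opR (qM 0 : C(TTS, Quaternion ℝ)) (bas 0 1) := by
    rw [opR_qM_zero_bas, one_mul]
  rw [this, opR_star_opR, add_neg_cancel]

theorem bas_one_ne_zero : bas 0 1 ≠ 0 := by
  rw [bas_apply, chr_zero, mul_one]
  intro h
  have : lastQ 1 = 0 := toH_injective (by rw [h, map_zero])
  have h1 := congrArg (fun f : C(TTS, Quaternion ℝ) => (f 1).re) this
  simp [lastQ] at h1

theorem kp_bas_one {a : Fin 3} (ha : a ≠ 0) : kp 0 a (bas 0 1) = 0 := by
  rw [kp_bas 0 ha one_mem_eig]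
  have : tsy 0 a (1, 0) = 0 := by
    unfold tsy lv
    fin_cases a <;> simp [hf] at ha ⊢
  rw [this, zero_smul]

theorem nn_qM_zero : nn (qM 0) ≡ 2 [MOD 4] := by
  refine (nn_modEq (hf 0) (qM 0)).symm.trans ?_
  let S : HH →L[ℝ] HH := (ℝ ∙ bas 0 1)ᗮ.starProjection
  have hS : LinearMap.ker S.toLinearMap = ℝ ∙ bas 0 1 := by
    ext y
    rw [LinearMap.mem_ker]
    change S y = 0 ↔ _
    rw [Submodule.starProjection_apply_eq_zero_iff, Submodule.orthogonal_orthogonal]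
  have hfin : FiniteDimensional ℝ (LinearMap.ker S.toLinearMap) := by
    rw [hS]
    infer_instance
  have key : LinearMap.ker (ker_op 0).toLinearMap = LinearMap.ker (blk S 0 0 S).toLinearMap := by
    ext z
    obtain ⟨⟨x, y⟩, rfl⟩ : ∃ w, z = WithLp.toLp 2 w := ⟨z.ofLp, rfl⟩
    rw [LinearMap.mem_ker, LinearMap.mem_ker]
    change ker_op 0 _ = 0 ↔ blk S 0 0 S _ = 0
    have e : blk S 0 0 S (WithLp.toLp 2 (x, y)) = 0 ↔ x ∈ ℝ ∙ bas 0 1 ∧ y ∈ ℝ ∙ bas 0 1 := by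
      rw [blk_apply, ← hS, LinearMap.mem_ker, LinearMap.mem_ker]
      simp
    rw [e]
    constructor
    · intro h
      have main : ∀ y, ((∀ k, wsq 0 k ≠ 0 → ∀ n, ∀ v ∈ VV (n, k), ⟪v, y⟫ = 0) ∧ av 0 y = 0) →
          y ∈ ℝ ∙ bas 0 1 := by
        rintro y ⟨h1, h2⟩
        have hmem := (ℝ ∙ bas 0 1).starProjection_apply_mem y
        obtain ⟨c, hc⟩ := Submodule.mem_span_singleton.1 hmem
        have h3 : y - c • bas 0 1 = 0 := by
          refine eq_zero_of_av_zero ?_ ?_ ?_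
          · rw [map_sub, h2, map_smul, av_bas_one, smul_zero, sub_zero]
          · intro k hk n v hv
            have hw : wsq 0 k ≠ 0 := fun h0 => hk <| by
              unfold wsq hf at h0
              simp only [Prod.fst_zero, Prod.snd_zero, Int.cast_zero, zero_div, add_zero] at h0
              have a1 : (k.1 : ℝ) = 0 := by nlinarith [sq_nonneg (k.1 : ℝ), sq_nonneg (k.2 : ℝ)]
              have a2 : (k.2 : ℝ) = 0 := by nlinarith [sq_nonneg (k.1 : ℝ), sq_nonneg (k.2 : ℝ)]
              exact Prod.ext (by exact_mod_cast a1) (by exact_mod_cast a2)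
            rw [inner_sub_right, h1 k hw n v hv, real_inner_smul_right]
            obtain ⟨h, -, rfl⟩ := hv
            rw [inner_bas_ne hk, mul_zero, sub_zero]
          · rw [hc]
            have := Submodule.sub_starProjection_mem_orthogonal (K := ℝ ∙ bas 0 1) y
            exact this _ (Submodule.mem_span_singleton_self _)
        rw [sub_eq_zero.1 h3]
        exact Submodule.smul_mem _ _ (Submodule.mem_span_singleton_self _)
      obtain ⟨h1, h2⟩ := of_ker_op_eq_zero 0 h
      exact ⟨main x h1, main y h2⟩
    · rintro ⟨hx, hy⟩
      have hk : ∀ a : Fin 3, a ≠ 0 → ∀ y ∈ ℝ ∙ bas 0 1,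
          kp 0 a ((bp 0 + qcj (qM 0) (bp 0)) y) = 0 := by
        intro a ha y hy
        obtain ⟨c, rfl⟩ := Submodule.mem_span_singleton.1 hy
        have hc : Cen (kp 0 a) (qM 0) := cen_kp_qm 0 ha
        rw [add_apply, map_add, kp_bp 0 ha, hc.qcj_comm (kp_bp 0 ha), map_smul, kp_bas_one ha,
          smul_zero, map_zero, map_zero, add_zero]
      have ha : ∀ y ∈ ℝ ∙ bas 0 1, av 0 y = 0 := by
        intro y hy
        obtain ⟨c, rfl⟩ := Submodule.mem_span_singleton.1 hy
        rw [map_smul, av_bas_one, smul_zero]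
      rw [ker_op_apply, hk 1 (by decide) x hx, hk 1 (by decide) y hy, hk 2 (by decide) x hx,
        hk 2 (by decide) y hy, ha x hx, ha y hy]
      simp
  change Module.finrank ℝ (LinearMap.ker (ker_op 0).toLinearMap) ≡ 2 [MOD 4]
  rw [key, finrank_ker_blk]
  have : Module.finrank ℝ (LinearMap.ker S.toLinearMap) = 1 :=
    (LinearEquiv.finrank_eq (LinearEquiv.ofEq _ _ hS)).trans (finrank_span_singleton bas_one_ne_zero)
  rw [this]

end TTS

end ZeroKernel

section Invariant

open Quaternion Topology

namespace TTS

/-- The rotation of the second complex coordinate of a quaternion. -/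
def rot (w : ℂ) (x : Quaternion ℝ) : Quaternion ℝ :=
  hq x.re x.imI (x.imJ * w.re - x.imK * w.im) (x.imJ * w.im + x.imK * w.re)

theorem rot_mul {w : ℂ} (hw : w.re * w.re + w.im * w.im = 1) (x y : Quaternion ℝ) :
    rot w (x * y) = rot w x * rot w y := by
  refine QuaternionAlgebra.ext ?_ ?_ ?_ ?_ <;> simp [rot]
  · linear_combination (x.imJ * y.imJ + x.imK * y.imK) * hw
  · linear_combination -(x.imJ * y.imK - x.imK * y.imJ) * hw
  · ring
  · ring

theorem rot_star (w : ℂ) (x : Quaternion ℝ) : rot w (star x) = star (rot w x) := by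
  refine QuaternionAlgebra.ext ?_ ?_ ?_ ?_ <;> simp [rot] <;> ring

theorem rot_rot (w z : ℂ) (x : Quaternion ℝ) : rot w (rot z x) = rot (w * z) x := by
  refine QuaternionAlgebra.ext ?_ ?_ ?_ ?_ <;> simp [rot] <;> ring

theorem rot_one (w : ℂ) : rot w 1 = 1 := by
  refine QuaternionAlgebra.ext ?_ ?_ ?_ ?_ <;> simp [rot]

theorem one_rot (x : Quaternion ℝ) : rot 1 x = x := by
  refine QuaternionAlgebra.ext ?_ ?_ ?_ ?_ <;> simp [rot]

theorem normSq_rot {w : ℂ} (hw : w.re * w.re + w.im * w.im = 1) (x : Quaternion ℝ) :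
    normSq (rot w x) = normSq x := by
  simp only [normSq_def', rot, hq_re, hq_imI, hq_imJ, hq_imK]
  linear_combination (x.imJ ^ 2 + x.imK ^ 2) * hw

/-- The commutator map of the rotation action. -/
def com (w : ℂ) (x : Quaternion ℝ) : Quaternion ℝ := rot w x * star x

theorem com_one (w : ℂ) : com w 1 = 1 := by rw [com, rot_one, star_one, mul_one]

theorem one_com {x : Quaternion ℝ} (hx : normSq x = 1) : com 1 x = 1 := by
  rw [com, one_rot, Quaternion.self_mul_star, hx, coe_one]

theorem normSq_com {w : ℂ} (hw : w.re * w.re + w.im * w.im = 1) {x : Quaternion ℝ}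
    (hx : normSq x = 1) : normSq (com w x) = 1 := by
  rw [com, map_mul, normSq_rot hw, normSq_star, hx, mul_one]

theorem com_com {w z : ℂ} (hw : w.re * w.re + w.im * w.im = 1) (x : Quaternion ℝ) :
    com w (com z x) = rot (w * z) x * star (rot w x) * x * star (rot z x) := by
  simp only [com, rot_mul hw, rot_rot, rot_star, star_mul, star_star, mul_assoc]

theorem continuous_com {Y : Type*} [TopologicalSpace Y] {f : Y → ℂ} {g : Y → Quaternion ℝ}
    (hf : Continuous f) (hg : Continuous g) : Continuous fun y => com (f y) (g y) := by
  have h0 := Quaternion.continuous_re.comp hg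
  have h1 := Quaternion.continuous_imI.comp hg
  have h2 := Quaternion.continuous_imJ.comp hg
  have h3 := Quaternion.continuous_imK.comp hg
  have h4 := Complex.continuous_re.comp hf
  have h5 := Complex.continuous_im.comp hf
  have h6 : Continuous fun y => rot (f y) (g y) :=
    continuous_quaternion h0 h1 ((h2.mul h4).sub (h3.mul h5)) ((h2.mul h5).add (h3.mul h4))
  exact h6.mul (continuous_star.comp hg)

theorem circle_sq (z : Circle) : (z : ℂ).re * (z : ℂ).re + (z : ℂ).im * (z : ℂ).im = 1 := by
  have := Circle.normSq_coe z
  rwa [Complex.normSq_apply] at this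

theorem normSq_sphere (x : S3) : normSq (x : Quaternion ℝ) = 1 := by
  rw [normSq_eq_norm_mul_self, norm_eq_of_mem_sphere, mul_one]

theorem mem_S3 {x : Quaternion ℝ} (h : normSq x = 1) : x ∈ S3 := by
  rw [mem_sphere_zero_iff_norm]
  rw [normSq_eq_norm_mul_self] at h
  nlinarith [norm_nonneg x]

/-- The iterated commutator map on `S¹ × S¹ × S³`. -/
def vv : C(TTS, S3) :=
  ⟨fun x => ⟨com (x.1 : ℂ) (com (x.2.1 : ℂ) (x.2.2 : Quaternion ℝ)),
    mem_S3 (normSq_com (circle_sq _) (normSq_com (circle_sq _) (normSq_sphere _)))⟩, by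
    refine Continuous.subtype_mk ?_ _
    have h1 : Continuous fun x : TTS => (x.1 : ℂ) := continuous_circle_coe.comp continuous_fst
    have h2 : Continuous fun x : TTS => (x.2.1 : ℂ) :=
      continuous_circle_coe.comp (continuous_fst.comp continuous_snd)
    have h3 : Continuous fun x : TTS => (x.2.2 : Quaternion ℝ) :=
      continuous_subtype_val.comp (continuous_snd.comp continuous_snd)
    exact continuous_com h1 (continuous_com h2 h3)⟩

/-- A map to the sphere as a unitary. -/
def toU (f : C(TTS, S3)) : UU :=
  ⟨⟨fun x => (f x : Quaternion ℝ), continuous_subtype_val.comp f.continuous⟩,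
    mem_unitary_of_normSq fun x => normSq_sphere (f x)⟩

theorem continuous_toU : Continuous toU := by
  refine Continuous.subtype_mk ?_ _
  exact (ContinuousMap.continuous_postcomp (⟨Subtype.val, continuous_subtype_val⟩ :
    C(S3, Quaternion ℝ)))

theorem qm_eq_rot (m : ℤ × ℤ) (x : TTS) :
    qm m x = rot ((x.1 ^ m.1 * x.2.1 ^ m.2 : Circle) : ℂ) x.2.2 := qm_apply m x

theorem toU_vv : toU vv = qM (1, 1) * star (qM (1, 0)) * qM 0 * star (qM (0, 1)) := by
  refine Subtype.ext (ContinuousMap.ext fun x => ?_)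
  change com (x.1 : ℂ) (com (x.2.1 : ℂ) (x.2.2 : Quaternion ℝ)) =
    qm (1, 1) x * star (qm (1, 0) x) * qm 0 x * star (qm (0, 1) x)
  rw [com_com (circle_sq _)]
  simp only [qm_eq_rot]
  simp [one_rot]

theorem nn_star (q : UU) : nn q + nn (star q) ≡ 0 [MOD 4] := by
  refine (nn_mul q (star q)).symm.trans ?_
  rw [Unitary.mul_star_self]
  exact nn_one

theorem nn_vv : nn (toU vv) ≡ 2 [MOD 4] := by
  rw [toU_vv]
  have h1 := nn_mul (qM (1, 1) * star (qM (1, 0)) * qM 0) (star (qM (0, 1)))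
  have h2 := nn_mul (qM (1, 1) * star (qM (1, 0))) (qM 0)
  have h3 := nn_mul (qM (1, 1)) (star (qM (1, 0)))
  have h4 := nn_star (qM (1, 0))
  have h5 := nn_star (qM (0, 1))
  have a1 : nn (qM (1, 1)) ≡ 0 [MOD 4] := nn_qM_of_odd (Or.inl odd_one)
  have a2 : nn (qM (1, 0)) ≡ 0 [MOD 4] := nn_qM_of_odd (Or.inl odd_one)
  have a3 : nn (qM (0, 1)) ≡ 0 [MOD 4] := nn_qM_of_odd (Or.inr odd_one)
  have a4 := nn_qM_zero
  simp only [Nat.ModEq] at *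
  omega

theorem nn_eq_of_homotopic {f g : C(TTS, S3)} (h : f.Homotopic g) :
    nn (toU f) ≡ nn (toU g) [MOD 4] := by
  obtain ⟨H⟩ := h
  have := nn_eq_of_path (fun t => toU (H.curry t)) (continuous_toU.comp H.curry.continuous)
  have e0 : H.curry 0 = f := by ext1 x; exact H.apply_zero x
  have e1 : H.curry 1 = g := by ext1 x; exact H.apply_one x
  simpa only [e0, e1] using this

theorem toU_const_one (h : (1 : Quaternion ℝ) ∈ S3) :
    toU (ContinuousMap.const TTS (⟨1, h⟩ : S3)) = 1 := Subtype.ext (ContinuousMap.ext fun _ => rfl)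

instance : PathConnectedSpace S3 := by
  refine isPathConnected_iff_pathConnectedSpace.1 (isPathConnected_sphere ?_ _ zero_le_one)
  rw [Quaternion.rank_eq_four]
  norm_num

theorem not_nullhomotopic_vv : ¬ vv.Nullhomotopic := by
  rintro ⟨y, hy⟩
  have h1 : (1 : Quaternion ℝ) ∈ S3 := by simp [S3]
  have hc : (ContinuousMap.const TTS y).Homotopic (ContinuousMap.const TTS ⟨1, h1⟩) :=
    (ContinuousMap.homotopic_const_iff).2 (PathConnectedSpace.joined _ _)
  have h2 := nn_eq_of_homotopic (hy.trans hc)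
  rw [toU_const_one] at h2
  have h3 := (nn_vv.symm.trans h2).trans nn_one
  simp [Nat.ModEq] at h3

end TTS

end Invariant

section Bumps

open Quaternion Topology

namespace TTS

theorem contDiff_coord {n : WithTop ℕ∞} (i : Fin 4) :
    ContDiff ℝ n fun q : Quaternion ℝ => linearIsometryEquivTuple q i :=
  contDiff_euclidean.1 linearIsometryEquivTuple.contDiff i

section Smooth

variable {V : Type*} [NormedAddCommGroup V] [NormedSpace ℝ V] {n : WithTop ℕ∞} {v : V}

theorem contDiffAt_hq {a b c d : V → ℝ} (ha : ContDiffAt ℝ n a v) (hb : ContDiffAt ℝ n b v)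
    (hc : ContDiffAt ℝ n c v) (hd : ContDiffAt ℝ n d v) :
    ContDiffAt ℝ n (fun x => hq (a x) (b x) (c x) (d x)) v := by
  have : (fun x => hq (a x) (b x) (c x) (d x)) = fun x => linearIsometryEquivTuple.symm
      (!₂[a x, b x, c x, d x] : EuclideanSpace ℝ (Fin 4)) := by
    funext x
    rw [LinearIsometryEquiv.eq_symm_apply]
    ext i; fin_cases i <;> rfl
  rw [this]
  refine linearIsometryEquivTuple.symm.contDiff.contDiffAt.comp v (contDiffAt_euclidean.2 fun i => ?_)
  fin_cases i <;> simpa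

theorem contDiffAt_com {f : V → ℂ} {g : V → Quaternion ℝ} (hf : ContDiffAt ℝ n f v)
    (hg : ContDiffAt ℝ n g v) : ContDiffAt ℝ n (fun x => com (f x) (g x)) v := by
  have h0 : ContDiffAt ℝ n (fun x => (g x).re) v := (contDiff_coord 0).contDiffAt.comp v hg
  have h1 : ContDiffAt ℝ n (fun x => (g x).imI) v := (contDiff_coord 1).contDiffAt.comp v hg
  have h2 : ContDiffAt ℝ n (fun x => (g x).imJ) v := (contDiff_coord 2).contDiffAt.comp v hg
  have h3 : ContDiffAt ℝ n (fun x => (g x).imK) v := (contDiff_coord 3).contDiffAt.comp v hg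
  have h4 : ContDiffAt ℝ n (fun x => (f x).re) v := Complex.reCLM.contDiff.contDiffAt.comp v hf
  have h5 : ContDiffAt ℝ n (fun x => (f x).im) v := Complex.imCLM.contDiff.contDiffAt.comp v hf
  have h6 : ContDiffAt ℝ n (fun x => rot (f x) (g x)) v :=
    contDiffAt_hq h0 h1 ((h2.mul h4).sub (h3.mul h5)) ((h2.mul h5).add (h3.mul h4))
  have h7 : ContDiffAt ℝ n (fun x => star (g x)) v := by
    have : (fun x => star (g x)) = fun x => hq (g x).re (-(g x).imI) (-(g x).imJ) (-(g x).imK) := by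
      funext x
      refine QuaternionAlgebra.ext ?_ ?_ ?_ ?_ <;> simp
    rw [this]
    exact contDiffAt_hq h0 h1.neg h2.neg h3.neg
  exact h6.mul h7

end Smooth

/-- A cut-off, positive exactly below `1`. -/
def bq (q : ℝ) : ℝ := Real.smoothTransition (1 - q)

theorem bq_of_one_le {q : ℝ} (h : 1 ≤ q) : bq q = 0 :=
  Real.smoothTransition.zero_of_nonpos (by linarith)

theorem bq_pos {q : ℝ} (h : q < 1) : 0 < bq q := Real.smoothTransition.pos_of_pos (by linarith)

theorem bq_zero : bq 0 = 1 := Real.smoothTransition.one_of_one_le (by norm_num)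

theorem bden_pos {q : ℝ} (h : 0 ≤ q) : 0 < q + bq q ^ 2 := by
  rcases lt_or_ge q 1 with h1 | h1
  · have := bq_pos h1
    positivity
  · have := sq_nonneg (bq q)
    linarith

/-- The real part of the collapse of a disc to a sphere. -/
def colA (q : ℝ) : ℝ := (q - bq q ^ 2) / (q + bq q ^ 2)

/-- The coefficient of the imaginary part of the collapse of a disc to a sphere. -/
def colB (q : ℝ) : ℝ := 2 * bq q / (q + bq q ^ 2)

theorem colA_colB {q : ℝ} (h : 0 ≤ q) : colA q ^ 2 + q * colB q ^ 2 = 1 := by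
  have := (bden_pos h).ne'
  rw [colA, colB]
  field_simp
  ring

theorem colA_of_one_le {q : ℝ} (h : 1 ≤ q) : colA q = 1 := by
  rw [colA, bq_of_one_le h, zero_pow two_ne_zero, sub_zero, add_zero, div_self (by linarith)]

theorem colB_of_one_le {q : ℝ} (h : 1 ≤ q) : colB q = 0 := by
  rw [colB, bq_of_one_le h, mul_zero, zero_div]

theorem colB_pos {q : ℝ} (h0 : 0 ≤ q) (h : q < 1) : 0 < colB q :=
  div_pos (mul_pos two_pos (bq_pos h)) (bden_pos h0)

theorem colA_zero : colA 0 = -1 := by rw [colA, bq_zero]; norm_num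

section Smooth

variable {V : Type*} [NormedAddCommGroup V] [NormedSpace ℝ V] {n : ℕ∞} {v : V} {f : V → ℝ}

theorem contDiffAt_bq (hf : ContDiffAt ℝ n f v) : ContDiffAt ℝ n (fun x => bq (f x)) v :=
  Real.smoothTransition.contDiff.contDiffAt.comp v (contDiffAt_const.sub hf)

theorem contDiffAt_colA (hf : ContDiffAt ℝ n f v) (h : 0 ≤ f v) :
    ContDiffAt ℝ n (fun x => colA (f x)) v :=
  (hf.sub ((contDiffAt_bq hf).pow 2)).div (hf.add ((contDiffAt_bq hf).pow 2)) (bden_pos h).ne'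

theorem contDiffAt_colB (hf : ContDiffAt ℝ n f v) (h : 0 ≤ f v) :
    ContDiffAt ℝ n (fun x => colB (f x)) v :=
  (contDiffAt_const.mul (contDiffAt_bq hf)).div (hf.add ((contDiffAt_bq hf).pow 2)) (bden_pos h).ne'

end Smooth

/-- The collapse of the line to the circle. -/
def colE (t : ℝ) : ℂ := ⟨colA (t ^ 2), colB (t ^ 2) * t⟩

/-- The collapse of `ℝ³` to `S³`. -/
def colC (a b c : ℝ) : Quaternion ℝ :=
  hq (colA (a ^ 2 + b ^ 2 + c ^ 2)) (colB (a ^ 2 + b ^ 2 + c ^ 2) * a)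
    (colB (a ^ 2 + b ^ 2 + c ^ 2) * b) (colB (a ^ 2 + b ^ 2 + c ^ 2) * c)

theorem colE_sq (t : ℝ) : (colE t).re * (colE t).re + (colE t).im * (colE t).im = 1 := by
  have := colA_colB (sq_nonneg t)
  simp only [colE]
  linarith

theorem normSq_colC (a b c : ℝ) : normSq (colC a b c) = 1 := by
  have := colA_colB (q := a ^ 2 + b ^ 2 + c ^ 2) (by positivity)
  simp only [colC, normSq_def', hq_re, hq_imI, hq_imJ, hq_imK]
  linarith

theorem colE_of_one_le {t : ℝ} (h : 1 ≤ t ^ 2) : colE t = 1 := by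
  refine Complex.ext ?_ ?_ <;> simp [colE, colA_of_one_le h, colB_of_one_le h]

theorem colC_of_one_le {a b c : ℝ} (h : 1 ≤ a ^ 2 + b ^ 2 + c ^ 2) : colC a b c = 1 := by
  refine QuaternionAlgebra.ext ?_ ?_ ?_ ?_ <;> simp [colC, colA_of_one_le h, colB_of_one_le h]

/-- The composition of the collapses with the inner commutator. -/
def colG (a b c r : ℝ) : Quaternion ℝ := com (colE a) (colC b c r)

/-- The composition of the collapses with the iterated commutator. -/
def colF (s a b c r : ℝ) : Quaternion ℝ := com (colE s) (colG a b c r)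

theorem normSq_colG (a b c r : ℝ) : normSq (colG a b c r) = 1 :=
  normSq_com (colE_sq _) (normSq_colC _ _ _)

theorem normSq_colF (s a b c r : ℝ) : normSq (colF s a b c r) = 1 :=
  normSq_com (colE_sq _) (normSq_colG _ _ _ _)

theorem colF_ne_one {s a b c r : ℝ} (h : colF s a b c r ≠ 1) :
    |s| < 1 ∧ |a| < 1 ∧ |b| < 1 ∧ |c| < 1 ∧ |r| < 1 := by
  simp only [← sq_lt_one_iff_abs_lt_one]
  have hC : a ^ 2 < 1 ∧ b ^ 2 + c ^ 2 + r ^ 2 < 1 := by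
    constructor <;> by_contra hs <;> rw [not_lt] at hs <;> apply h
    · rw [colF, colG, colE_of_one_le hs, one_com (normSq_colC _ _ _), com_one]
    · rw [colF, colG, colC_of_one_le hs, com_one, com_one]
  refine ⟨?_, hC.1, ?_, ?_, ?_⟩
  · by_contra hs
    rw [not_lt] at hs
    exact h (by rw [colF, colE_of_one_le hs, one_com (normSq_colG _ _ _ _)])
  all_goals linarith [hC.2, sq_nonneg b, sq_nonneg c, sq_nonneg r]

section Smooth

variable {V : Type*} [NormedAddCommGroup V] [NormedSpace ℝ V] {n : ℕ∞} {v : V} {s a b c r : V → ℝ}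

theorem contDiffAt_colE (hs : ContDiffAt ℝ n s v) : ContDiffAt ℝ n (fun x => colE (s x)) v := by
  have h : (fun x => colE (s x)) = fun x => Complex.equivRealProdCLM.symm
      (colA (s x ^ 2), colB (s x ^ 2) * s x) := by
    funext x
    exact Complex.ext (by simp [colE]) (by simp [colE])
  rw [h]
  exact Complex.equivRealProdCLM.symm.contDiff.contDiffAt.comp v
    ((contDiffAt_colA (hs.pow 2) (sq_nonneg _)).prodMk
      ((contDiffAt_colB (hs.pow 2) (sq_nonneg _)).mul hs))

theorem contDiffAt_colG (ha : ContDiffAt ℝ n a v) (hb : ContDiffAt ℝ n b v)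
    (hc : ContDiffAt ℝ n c v) (hr : ContDiffAt ℝ n r v) :
    ContDiffAt ℝ n (fun x => colG (a x) (b x) (c x) (r x)) v := by
  have hq := ((hb.pow 2).add (hc.pow 2)).add (hr.pow 2)
  have h0 : 0 ≤ b v ^ 2 + c v ^ 2 + r v ^ 2 := by positivity
  have hB := contDiffAt_colB hq h0
  exact contDiffAt_com (contDiffAt_colE ha)
    (contDiffAt_hq (contDiffAt_colA hq h0) (hB.mul hb) (hB.mul hc) (hB.mul hr))

theorem contDiffAt_colF (hs : ContDiffAt ℝ n s v) (ha : ContDiffAt ℝ n a v)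
    (hb : ContDiffAt ℝ n b v) (hc : ContDiffAt ℝ n c v) (hr : ContDiffAt ℝ n r v) :
    ContDiffAt ℝ n (fun x => colF (s x) (a x) (b x) (c x) (r x)) v :=
  contDiffAt_com (contDiffAt_colE hs) (contDiffAt_colG ha hb hc hr)

end Smooth

end TTS

end Bumps

section Family

open Quaternion Topology Filter TTS

namespace Twist

/-- The three complex coordinates of a vector of `ℝ⁶`. -/
def zc (j : Fin 3) : EuclideanSpace ℝ (Fin 6) →L[ℝ] ℂ :=
  Complex.equivRealProdCLM.symm.toContinuousLinearMap ∘L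
    ((EuclideanSpace.proj (finProdFinEquiv (j, (0 : Fin 2)))).prod
      (EuclideanSpace.proj (finProdFinEquiv (j, (1 : Fin 2)))))

theorem zc_re (j : Fin 3) (x : EuclideanSpace ℝ (Fin 6)) :
    (zc j x).re = x (finProdFinEquiv (j, (0 : Fin 2))) := by simp [zc]

theorem zc_im (j : Fin 3) (x : EuclideanSpace ℝ (Fin 6)) :
    (zc j x).im = x (finProdFinEquiv (j, (1 : Fin 2))) := by simp [zc]

/-- The squared modulus of a coordinate. -/
def rc (j : Fin 3) (x : EuclideanSpace ℝ (Fin 6)) : ℝ := Complex.normSq (zc j x)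

theorem norm_sq_eq (x : EuclideanSpace ℝ (Fin 6)) : ‖x‖ ^ 2 = rc 0 x + rc 1 x + rc 2 x := by
  rw [EuclideanSpace.norm_sq_eq]
  simp only [rc, Complex.normSq_apply, zc_re, zc_im, Fin.sum_univ_six, Real.norm_eq_abs, sq_abs]
  simp only [finProdFinEquiv, Equiv.coe_fn_mk]
  norm_num
  simp only [show (⟨3, by norm_num⟩ : Fin 6) = 3 from rfl, show (⟨2, by norm_num⟩ : Fin 6) = 2 from rfl,
    show (⟨4, by norm_num⟩ : Fin 6) = 4 from rfl, show (⟨5, by norm_num⟩ : Fin 6) = 5 from rfl]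
  ring

theorem contDiff_rc {n : WithTop ℕ∞} (j : Fin 3) : ContDiff ℝ n (rc j) := by
  have h : rc j = fun x => (zc j x).re * (zc j x).re + (zc j x).im * (zc j x).im :=
    funext fun x => Complex.normSq_apply _
  rw [h]
  have h1 : ContDiff ℝ n fun x => (zc j x).re := Complex.reCLM.contDiff.comp (zc j).contDiff
  have h2 : ContDiff ℝ n fun x => (zc j x).im := Complex.imCLM.contDiff.comp (zc j).contDiff
  exact (h1.mul h1).add (h2.mul h2)

/-- Unwinding by an angle. -/
def unw (z : ℂ) (b : ℝ) : ℂ := z * Complex.exp (-(b : ℂ) * Complex.I)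

theorem unw_zero (z : ℂ) : unw z 0 = z := by simp [unw]

theorem norm_unw (z : ℂ) (b : ℝ) : ‖unw z b‖ = ‖z‖ := by
  rw [unw, norm_mul, ← Complex.ofReal_neg, Complex.norm_exp_ofReal_mul_I, mul_one]

theorem le_re_of_abs_arg {z : ℂ} (h : |z.arg| < 1) (hz : (17 / 100 : ℝ) ≤ Complex.normSq z) :
    1 / 5 ≤ z.re := by
  have h1 : 1 / 2 ≤ Real.cos z.arg := by
    have := Real.one_sub_sq_div_two_le_cos (x := z.arg)
    have h2 : z.arg ^ 2 < 1 := (sq_lt_one_iff_abs_lt_one _).2 h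
    linarith
  have h2 : 2 / 5 ≤ ‖z‖ := by
    rw [Complex.normSq_eq_norm_sq] at hz
    nlinarith [norm_nonneg z]
  rw [← Complex.norm_mul_cos_arg]
  nlinarith

section Smooth

variable {V : Type*} [NormedAddCommGroup V] [NormedSpace ℝ V] {n : WithTop ℕ∞} {v : V}

theorem contDiffAt_unw {f : V → ℂ} {b : V → ℝ} (hf : ContDiffAt ℝ n f v) (hb : ContDiffAt ℝ n b v) :
    ContDiffAt ℝ n (fun x => unw (f x) (b x)) v := by
  have h1 : ContDiffAt ℝ n (fun x => (b x : ℂ)) v := Complex.ofRealCLM.contDiff.contDiffAt.comp v hb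
  exact hf.mul ((h1.neg.mul contDiffAt_const).cexp)

theorem contDiffAt_arg {f : V → ℂ} (hf : ContDiffAt ℝ n f v) (h : 0 < (f v).re) :
    ContDiffAt ℝ n (fun x => (f x).arg) v := by
  have h1 : ContDiffAt ℝ n (fun x => Complex.log (f x)) v :=
    ((Complex.contDiffAt_log (Or.inl h)).restrict_scalars ℝ).comp v hf
  have h2 : (fun x => (f x).arg) = fun x => (Complex.log (f x)).im :=
    funext fun x => (Complex.log_im _).symm
  rw [h2]
  exact Complex.imCLM.contDiff.contDiffAt.comp v h1

end Smooth

/-- The first radial coordinate. -/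
def ph (x : EuclideanSpace ℝ (Fin 6)) : ℝ := 100 * (rc 0 x - rc 2 x)

/-- The second radial coordinate. -/
def rh (x : EuclideanSpace ℝ (Fin 6)) : ℝ := 100 * (rc 1 x - rc 2 x)

variable (N : ℝ) (p : ℝ × EuclideanSpace ℝ (Fin 6))

/-- The first twisted coordinate, with twisting parameter `p.1 * N`. -/
def w0 : ℂ := unw (zc 0 p.2) (p.1 * N * ph p.2)

/-- The first lifted angle. -/
def t0 : ℝ := (w0 N p).arg + p.1 * N * ph p.2

/-- The second twisted coordinate. -/
def w1 : ℂ := unw (zc 1 p.2) (p.1 * N * t0 N p)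

/-- The second lifted angle. -/
def t1 : ℝ := (w1 N p).arg + p.1 * N * t0 N p

/-- The third twisted coordinate. -/
def w2 : ℂ := unw (zc 2 p.2) (p.1 * N * t1 N p)

/-- The slow coordinate. -/
def sl : ℝ := ph p.2 + p.1 / N * (w0 N p).arg + p.1 / N ^ 2 * (w1 N p).arg +
  p.1 / N ^ 3 * (w2 N p).arg

/-- The right half-plane condition. -/
def grd : Prop := 0 < (w0 N p).re ∧ 0 < (w1 N p).re ∧ 0 < (w2 N p).re

/-- The value of the twisted family in the right half-planes. -/
def core : Quaternion ℝ :=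
  colF (sl N p) (w0 N p).arg (w1 N p).arg (w2 N p).arg (rh p.2)

open Classical in
/-- The twisted family. -/
def fam : Quaternion ℝ := if grd N p then core N p else 1

/-- The domain where the twisted family is well-behaved. -/
def Good (p : ℝ × EuclideanSpace ℝ (Fin 6)) : Prop := p.1 ∈ Icc (0 : ℝ) 1 ∧ 7 / 10 < ‖p.2‖ ^ 2

variable {N p}

theorem normSq_fam : normSq (fam N p) = 1 := by
  unfold fam
  split_ifs
  · exact normSq_colF _ _ _ _ _
  · simp

theorem fam_ne_one (hN : 1 ≤ N) (hp : Good p) (h : fam N p ≠ 1) :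
    grd N p ∧ core N p ≠ 1 ∧ (∀ j, 17 / 100 ≤ rc j p.2) ∧ 1 / 5 ≤ (w0 N p).re ∧
      1 / 5 ≤ (w1 N p).re ∧ 1 / 5 ≤ (w2 N p).re := by
  obtain ⟨⟨h0, h1⟩, hr⟩ := hp
  have hg : grd N p := by
    by_contra hg
    exact h (if_neg hg)
  have hc : core N p ≠ 1 := by rwa [fam, if_pos hg] at h
  obtain ⟨a1, a2, a3, a4, a5⟩ := colF_ne_one hc
  have key : ∀ (M : ℝ), 1 ≤ M → ∀ y : ℝ, |y| < 1 → |p.1 / M * y| ≤ 1 := fun M hM y hy => by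
    have : |p.1 / M| ≤ 1 := by
      rw [abs_of_nonneg (by positivity), div_le_one (by linarith)]
      linarith
    rw [abs_mul]
    exact mul_le_one₀ this (abs_nonneg _) hy.le
  have k1 := key N hN _ a2
  have k2 := key (N ^ 2) (one_le_pow₀ hN) _ a3
  have k3 := key (N ^ 3) (one_le_pow₀ hN) _ a4
  have hrc : ∀ j, 17 / 100 ≤ rc j p.2 := by
    rw [norm_sq_eq] at hr
    simp only [sl, rh, ph] at a1 a5
    rw [abs_lt] at a1 a5
    rw [abs_le] at k1 k2 k3
    intro j
    fin_cases j
    · change _ ≤ rc 0 p.2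
      linarith
    · change _ ≤ rc 1 p.2
      linarith
    · change _ ≤ rc 2 p.2
      linarith
  have key2 : ∀ (z : ℂ) (b : ℝ), 17 / 100 ≤ Complex.normSq z → 17 / 100 ≤ Complex.normSq (unw z b) :=
    fun z b hz => by rwa [Complex.normSq_eq_norm_sq, norm_unw, ← Complex.normSq_eq_norm_sq]
  exact ⟨hg, hc, hrc, le_re_of_abs_arg a2 (key2 _ _ (hrc 0)), le_re_of_abs_arg a3 (key2 _ _ (hrc 1)),
    le_re_of_abs_arg a4 (key2 _ _ (hrc 2))⟩

theorem contDiff_ph {n : WithTop ℕ∞} : ContDiff ℝ n ph :=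
  contDiff_const.mul ((contDiff_rc 0).sub (contDiff_rc 2))

theorem contDiff_rh {n : WithTop ℕ∞} : ContDiff ℝ n rh :=
  contDiff_const.mul ((contDiff_rc 1).sub (contDiff_rc 2))

section Smooth

variable {n : ℕ∞}

theorem contDiffAt_zc (j : Fin 3) :
    ContDiffAt ℝ n (fun p : ℝ × EuclideanSpace ℝ (Fin 6) => zc j p.2) p :=
  ((zc j).contDiff.comp contDiff_snd).contDiffAt

theorem contDiffAt_w0 : ContDiffAt ℝ n (w0 N) p :=
  contDiffAt_unw (contDiffAt_zc 0)
    ((contDiffAt_fst.mul contDiffAt_const).mul (contDiff_ph.comp contDiff_snd).contDiffAt)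

theorem contDiffAt_t0 (h : 0 < (w0 N p).re) : ContDiffAt ℝ n (t0 N) p :=
  (contDiffAt_arg contDiffAt_w0 h).add
    ((contDiffAt_fst.mul contDiffAt_const).mul (contDiff_ph.comp contDiff_snd).contDiffAt)

theorem contDiffAt_w1 (h : 0 < (w0 N p).re) : ContDiffAt ℝ n (w1 N) p :=
  contDiffAt_unw (contDiffAt_zc 1)
    ((contDiffAt_fst.mul contDiffAt_const).mul (contDiffAt_t0 h))

theorem contDiffAt_t1 (h : 0 < (w0 N p).re) (h' : 0 < (w1 N p).re) : ContDiffAt ℝ n (t1 N) p :=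
  (contDiffAt_arg (contDiffAt_w1 h) h').add
    ((contDiffAt_fst.mul contDiffAt_const).mul (contDiffAt_t0 h))

theorem contDiffAt_w2 (h : 0 < (w0 N p).re) (h' : 0 < (w1 N p).re) : ContDiffAt ℝ n (w2 N) p :=
  contDiffAt_unw (contDiffAt_zc 2)
    ((contDiffAt_fst.mul contDiffAt_const).mul (contDiffAt_t1 h h'))

theorem contDiffAt_sl (h : grd N p) : ContDiffAt ℝ n (sl N) p := by
  obtain ⟨h0, h1, h2⟩ := h
  have e : ∀ M : ℝ, ContDiffAt ℝ n (fun p : ℝ × EuclideanSpace ℝ (Fin 6) => p.1 / M) p := fun M =>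
    contDiffAt_fst.div_const M
  exact ((((contDiff_ph.comp contDiff_snd).contDiffAt).add
    ((e N).mul (contDiffAt_arg contDiffAt_w0 h0))).add
    ((e (N ^ 2)).mul (contDiffAt_arg (contDiffAt_w1 h0) h1))).add
    ((e (N ^ 3)).mul (contDiffAt_arg (contDiffAt_w2 h0 h1) h2))

theorem contDiffAt_core (h : grd N p) : ContDiffAt ℝ n (core N) p :=
  contDiffAt_colF (contDiffAt_sl h) (contDiffAt_arg contDiffAt_w0 h.1)
    (contDiffAt_arg (contDiffAt_w1 h.1) h.2.1) (contDiffAt_arg (contDiffAt_w2 h.1 h.2.1) h.2.2)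
    (contDiff_rh.comp contDiff_snd).contDiffAt

theorem eventually_grd (h : grd N p) : ∀ᶠ q in 𝓝 p, grd N q := by
  have key : ∀ f : ℝ × EuclideanSpace ℝ (Fin 6) → ℂ, ContDiffAt ℝ 0 f p → 0 < (f p).re →
      ∀ᶠ q in 𝓝 p, 0 < (f q).re := fun f hf h =>
    (Complex.continuous_re.continuousAt.comp hf.continuousAt).eventually (lt_mem_nhds h)
  exact (key _ contDiffAt_w0 h.1).and ((key _ (contDiffAt_w1 h.1) h.2.1).and
    (key _ (contDiffAt_w2 h.1 h.2.1) h.2.2))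

theorem fam_eventuallyEq (h : grd N p) : fam N =ᶠ[𝓝 p] core N := by
  filter_upwards [eventually_grd h] with q hq
  exact if_pos hq

theorem contDiffAt_fam (h : grd N p) : ContDiffAt ℝ n (fam N) p :=
  (contDiffAt_core h).congr_of_eventuallyEq (fam_eventuallyEq h)

end Smooth

theorem fam_dichotomy (hN : 1 ≤ N) (p : ℝ × EuclideanSpace ℝ (Fin 6)) :
    (∀ᶠ q in 𝓝 p, Good q → fam N q = 1) ∨ grd N p := by
  have key : ∀ f : ℝ × EuclideanSpace ℝ (Fin 6) → ℂ, ContDiffAt ℝ 0 f p → ¬ 0 < (f p).re →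
      (∀ q, Good q → fam N q ≠ 1 → 1 / 5 ≤ (f q).re) → ∀ᶠ q in 𝓝 p, Good q → fam N q = 1 := by
    intro f hf h h'
    have h1 : (f p).re < 1 / 5 := by linarith
    filter_upwards [(Complex.continuous_re.continuousAt.comp hf.continuousAt).eventually
      (gt_mem_nhds h1)] with q hq hg
    by_contra hne
    exact absurd (h' q hg hne) (not_le.2 hq)
  by_cases h0 : 0 < (w0 N p).re
  · by_cases h1 : 0 < (w1 N p).re
    · by_cases h2 : 0 < (w2 N p).re
      · exact Or.inr ⟨h0, h1, h2⟩
      · exact Or.inl (key _ (contDiffAt_w2 h0 h1) h2 fun q hg hq => (fam_ne_one hN hg hq).2.2.2.2.2)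
    · exact Or.inl (key _ (contDiffAt_w1 h0) h1 fun q hg hq => (fam_ne_one hN hg hq).2.2.2.2.1)
  · exact Or.inl (key _ contDiffAt_w0 h0 fun q hg hq => (fam_ne_one hN hg hq).2.2.2.1)

theorem continuousOn_fam (hN : 1 ≤ N) : ContinuousOn (fam N) {p | Good p} := by
  intro p hp
  rcases fam_dichotomy hN p with h | h
  · refine ContinuousWithinAt.congr_of_eventuallyEq (f := fun _ => 1) continuousWithinAt_const ?_
      (h.self_of_nhds hp)
    filter_upwards [mem_nhdsWithin_of_mem_nhds h, self_mem_nhdsWithin] with q hq hg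
    exact hq hg
  · exact (contDiffAt_fam (n := 0) h).continuousAt.continuousWithinAt

end Twist

end Family

section Straight

open Quaternion Topology Filter TTS

namespace Twist

/-- The interpolation between the angle and the imaginary part. -/
def itp (m : ℝ) (z : ℂ) : ℝ := (1 - m) * z.arg + 20 * m * z.im

/-- The interpolation between the squared modulus and the real part. -/
def itr (m : ℝ) (z : ℂ) : ℝ := (1 - m) * Complex.normSq z + m * z.re

theorem abs_itp {m : ℝ} (h0 : 0 ≤ m) (h1 : m ≤ 1) (z : ℂ) :
    |itp m z| = (1 - m) * |z.arg| + 20 * m * |z.im| := by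
  rw [itp]
  rcases le_or_gt 0 z.im with h | h
  · have ha := Complex.arg_nonneg_iff.2 h
    rw [abs_of_nonneg ha, abs_of_nonneg h, abs_of_nonneg]
    have := mul_nonneg (sub_nonneg.2 h1) ha
    positivity
  · have ha := Complex.arg_neg_iff.2 h
    rw [abs_of_neg ha, abs_of_neg h, abs_of_nonpos]
    · ring
    · have := mul_nonneg (sub_nonneg.2 h1) (neg_nonneg.2 ha.le)
      nlinarith

theorem normSq_lt_of_itp {m : ℝ} (h0 : 0 ≤ m) (h1 : m ≤ 1) {z : ℂ} (hz : 0 < z.re)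
    (hi : |itp m z| < 1) (hr : z.re < 1 / 50) : Complex.normSq z < 1 / 100 := by
  by_contra! hs
  rw [abs_itp h0 h1] at hi
  have hy : 1 ≤ 20 * |z.im| := by
    rw [Complex.normSq_apply] at hs
    have := sq_abs z.im
    nlinarith [abs_nonneg z.im]
  have ha : 1 ≤ |z.arg| := by
    by_contra! ha
    have h2 := Real.one_sub_sq_div_two_le_cos (x := z.arg)
    have h3 : z.arg ^ 2 < 1 := (sq_lt_one_iff_abs_lt_one _).2 ha
    have h4 : 1 / 10 ≤ ‖z‖ := by
      rw [Complex.normSq_eq_norm_sq] at hs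
      nlinarith [norm_nonneg z]
    have h5 := Complex.norm_mul_cos_arg z
    nlinarith
  nlinarith

theorem normSq_le_of_itr {m : ℝ} (h0 : 0 ≤ m) (h1 : m ≤ 1) {z : ℂ} (hz : 0 < z.re)
    (hi : |itp m z| < 1) (hn : Complex.normSq z ≤ 1) (hr : itr m z ≤ 3 / 100 + m / 10) :
    Complex.normSq z ≤ 16 / 100 := by
  rw [abs_itp h0 h1] at hi
  have h2 : |z.im| ≤ |z.arg| := by
    have h3 := Complex.norm_mul_sin_arg z
    have h4 : ‖z‖ ≤ 1 := by
      rw [Complex.normSq_eq_norm_sq] at hn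
      nlinarith [norm_nonneg z]
    rw [← h3, abs_mul, abs_norm]
    exact (mul_le_of_le_one_left (abs_nonneg _) h4).trans Real.abs_sin_le_abs
  have h5 : (1 + 19 * m) * |z.im| < 1 := by nlinarith
  have h6 := Complex.normSq_nonneg z
  rw [itr] at hr
  rcases le_or_gt m (1 / 2) with hm | hm
  · nlinarith
  · have h7 : z.re ≤ 16 / 100 := by nlinarith [mul_nonneg (sub_nonneg.2 h1) h6]
    have h8 : |z.im| < 1 / 10 := by nlinarith [abs_nonneg z.im]
    rw [Complex.normSq_apply]
    nlinarith [abs_mul_abs_self z.im, abs_nonneg z.im]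

variable (p : ℝ × EuclideanSpace ℝ (Fin 6))

/-- The value of the straightening family in the right half-planes. -/
def sco : Quaternion ℝ :=
  colF (100 * (itr p.1 (zc 0 p.2) - itr p.1 (zc 2 p.2))) (itp p.1 (zc 0 p.2)) (itp p.1 (zc 1 p.2))
    (itp p.1 (zc 2 p.2)) (100 * (itr p.1 (zc 1 p.2) - itr p.1 (zc 2 p.2)))

open Classical in
/-- The straightening family. -/
def str : Quaternion ℝ := if ∀ j, 0 < (zc j p.2).re then sco p else 1

/-- The domain of the straightening family. -/
def Strip : Set (ℝ × EuclideanSpace ℝ (Fin 6)) := {p | p.1 ∈ Icc (0 : ℝ) 1 ∧ ‖p.2‖ = 1}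

variable {p}

theorem normSq_str : normSq (str p) = 1 := by
  unfold str
  split_ifs
  · exact normSq_colF _ _ _ _ _
  · simp

theorem str_ne_one (hp : p ∈ Strip) (h : str p ≠ 1) (j : Fin 3) : 1 / 50 ≤ (zc j p.2).re := by
  obtain ⟨⟨h0, h1⟩, hr⟩ := hp
  have hg : ∀ j, 0 < (zc j p.2).re := by
    by_contra hg
    exact h (if_neg hg)
  rw [str, if_pos hg] at h
  obtain ⟨a1, a2, a3, a4, a5⟩ := colF_ne_one h
  have ai : ∀ j, |itp p.1 (zc j p.2)| < 1 := fun j => by fin_cases j <;> assumption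
  have hs : rc 0 p.2 + rc 1 p.2 + rc 2 p.2 = 1 := by rw [← norm_sq_eq, hr, one_pow]
  simp only [rc] at hs
  have hn : ∀ j, Complex.normSq (zc j p.2) ≤ 1 := fun j => by
    have e0 := Complex.normSq_nonneg (zc 0 p.2)
    have e1 := Complex.normSq_nonneg (zc 1 p.2)
    have e2 := Complex.normSq_nonneg (zc 2 p.2)
    fin_cases j
    · change Complex.normSq (zc 0 p.2) ≤ 1
      linarith
    · change Complex.normSq (zc 1 p.2) ≤ 1
      linarith
    · change Complex.normSq (zc 2 p.2) ≤ 1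
      linarith
  by_contra! hj
  have hb := normSq_lt_of_itp h0 h1 (hg j) (ai j) hj
  have hx : (zc j p.2).re ≤ 1 / 10 := by linarith
  have hi : itr p.1 (zc j p.2) ≤ 1 / 100 + p.1 / 10 := by
    rw [itr]
    nlinarith [Complex.normSq_nonneg (zc j p.2)]
  have hk : ∀ k, itr p.1 (zc k p.2) ≤ 3 / 100 + p.1 / 10 := fun k => by
    rw [abs_lt] at a1 a5
    have hjk : ∀ k, |itr p.1 (zc k p.2) - itr p.1 (zc 2 p.2)| ≤ 1 / 100 := fun k => by
      rw [abs_le]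
      fin_cases k
      · constructor
        · change _ ≤ itr p.1 (zc 0 p.2) - _
          linarith
        · change itr p.1 (zc 0 p.2) - _ ≤ _
          linarith
      · constructor
        · change _ ≤ itr p.1 (zc 1 p.2) - _
          linarith
        · change itr p.1 (zc 1 p.2) - _ ≤ _
          linarith
      · constructor
        · change _ ≤ itr p.1 (zc 2 p.2) - _
          linarith
        · change itr p.1 (zc 2 p.2) - _ ≤ _
          linarith
    have e1 := abs_le.1 (hjk j)
    have e2 := abs_le.1 (hjk k)
    linarith
  have e := fun k => normSq_le_of_itr h0 h1 (hg k) (ai k) (hn k) (hk k)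
  linarith [e 0, e 1, e 2]

theorem continuousAt_sco (h : ∀ j, 0 < (zc j p.2).re) : ContinuousAt sco p := by
  have hi : ∀ j, ContDiffAt ℝ 0
      (fun q : ℝ × EuclideanSpace ℝ (Fin 6) => itp q.1 (zc j q.2)) p := fun j => by
    have e : ContDiffAt ℝ 0 (fun q : ℝ × EuclideanSpace ℝ (Fin 6) => (zc j q.2).im) p :=
      Complex.imCLM.contDiff.contDiffAt.comp p (contDiffAt_zc j)
    exact ((contDiffAt_const.sub contDiffAt_fst).mul (contDiffAt_arg (contDiffAt_zc j) (h j))).add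
      ((contDiffAt_const.mul contDiffAt_fst).mul e)
  have hr : ∀ j, ContDiffAt ℝ 0
      (fun q : ℝ × EuclideanSpace ℝ (Fin 6) => itr q.1 (zc j q.2)) p := fun j => by
    have e : ContDiffAt ℝ 0 (fun q : ℝ × EuclideanSpace ℝ (Fin 6) => (zc j q.2).re) p :=
      Complex.reCLM.contDiff.contDiffAt.comp p (contDiffAt_zc j)
    exact ((contDiffAt_const.sub contDiffAt_fst).mul
      ((contDiff_rc j).contDiffAt.comp p contDiffAt_snd)).add (contDiffAt_fst.mul e)
  exact (contDiffAt_colF (n := 0) (contDiffAt_const.mul ((hr 0).sub (hr 2))) (hi 0) (hi 1) (hi 2)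
    (contDiffAt_const.mul ((hr 1).sub (hr 2)))).continuousAt

theorem continuousOn_str : ContinuousOn str Strip := by
  intro p hp
  have hc : ∀ j, Continuous fun q : ℝ × EuclideanSpace ℝ (Fin 6) => (zc j q.2).re := fun j =>
    Complex.continuous_re.comp ((zc j).continuous.comp continuous_snd)
  by_cases h : ∀ j, 0 < (zc j p.2).re
  · have he : str =ᶠ[𝓝 p] sco := by
      filter_upwards [eventually_all.2 fun j => (hc j).continuousAt.eventually
        (lt_mem_nhds (h j))] with q hq
      exact if_pos hq
    exact ((continuousAt_sco h).congr he.symm).continuousWithinAt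
  · obtain ⟨j, hj⟩ := not_forall.1 h
    have h1 : (zc j p.2).re < 1 / 50 := by linarith
    refine ContinuousWithinAt.congr_of_eventuallyEq (f := fun _ => 1) continuousWithinAt_const ?_
      (if_neg h)
    filter_upwards [mem_nhdsWithin_of_mem_nhds ((hc j).continuousAt.eventually (gt_mem_nhds h1)),
      self_mem_nhdsWithin] with q hq hg
    by_contra hne
    exact absurd (str_ne_one hg hne j) (not_le.2 hq)

theorem fam_zero_eq_str {N : ℝ} (x : EuclideanSpace ℝ (Fin 6)) : fam N (0, x) = str (0, x) := by
  have e0 : w0 N (0, x) = zc 0 x := by simp [w0, unw_zero]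
  have e1 : w1 N (0, x) = zc 1 x := by simp [w1, unw_zero]
  have e2 : w2 N (0, x) = zc 2 x := by simp [w2, unw_zero]
  have hg : grd N (0, x) ↔ ∀ j, 0 < (zc j x).re := by
    rw [grd, e0, e1, e2, Fin.forall_fin_succ, Fin.forall_fin_two]
    rfl
  have hc : core N (0, x) = sco (0, x) := by
    simp only [core, sco, sl, e0, e1, e2, itp, itr, ph, rh, rc]
    simp
  simp only [fam, str, hg, hc]

end Twist

end Straight

section Pullback

open Quaternion Topology Filter TTS

namespace Twist

theorem mix_ne_zero {E : Type*} [NormedAddCommGroup E] [NormedSpace ℝ E] {u v : E} (hu : ‖u‖ = 1)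
    (hv : ‖v‖ = 1) (h : u ≠ -v) {t : ℝ} (h0 : 0 ≤ t) (h1 : t ≤ 1) : (1 - t) • u + t • v ≠ 0 := by
  intro he
  have h2 : (1 - t) • u = -(t • v) := eq_neg_of_add_eq_zero_left he
  have h3 := congrArg norm h2
  rw [norm_neg, norm_smul, norm_smul, hu, hv, Real.norm_of_nonneg h0,
    Real.norm_of_nonneg (sub_nonneg.2 h1)] at h3
  have h4 : t = 1 / 2 := by linarith
  subst h4
  apply h
  have h5 : (1 / 2 : ℝ) • (u + v) = 0 := by
    rw [smul_add, ← he]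
    norm_num
  exact eq_neg_of_add_eq_zero_left ((smul_eq_zero.1 h5).resolve_left (by norm_num))

/-- The normalized segment between two unit vectors. -/
def nseg {E : Type*} [NormedAddCommGroup E] [NormedSpace ℝ E] (t : ℝ) (u v : E) : E :=
  ‖(1 - t) • u + t • v‖⁻¹ • ((1 - t) • u + t • v)

section NSeg

variable {E : Type*} [NormedAddCommGroup E] [NormedSpace ℝ E]

theorem nseg_zero {u v : E} (hu : ‖u‖ = 1) : nseg 0 u v = u := by simp [nseg, hu]

theorem nseg_one {u v : E} (hv : ‖v‖ = 1) : nseg 1 u v = v := by simp [nseg, hv]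

theorem norm_nseg {u v : E} (hu : ‖u‖ = 1) (hv : ‖v‖ = 1) (h : u ≠ -v) (t : unitInterval) :
    ‖nseg (t : ℝ) u v‖ = 1 :=
  norm_smul_inv_norm (𝕜 := ℝ) (mix_ne_zero hu hv h t.2.1 t.2.2)

theorem continuous_nseg {Y : Type*} [TopologicalSpace Y] {u v : Y → E} (hu : ∀ y, ‖u y‖ = 1)
    (hv : ∀ y, ‖v y‖ = 1) (h : ∀ y, u y ≠ -v y) (cu : Continuous u) (cv : Continuous v) :
    Continuous fun q : unitInterval × Y => nseg (q.1 : ℝ) (u q.2) (v q.2) := by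
  have ht : Continuous fun q : unitInterval × Y => (q.1 : ℝ) :=
    continuous_subtype_val.comp continuous_fst
  have hc : Continuous fun q : unitInterval × Y => (1 - (q.1 : ℝ)) • u q.2 + (q.1 : ℝ) • v q.2 :=
    ((continuous_const.sub ht).smul (cu.comp continuous_snd)).add (ht.smul (cv.comp continuous_snd))
  exact (hc.norm.inv₀ fun q => norm_ne_zero_iff.2
    (mix_ne_zero (hu _) (hv _) (h _) q.1.2.1 q.1.2.2)).smul hc

end NSeg

theorem norm_of_normSq {x : Quaternion ℝ} (h : normSq x = 1) : ‖x‖ = 1 :=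
  mem_sphere_zero_iff_norm.1 (mem_S3 h)

theorem complex_sq_of_norm {w : ℂ} (h : ‖w‖ = 1) : w.re * w.re + w.im * w.im = 1 := by
  rw [← Complex.normSq_apply, Complex.normSq_eq_norm_sq, h, one_pow]

theorem norm_of_complex_sq {w : ℂ} (h : w.re * w.re + w.im * w.im = 1) : ‖w‖ = 1 := by
  rw [← Complex.normSq_apply, Complex.normSq_eq_norm_sq] at h
  nlinarith [norm_nonneg w]

theorem normSq_of_norm {x : Quaternion ℝ} (h : ‖x‖ = 1) : normSq x = 1 := by
  rw [normSq_eq_norm_mul_self, h, mul_one]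

/-- The iterated commutator of three families of unit vectors. -/
def comC (a b : C(TTS, Metric.sphere (0 : ℂ) 1)) (x : C(TTS, S3)) : C(TTS, S3) :=
  ⟨fun y => ⟨com (a y) (com (b y) (x y)), mem_S3 (normSq_com (complex_sq_of_norm
    (norm_eq_of_mem_sphere (a y))) (normSq_com (complex_sq_of_norm
    (norm_eq_of_mem_sphere (b y))) (normSq_sphere (x y))))⟩, by
    refine Continuous.subtype_mk ?_ _
    exact continuous_com (continuous_subtype_val.comp a.continuous)
      (continuous_com (continuous_subtype_val.comp b.continuous)
        (continuous_subtype_val.comp x.continuous))⟩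

theorem homotopic_comC {a b a' b' : C(TTS, Metric.sphere (0 : ℂ) 1)} {x x' : C(TTS, S3)}
    (ha : ∀ y, (a y : ℂ) ≠ -(a' y : ℂ)) (hb : ∀ y, (b y : ℂ) ≠ -(b' y : ℂ))
    (hx : ∀ y, (x y : Quaternion ℝ) ≠ -(x' y : Quaternion ℝ)) :
    (comC a b x).Homotopic (comC a' b' x') := by
  have na := fun y => norm_eq_of_mem_sphere (a y)
  have nb := fun y => norm_eq_of_mem_sphere (b y)
  have nx := fun y => norm_eq_of_mem_sphere (x y)
  have na' := fun y => norm_eq_of_mem_sphere (a' y)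
  have nb' := fun y => norm_eq_of_mem_sphere (b' y)
  have nx' := fun y => norm_eq_of_mem_sphere (x' y)
  have ca : Continuous fun q : unitInterval × TTS => nseg (q.1 : ℝ) (a q.2 : ℂ) (a' q.2) :=
    continuous_nseg (u := fun y => (a y : ℂ)) (v := fun y => (a' y : ℂ)) na na' ha
      (continuous_subtype_val.comp a.continuous) (continuous_subtype_val.comp a'.continuous)
  have cb : Continuous fun q : unitInterval × TTS => nseg (q.1 : ℝ) (b q.2 : ℂ) (b' q.2) :=
    continuous_nseg (u := fun y => (b y : ℂ)) (v := fun y => (b' y : ℂ)) nb nb' hb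
      (continuous_subtype_val.comp b.continuous) (continuous_subtype_val.comp b'.continuous)
  have cx : Continuous fun q : unitInterval × TTS =>
      nseg (q.1 : ℝ) (x q.2 : Quaternion ℝ) (x' q.2) :=
    continuous_nseg (u := fun y => (x y : Quaternion ℝ)) (v := fun y => (x' y : Quaternion ℝ))
      nx nx' hx (continuous_subtype_val.comp x.continuous) (continuous_subtype_val.comp x'.continuous)
  let H : C(unitInterval × TTS, S3) :=
    ⟨fun q => ⟨com (nseg (q.1 : ℝ) (a q.2 : ℂ) (a' q.2)) (com (nseg (q.1 : ℝ) (b q.2 : ℂ) (b' q.2))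
      (nseg (q.1 : ℝ) (x q.2 : Quaternion ℝ) (x' q.2))), mem_S3 (normSq_com (complex_sq_of_norm
      (norm_nseg (na _) (na' _) (ha _) _)) (normSq_com (complex_sq_of_norm
      (norm_nseg (nb _) (nb' _) (hb _) _)) (normSq_of_norm (norm_nseg (nx _) (nx' _) (hx _) _))))⟩,
      (continuous_com ca (continuous_com cb cx)).subtype_mk _⟩
  refine ⟨⟨H, fun y => Subtype.ext ?_, fun y => Subtype.ext ?_⟩⟩
  · change com (nseg (0 : ℝ) (a y : ℂ) (a' y)) (com (nseg (0 : ℝ) (b y : ℂ) (b' y))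
      (nseg (0 : ℝ) (x y : Quaternion ℝ) (x' y))) = com (a y) (com (b y) (x y))
    rw [nseg_zero (na _), nseg_zero (nb _), nseg_zero (nx _)]
  · change com (nseg (1 : ℝ) (a y : ℂ) (a' y)) (com (nseg (1 : ℝ) (b y : ℂ) (b' y))
      (nseg (1 : ℝ) (x y : Quaternion ℝ) (x' y))) = com (a' y) (com (b' y) (x' y))
    rw [nseg_one (na' _), nseg_one (nb' _), nseg_one (nx' _)]

variable (y : TTS)

/-- The signed distance to the walls. -/
def wall : ℝ := min (min (-(y.1 : ℂ).re) (-(y.2.1 : ℂ).re)) (-(y.2.2 : Quaternion ℝ).re)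

/-- The unnormalized collapse map to `ℝ⁶`. -/
def raw : EuclideanSpace ℝ (Fin 6) :=
  !₂[wall y + (y.1 : ℂ).im, (y.2.1 : ℂ).im, wall y + (y.2.2 : Quaternion ℝ).imK,
    (y.2.2 : Quaternion ℝ).imI, wall y, (y.2.2 : Quaternion ℝ).imJ]

theorem zc_raw_zero : zc 0 (raw y) = ⟨wall y + (y.1 : ℂ).im, (y.2.1 : ℂ).im⟩ :=
  Complex.ext (zc_re 0 _) (zc_im 0 _)

theorem zc_raw_one : zc 1 (raw y) =
    ⟨wall y + (y.2.2 : Quaternion ℝ).imK, (y.2.2 : Quaternion ℝ).imI⟩ :=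
  Complex.ext (zc_re 1 _) (zc_im 1 _)

theorem zc_raw_two : zc 2 (raw y) = ⟨wall y, (y.2.2 : Quaternion ℝ).imJ⟩ :=
  Complex.ext (zc_re 2 _) (zc_im 2 _)

theorem norm_raw_sq : ‖raw y‖ ^ 2 = (wall y + (y.1 : ℂ).im) ^ 2 + (y.2.1 : ℂ).im ^ 2 +
    (wall y + (y.2.2 : Quaternion ℝ).imK) ^ 2 + (y.2.2 : Quaternion ℝ).imI ^ 2 + wall y ^ 2 +
    (y.2.2 : Quaternion ℝ).imJ ^ 2 := by
  rw [norm_sq_eq]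
  simp only [rc, zc_raw_zero, zc_raw_one, zc_raw_two, Complex.normSq_mk]
  ring

theorem sphere_sq : (y.2.2 : Quaternion ℝ).re ^ 2 + (y.2.2 : Quaternion ℝ).imI ^ 2 +
    (y.2.2 : Quaternion ℝ).imJ ^ 2 + (y.2.2 : Quaternion ℝ).imK ^ 2 = 1 := by
  have := normSq_sphere y.2.2
  rwa [normSq_def'] at this

theorem abs_wall_le : |wall y| ≤ 1 := by
  have h1 := circle_sq y.1
  have h2 := circle_sq y.2.1
  have h3 := sphere_sq y
  have e1 : |(y.1 : ℂ).re| ≤ 1 := abs_le_one_iff_mul_self_le_one.2 (by nlinarith)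
  have e2 : |(y.2.1 : ℂ).re| ≤ 1 := abs_le_one_iff_mul_self_le_one.2 (by nlinarith)
  have e3 : |(y.2.2 : Quaternion ℝ).re| ≤ 1 := abs_le_one_iff_mul_self_le_one.2 (by nlinarith)
  rw [abs_le] at *
  refine ⟨le_min (le_min ?_ ?_) ?_, (min_le_right _ _).trans ?_⟩ <;> linarith

theorem norm_raw_lt : ‖raw y‖ < 4 := by
  have h := norm_raw_sq y
  have h1 := circle_sq y.1
  have h2 := circle_sq y.2.1
  have h3 := sphere_sq y
  have h4 := abs_wall_le y
  rw [← sq_le_one_iff_abs_le_one] at h4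
  by_contra! h5
  have h6 : 16 ≤ ‖raw y‖ ^ 2 := by nlinarith
  nlinarith [sq_nonneg (wall y - (y.1 : ℂ).im), sq_nonneg (wall y - (y.2.2 : Quaternion ℝ).imK),
    sq_nonneg (y.1 : ℂ).re, sq_nonneg (y.2.1 : ℂ).re, sq_nonneg (y.2.2 : Quaternion ℝ).re,
    sq_nonneg (y.2.2 : Quaternion ℝ).imI, sq_nonneg (y.2.2 : Quaternion ℝ).imJ]

theorem norm_raw_pos : 0 < ‖raw y‖ := by
  by_contra! h0
  have h := norm_raw_sq y
  rw [le_antisymm h0 (norm_nonneg _), zero_pow two_ne_zero] at h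
  have hw : wall y = 0 := by nlinarith
  have h1 := circle_sq y.1
  have h2 := circle_sq y.2.1
  have h3 := sphere_sq y
  rw [hw] at h
  have a1 : (y.1 : ℂ).im = 0 := by nlinarith
  have a2 : (y.2.1 : ℂ).im = 0 := by nlinarith
  have a3 : (y.2.2 : Quaternion ℝ).imI = 0 := by nlinarith
  have a4 : (y.2.2 : Quaternion ℝ).imJ = 0 := by nlinarith
  have a5 : (y.2.2 : Quaternion ℝ).imK = 0 := by nlinarith
  rw [a1] at h1
  rw [a2] at h2
  rw [a3, a4, a5] at h3
  unfold wall at hw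
  rcases min_choice (min (-(y.1 : ℂ).re) (-(y.2.1 : ℂ).re)) (-(y.2.2 : Quaternion ℝ).re) with e | e <;>
    rw [e] at hw
  · rcases min_choice (-(y.1 : ℂ).re) (-(y.2.1 : ℂ).re) with e | e <;> rw [e] at hw <;> nlinarith
  · nlinarith

theorem continuous_raw : Continuous raw := by
  have c1 : Continuous fun y : TTS => (y.1 : ℂ) := continuous_circle_coe.comp continuous_fst
  have c2 : Continuous fun y : TTS => (y.2.1 : ℂ) :=
    continuous_circle_coe.comp (continuous_fst.comp continuous_snd)
  have c3 : Continuous fun y : TTS => (y.2.2 : Quaternion ℝ) :=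
    continuous_subtype_val.comp (continuous_snd.comp continuous_snd)
  have hw : Continuous wall := ((Complex.continuous_re.comp c1).neg.min
    (Complex.continuous_re.comp c2).neg).min (Quaternion.continuous_re.comp c3).neg
  refine (PiLp.continuous_toLp 2 _).comp (continuous_pi fun i => ?_)
  fin_cases i
  · exact hw.add (Complex.continuous_im.comp c1)
  · exact Complex.continuous_im.comp c2
  · exact hw.add (Quaternion.continuous_imK.comp c3)
  · exact Quaternion.continuous_imI.comp c3
  · exact hw
  · exact Quaternion.continuous_imJ.comp c3

/-- The collapse map to the sphere. -/
def collapse : C(TTS, Metric.sphere (0 : EuclideanSpace ℝ (Fin 6)) 1) :=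
  ⟨fun y => ⟨‖raw y‖⁻¹ • raw y, mem_sphere_zero_iff_norm.2
    (norm_smul_inv_norm (𝕜 := ℝ) (norm_pos_iff.1 (norm_raw_pos y)))⟩,
    ((continuous_raw.norm.inv₀ fun y => (norm_raw_pos y).ne').smul continuous_raw).subtype_mk _⟩

end Twist

end Pullback

section Nontrivial

open Quaternion Topology Filter TTS

namespace Twist

theorem colB_nonneg {q : ℝ} (h0 : 0 ≤ q) : 0 ≤ colB q := by
  rcases lt_or_ge q 1 with h | h
  · exact (colB_pos h0 h).le
  · rw [colB_of_one_le h]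

theorem continuous_colE : Continuous colE :=
  continuous_iff_continuousAt.2 fun _ =>
    (contDiffAt_colE (n := 0) (s := fun t => t) contDiffAt_id).continuousAt

theorem continuous_colC {Y : Type*} [TopologicalSpace Y] {a b c : Y → ℝ} (ha : Continuous a)
    (hb : Continuous b) (hc : Continuous c) : Continuous fun y => colC (a y) (b y) (c y) := by
  have hA : ∀ q : ℝ, 0 ≤ q → ContinuousAt colA q := fun q hq =>
    (contDiffAt_colA (n := 0) (f := fun t : ℝ => t) contDiffAt_id hq).continuousAt
  have hB : ∀ q : ℝ, 0 ≤ q → ContinuousAt colB q := fun q hq =>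
    (contDiffAt_colB (n := 0) (f := fun t : ℝ => t) contDiffAt_id hq).continuousAt
  have hq : Continuous fun y => a y ^ 2 + b y ^ 2 + c y ^ 2 :=
    ((ha.pow 2).add (hb.pow 2)).add (hc.pow 2)
  have hA' : Continuous fun y => colA (a y ^ 2 + b y ^ 2 + c y ^ 2) :=
    continuous_iff_continuousAt.2 fun y => (hA _ (by positivity)).comp (f := fun y =>
      a y ^ 2 + b y ^ 2 + c y ^ 2) hq.continuousAt
  have hB' : Continuous fun y => colB (a y ^ 2 + b y ^ 2 + c y ^ 2) :=
    continuous_iff_continuousAt.2 fun y => (hB _ (by positivity)).comp (f := fun y =>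
      a y ^ 2 + b y ^ 2 + c y ^ 2) hq.continuousAt
  exact continuous_quaternion (f := fun y => colC (a y) (b y) (c y)) hA' (hB'.mul ha) (hB'.mul hb)
    (hB'.mul hc)

theorem colE_ne_neg {k : ℝ} (hk : 0 < k) {w : ℂ} (hr : w.re ≤ 0) : colE (k * w.im) ≠ -w := by
  intro h
  have h1 := congrArg Complex.re h
  have h2 := congrArg Complex.im h
  simp only [colE, Complex.neg_re, Complex.neg_im] at h1 h2
  have h3 : (colB ((k * w.im) ^ 2) * k + 1) * w.im = 0 := by linarith
  have h4 : 0 < colB ((k * w.im) ^ 2) * k + 1 := by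
    have := colB_nonneg (sq_nonneg (k * w.im))
    positivity
  have h5 : w.im = 0 := (mul_eq_zero.1 h3).resolve_left h4.ne'
  rw [h5, mul_zero, zero_pow two_ne_zero, colA_zero] at h1
  linarith

theorem colC_ne_neg {k l : ℝ} (hk : 0 < k) (hl : 0 < l) {x : Quaternion ℝ} (hr : x.re ≤ 0) :
    colC (k * x.imI) (k * x.imJ) (l * x.imK) ≠ -x := by
  intro h
  have h0 := congrArg QuaternionAlgebra.re h
  have h1 := congrArg QuaternionAlgebra.imI h
  have h2 := congrArg QuaternionAlgebra.imJ h
  have h3 := congrArg QuaternionAlgebra.imK h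
  simp only [colC, hq_re, hq_imI, hq_imJ, hq_imK, Quaternion.re_neg, Quaternion.imI_neg,
    Quaternion.imJ_neg, Quaternion.imK_neg] at h0 h1 h2 h3
  have hB := colB_nonneg (q := (k * x.imI) ^ 2 + (k * x.imJ) ^ 2 + (l * x.imK) ^ 2) (by positivity)
  have key : ∀ m y : ℝ, 0 < m → colB ((k * x.imI) ^ 2 + (k * x.imJ) ^ 2 + (l * x.imK) ^ 2) * (m * y) = -y →
      y = 0 := fun m y hm hy => by
    have h3 : (colB ((k * x.imI) ^ 2 + (k * x.imJ) ^ 2 + (l * x.imK) ^ 2) * m + 1) * y = 0 := by linarith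
    exact (mul_eq_zero.1 h3).resolve_left (by positivity)
  rw [key _ _ hk h1, key _ _ hk h2, key _ _ hl h3] at h0
  simp [colA_zero] at h0
  linarith

theorem one_le_scale_sq {k t : ℝ} (y : TTS) (hk : 20 ≤ k) (ht : 9 / 10 ≤ t) :
    1 ≤ (k / ‖raw y‖) ^ 2 * t := by
  have h1 := norm_raw_lt y
  have h2 := norm_raw_pos y
  have h3 : 5 ≤ k / ‖raw y‖ := by rw [le_div_iff₀ h2]; linarith
  have h4 : 25 ≤ (k / ‖raw y‖) ^ 2 := by nlinarith
  nlinarith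

open Classical in
/-- A degree one collapse of the circle, with scale depending on a parameter. -/
def etaE (k : ℝ) (y : TTS) (w : ℂ) : ℂ := if w.re ≤ 0 then colE (k / ‖raw y‖ * w.im) else 1

open Classical in
/-- A degree one collapse of the three-sphere, with scale depending on a parameter. -/
def etaC (k l : ℝ) (y : TTS) (x : Quaternion ℝ) : Quaternion ℝ :=
  if x.re ≤ 0 then colC (k / ‖raw y‖ * x.imI) (k / ‖raw y‖ * x.imJ) (l / ‖raw y‖ * x.imK) else 1

theorem etaE_of_large {k : ℝ} (hk : 20 ≤ k) {w : ℂ} (hw : 9 / 10 ≤ w.im ^ 2) (y : TTS) :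
    etaE k y w = 1 := by
  unfold etaE
  split_ifs
  · refine colE_of_one_le ?_
    rw [mul_pow]
    exact one_le_scale_sq y hk hw
  · rfl

theorem etaC_of_large {k l : ℝ} (hk : 20 ≤ k) (hl : k ≤ l) {x : Quaternion ℝ}
    (hx : 9 / 10 ≤ x.imI ^ 2 + x.imJ ^ 2 + x.imK ^ 2) (y : TTS) : etaC k l y x = 1 := by
  unfold etaC
  split_ifs
  · refine colC_of_one_le ?_
    have h1 := one_le_scale_sq y hk hx
    have h2 : (k / ‖raw y‖) ^ 2 ≤ (l / ‖raw y‖) ^ 2 := by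
      have := norm_raw_pos y
      gcongr
    nlinarith [sq_nonneg x.imK]
  · rfl

theorem continuous_etaE {k : ℝ} (hk : 20 ≤ k) {w : TTS → ℂ} (hw : Continuous w)
    (h : ∀ y, (w y).re * (w y).re + (w y).im * (w y).im = 1) :
    Continuous fun y => etaE k y (w y) := by
  have hs : Continuous fun y : TTS => k / ‖raw y‖ :=
    continuous_const.div continuous_raw.norm fun y => (norm_raw_pos y).ne'
  refine Continuous.if_le (continuous_colE.comp (hs.mul (Complex.continuous_im.comp hw)))
    continuous_const (Complex.continuous_re.comp hw) continuous_const fun y hy => ?_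
  have := etaE_of_large hk (w := w y) (by have := h y; rw [hy] at this; linarith) y
  rwa [etaE, if_pos hy.le] at this

theorem continuous_etaC {k l : ℝ} (hk : 20 ≤ k) (hl : k ≤ l) :
    Continuous fun y : TTS => etaC k l y y.2.2 := by
  have hs : ∀ k : ℝ, Continuous fun y : TTS => k / ‖raw y‖ := fun k =>
    continuous_const.div continuous_raw.norm fun y => (norm_raw_pos y).ne'
  have c3 : Continuous fun y : TTS => (y.2.2 : Quaternion ℝ) :=
    continuous_subtype_val.comp (continuous_snd.comp continuous_snd)
  refine Continuous.if_le (continuous_colC ((hs k).mul (Quaternion.continuous_imI.comp c3))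
    ((hs k).mul (Quaternion.continuous_imJ.comp c3)) ((hs l).mul (Quaternion.continuous_imK.comp c3)))
    continuous_const (Quaternion.continuous_re.comp c3) continuous_const fun y hy => ?_
  have := etaC_of_large hk hl (x := (y.2.2 : Quaternion ℝ))
    (by have := sphere_sq y; rw [hy] at this; linarith) y
  rwa [etaC, if_pos hy.le] at this

theorem norm_etaE (k : ℝ) (y : TTS) (w : ℂ) : ‖etaE k y w‖ = 1 := by
  unfold etaE
  split_ifs
  · exact norm_of_complex_sq (colE_sq _)
  · simp

theorem normSq_etaC (k l : ℝ) (y : TTS) (x : Quaternion ℝ) : normSq (etaC k l y x) = 1 := by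
  unfold etaC
  split_ifs
  · exact normSq_colC _ _ _
  · simp

theorem etaE_ne_neg {k : ℝ} (hk : 0 < k) (w : ℂ) (y : TTS) :
    etaE k y w ≠ -w := by
  unfold etaE
  split_ifs with h
  · exact colE_ne_neg (div_pos hk (norm_raw_pos y)) h
  · intro he
    have := congrArg Complex.re he
    simp at this
    linarith

theorem etaC_ne_neg {k l : ℝ} (hk : 0 < k) (hl : 0 < l) (x : Quaternion ℝ) (y : TTS) :
    etaC k l y x ≠ -x := by
  unfold etaC
  split_ifs with h
  · exact colC_ne_neg (div_pos hk (norm_raw_pos y)) (div_pos hl (norm_raw_pos y)) h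
  · intro he
    have := congrArg QuaternionAlgebra.re he
    simp at this
    linarith

theorem com_eq_one {w z : ℂ} {x : Quaternion ℝ} (hz : z.re * z.re + z.im * z.im = 1)
    (hx : normSq x = 1) (h : w = 1 ∨ z = 1 ∨ x = 1) : com w (com z x) = 1 := by
  rcases h with rfl | rfl | rfl
  · exact one_com (normSq_com hz hx)
  · rw [one_com hx, com_one]
  · rw [com_one, com_one]

theorem zc_collapse (y : TTS) (j : Fin 3) :
    zc j (collapse y : EuclideanSpace ℝ (Fin 6)) = (‖raw y‖⁻¹ : ℝ) • zc j (raw y) := by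
  change zc j (‖raw y‖⁻¹ • raw y) = _
  rw [map_smul]

theorem str_collapse (y : TTS) : str (1, (collapse y : EuclideanSpace ℝ (Fin 6))) =
    com (etaE 100 y y.1) (com (etaE 20 y y.2.1) (etaC 20 100 y y.2.2)) := by
  have hp := norm_raw_pos y
  have hip : 0 < ‖raw y‖⁻¹ := inv_pos.2 hp
  by_cases hw : 0 < wall y
  · have w1 : wall y ≤ -(y.1 : ℂ).re := (min_le_left _ _).trans (min_le_left _ _)
    have w2 : wall y ≤ -(y.2.1 : ℂ).re := (min_le_left _ _).trans (min_le_right _ _)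
    have w3 : wall y ≤ -(y.2.2 : Quaternion ℝ).re := min_le_right _ _
    by_cases hg : ∀ j, 0 < (zc j (collapse y : EuclideanSpace ℝ (Fin 6))).re
    · rw [str, if_pos hg, etaE, if_pos (by linarith), etaE, if_pos (by linarith), etaC,
        if_pos (by linarith)]
      simp only [sco, colF, colG, itp, itr, zc_collapse, zc_raw_zero, zc_raw_one, zc_raw_two,
        Complex.smul_re, Complex.smul_im, smul_eq_mul]
      congr 2
      · ring
      · congr 1
        ring
      · congr 1 <;> ring
    · rw [str, if_neg hg]
      refine (com_eq_one (complex_sq_of_norm (norm_etaE _ _ _)) (normSq_etaC _ _ _ _) ?_).symm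
      obtain ⟨j, hj⟩ := not_forall.1 hg
      rw [zc_collapse, Complex.smul_re, smul_eq_mul, mul_pos_iff_of_pos_left hip] at hj
      by_cases hs : 1 / 10 ≤ wall y
      · have key : ∀ t : ℝ, wall y + t ≤ 0 → 1 ≤ (100 / ‖raw y‖ * t) ^ 2 := fun t ht => by
          have h1 := norm_raw_lt y
          have h3 : 25 ≤ 100 / ‖raw y‖ := by rw [le_div_iff₀ hp]; linarith
          have h4 : 1 ≤ 100 / ‖raw y‖ * (-t) := by nlinarith
          nlinarith
        fin_cases j
        · left
          rw [etaE, if_pos (by linarith)]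
          refine colE_of_one_le (key _ ?_)
          change ¬ 0 < (zc 0 (raw y)).re at hj
          rwa [zc_raw_zero, not_lt] at hj
        · right; right
          rw [etaC, if_pos (by linarith)]
          have := key (y.2.2 : Quaternion ℝ).imK (by
            change ¬ 0 < (zc 1 (raw y)).re at hj
            rwa [zc_raw_one, not_lt] at hj)
          exact colC_of_one_le (this.trans (le_add_of_nonneg_left (by positivity)))
        · change ¬ 0 < (zc 2 (raw y)).re at hj
          rw [zc_raw_two] at hj
          exact absurd hw hj
      · rw [not_le, wall] at hs
        rcases min_lt_iff.1 hs with hs | hs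
        · rcases min_lt_iff.1 hs with hs | hs
          · exact Or.inl (etaE_of_large (by norm_num) (by nlinarith [circle_sq y.1]) y)
          · exact Or.inr (Or.inl (etaE_of_large (by norm_num) (by nlinarith [circle_sq y.2.1]) y))
        · exact Or.inr (Or.inr (etaC_of_large (by norm_num) (by norm_num)
            (by nlinarith [sphere_sq y]) y))
  · have hg : ¬ ∀ j, 0 < (zc j (collapse y : EuclideanSpace ℝ (Fin 6))).re := fun hg => by
      have := hg 2
      rw [zc_collapse, zc_raw_two, Complex.smul_re, smul_eq_mul, mul_pos_iff_of_pos_left hip] at this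
      exact hw this
    rw [str, if_neg hg]
    refine (com_eq_one (complex_sq_of_norm (norm_etaE _ _ _)) (normSq_etaC _ _ _ _) ?_).symm
    have kE : ∀ (k : ℝ) (w : ℂ), 20 ≤ k → w.re * w.re + w.im * w.im = 1 → -w.re ≤ 0 →
        etaE k y w = 1 := fun k w hk h h0 => by
      rcases h0.lt_or_eq with h1 | h1
      · rw [etaE, if_neg (by linarith)]
      · exact etaE_of_large hk (by rw [neg_eq_zero] at h1; rw [h1] at h; linarith) y
    rw [not_lt, wall] at hw
    rcases min_le_iff.1 hw with hw | hw
    · rcases min_le_iff.1 hw with hw | hw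
      · exact Or.inl (kE _ _ (by norm_num) (circle_sq _) hw)
      · exact Or.inr (Or.inl (kE _ _ le_rfl (circle_sq _) hw))
    · refine Or.inr (Or.inr ?_)
      rcases hw.lt_or_eq with h1 | h1
      · rw [etaC, if_neg (by linarith)]
      · exact etaC_of_large le_rfl (by norm_num)
          (by rw [neg_eq_zero] at h1; have := sphere_sq y; rw [h1] at this; linarith) y

/-- The slices of the twisted family as maps of spheres. -/
def famC {N : ℝ} (hN : 1 ≤ N) (t : unitInterval) :
    C(Metric.sphere (0 : EuclideanSpace ℝ (Fin 6)) 1, S3) :=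
  ⟨fun x => ⟨fam N ((t : ℝ), (x : EuclideanSpace ℝ (Fin 6))), mem_S3 normSq_fam⟩, by
    refine Continuous.subtype_mk ((continuousOn_fam hN).comp_continuous
      (f := fun x : Metric.sphere (0 : EuclideanSpace ℝ (Fin 6)) 1 =>
        ((t : ℝ), (x : EuclideanSpace ℝ (Fin 6)))) (by fun_prop) fun x => ⟨t.2, ?_⟩) _
    change 7 / 10 < ‖(x : EuclideanSpace ℝ (Fin 6))‖ ^ 2
    rw [norm_eq_of_mem_sphere]
    norm_num⟩

theorem famC_homotopic {N : ℝ} (hN : 1 ≤ N) : (famC hN 0).Homotopic (famC hN 1) := by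
  refine ⟨⟨⟨fun q => ⟨fam N ((q.1 : ℝ), (q.2 : EuclideanSpace ℝ (Fin 6))), mem_S3 normSq_fam⟩, ?_⟩,
    fun x => rfl, fun x => rfl⟩⟩
  refine Continuous.subtype_mk ((continuousOn_fam hN).comp_continuous
    (f := fun q : unitInterval × Metric.sphere (0 : EuclideanSpace ℝ (Fin 6)) 1 =>
      ((q.1 : ℝ), (q.2 : EuclideanSpace ℝ (Fin 6)))) (by fun_prop) fun q => ⟨q.1.2, ?_⟩) _
  change 7 / 10 < ‖(q.2 : EuclideanSpace ℝ (Fin 6))‖ ^ 2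
  rw [norm_eq_of_mem_sphere]
  norm_num

/-- The slices of the straightening family as maps of spheres. -/
def strC (t : unitInterval) : C(Metric.sphere (0 : EuclideanSpace ℝ (Fin 6)) 1, S3) :=
  ⟨fun x => ⟨str ((t : ℝ), (x : EuclideanSpace ℝ (Fin 6))), mem_S3 normSq_str⟩,
    Continuous.subtype_mk (continuousOn_str.comp_continuous
      (f := fun x : Metric.sphere (0 : EuclideanSpace ℝ (Fin 6)) 1 =>
        ((t : ℝ), (x : EuclideanSpace ℝ (Fin 6)))) (by fun_prop)
        fun x => ⟨t.2, norm_eq_of_mem_sphere x⟩) _⟩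

theorem strC_homotopic : (strC 0).Homotopic (strC 1) :=
  ⟨⟨⟨fun q => ⟨str ((q.1 : ℝ), (q.2 : EuclideanSpace ℝ (Fin 6))), mem_S3 normSq_str⟩,
    Continuous.subtype_mk (continuousOn_str.comp_continuous
      (f := fun q : unitInterval × Metric.sphere (0 : EuclideanSpace ℝ (Fin 6)) 1 =>
        ((q.1 : ℝ), (q.2 : EuclideanSpace ℝ (Fin 6)))) (by fun_prop)
        fun q => ⟨q.1.2, norm_eq_of_mem_sphere q.2⟩) _⟩,
    fun x => rfl, fun x => rfl⟩⟩

theorem strC_collapse_homotopic : ((strC 1).comp collapse).Homotopic vv := by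
  have c1 : Continuous fun y : TTS => (y.1 : ℂ) := continuous_circle_coe.comp continuous_fst
  have c2 : Continuous fun y : TTS => (y.2.1 : ℂ) :=
    continuous_circle_coe.comp (continuous_fst.comp continuous_snd)
  let a : C(TTS, Metric.sphere (0 : ℂ) 1) := ⟨fun y => ⟨etaE 100 y y.1,
    mem_sphere_zero_iff_norm.2 (norm_etaE _ _ _)⟩,
    (continuous_etaE (by norm_num) c1 fun y => circle_sq y.1).subtype_mk _⟩
  let b : C(TTS, Metric.sphere (0 : ℂ) 1) := ⟨fun y => ⟨etaE 20 y y.2.1,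
    mem_sphere_zero_iff_norm.2 (norm_etaE _ _ _)⟩,
    (continuous_etaE le_rfl c2 fun y => circle_sq y.2.1).subtype_mk _⟩
  let x : C(TTS, S3) := ⟨fun y => ⟨etaC 20 100 y y.2.2, mem_S3 (normSq_etaC _ _ _ _)⟩,
    (continuous_etaC le_rfl (by norm_num)).subtype_mk _⟩
  let a' : C(TTS, Metric.sphere (0 : ℂ) 1) := ⟨fun y => ⟨(y.1 : ℂ),
    mem_sphere_zero_iff_norm.2 (norm_of_complex_sq (circle_sq _))⟩, c1.subtype_mk _⟩
  let b' : C(TTS, Metric.sphere (0 : ℂ) 1) := ⟨fun y => ⟨(y.2.1 : ℂ),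
    mem_sphere_zero_iff_norm.2 (norm_of_complex_sq (circle_sq _))⟩, c2.subtype_mk _⟩
  let x' : C(TTS, S3) := ⟨fun y => y.2.2, continuous_snd.comp continuous_snd⟩
  have e1 : (strC 1).comp collapse = comC a b x :=
    ContinuousMap.ext fun y => Subtype.ext (str_collapse y)
  have e2 : vv = comC a' b' x' := ContinuousMap.ext fun y => Subtype.ext rfl
  rw [e1, e2]
  exact homotopic_comC (fun y => etaE_ne_neg (by norm_num) _ y)
    (fun y => etaE_ne_neg (by norm_num) _ y)
    fun y => etaC_ne_neg (by norm_num) (by norm_num) _ y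

theorem not_nullhomotopic_famC {N : ℝ} (hN : 1 ≤ N) : ¬ (famC hN 1).Nullhomotopic := by
  intro h
  have e : famC hN 0 = strC 0 := ContinuousMap.ext fun x => Subtype.ext (fam_zero_eq_str _)
  have h1 : (strC 1).Homotopic (famC hN 1) :=
    strC_homotopic.symm.trans (e ▸ famC_homotopic hN)
  obtain ⟨y, hy⟩ := h
  obtain ⟨z, hz⟩ : ((strC 1).comp collapse).Nullhomotopic :=
    ContinuousMap.Nullhomotopic.comp_left ⟨y, h1.trans hy⟩ _
  exact not_nullhomotopic_vv ⟨z, strC_collapse_homotopic.symm.trans hz⟩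

end Twist

end Nontrivial

section Gram

variable {E F : Type*} [NormedAddCommGroup E] [InnerProductSpace ℝ E]
  [NormedAddCommGroup F] [InnerProductSpace ℝ F]

/-- Hadamard's inequality for the Gram determinant of three vectors. -/
theorem gram_three_le (x y z : F) :
    ⟪x, x⟫ * ⟪y, y⟫ * ⟪z, z⟫ + 2 * ⟪x, y⟫ * ⟪x, z⟫ * ⟪y, z⟫ - ⟪x, x⟫ * ⟪y, z⟫ ^ 2 -
      ⟪y, y⟫ * ⟪x, z⟫ ^ 2 - ⟪z, z⟫ * ⟪x, y⟫ ^ 2 ≤ ‖x‖ ^ 2 * ‖y‖ ^ 2 * ‖z‖ ^ 2 := by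
  have h : 0 ≤ ⟪⟪y, z⟫ • x - ⟪x, z⟫ • y, ⟪y, z⟫ • x - ⟪x, z⟫ • y⟫ := real_inner_self_nonneg
  simp only [inner_sub_left, inner_sub_right, real_inner_smul_left, real_inner_smul_right,
    real_inner_comm x y] at h
  have h2 : 0 ≤ ⟪z, z⟫ * ⟪x, y⟫ ^ 2 := mul_nonneg real_inner_self_nonneg (sq_nonneg _)
  simp only [← real_inner_self_eq_norm_sq]
  linarith

theorem gram_combination_le (u : Fin 3 → F) (c : Fin 3 → ℝ) (i : Fin 3) {m M : ℝ}
    (hM : ∀ j, ‖u j‖ ^ 2 ≤ M) (hm : ‖∑ k, c k • u k‖ ^ 2 ≤ m) :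
    c i ^ 2 * (Matrix.of fun (i j : Fin 3) => ⟪u i, u j⟫).det ≤ m * M ^ 2 := by
  have key : ∀ w y z : F, ‖w‖ ^ 2 ≤ m → ‖y‖ ^ 2 ≤ M → ‖z‖ ^ 2 ≤ M →
      ‖w‖ ^ 2 * ‖y‖ ^ 2 * ‖z‖ ^ 2 ≤ m * M ^ 2 := fun w y z hw hy hz => by
    rw [sq M, ← mul_assoc]
    have : 0 ≤ m := (sq_nonneg _).trans hw
    have : 0 ≤ M := (sq_nonneg _).trans hy
    gcongr
  rw [Fin.sum_univ_three] at hm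
  have e10 := real_inner_comm (u 0) (u 1)
  have e20 := real_inner_comm (u 0) (u 2)
  have e21 := real_inner_comm (u 1) (u 2)
  fin_cases i
  · refine le_trans (le_of_eq ?_) ((gram_three_le (c 0 • u 0 + c 1 • u 1 + c 2 • u 2) (u 1) (u 2)).trans
      (key _ _ _ hm (hM 1) (hM 2)))
    simp only [Matrix.det_fin_three, Matrix.of_apply, inner_add_left, inner_add_right,
      real_inner_smul_left, real_inner_smul_right, e10, e20, e21, Fin.zero_eta]
    ring
  · refine le_trans (le_of_eq ?_) ((gram_three_le (c 0 • u 0 + c 1 • u 1 + c 2 • u 2) (u 0) (u 2)).trans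
      (key _ _ _ hm (hM 0) (hM 2)))
    simp only [Matrix.det_fin_three, Matrix.of_apply, inner_add_left, inner_add_right,
      real_inner_smul_left, real_inner_smul_right, e10, e20, e21, Fin.mk_one]
    ring
  · refine le_trans (le_of_eq ?_) ((gram_three_le (c 0 • u 0 + c 1 • u 1 + c 2 • u 2) (u 0) (u 1)).trans
      (key _ _ _ hm (hM 0) (hM 1)))
    simp only [Matrix.det_fin_three, Matrix.of_apply, inner_add_left, inner_add_right,
      real_inner_smul_left, real_inner_smul_right, e10, e20, e21, Fin.reduceFinMk]
    ring

/-- A linear map which is small on the kernel of a map of rank at most two contracts volumes of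
three-frames. -/
theorem lamNorm_three_le (A : E →ₗ[ℝ] F) (H : E →ₗ[ℝ] (Fin 3 → ℝ)) {η : Fin 3 → ℝ} (hη : η ≠ 0)
    (hH : ∀ v, H v ⬝ᵥ η = 0) {m M : ℝ} (h0 : 0 ≤ m) (hM : ∀ v, ‖A v‖ ≤ M * ‖v‖)
    (hm : ∀ v, H v = 0 → ‖A v‖ ≤ m * ‖v‖) : lamNorm 3 A ≤ 2 * m * M ^ 2 := by
  refine Real.iSup_le (fun ⟨v, hv⟩ => ?_) (by positivity)
  refine Real.sqrt_le_iff.2 ⟨by positivity, ?_⟩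
  have hdet : (Matrix.of fun i => H (v i)).det = 0 := by
    rw [← Matrix.exists_mulVec_eq_zero_iff]
    exact ⟨η, hη, funext fun i => hH (v i)⟩
  obtain ⟨c, hc, hc'⟩ := Matrix.exists_vecMul_eq_zero_iff.2 hdet
  have hw : H (∑ k, c k • v k) = 0 := by
    rw [map_sum, ← hc']
    ext j
    simp [Matrix.vecMul, dotProduct]
  obtain ⟨i, hi⟩ := Finite.exists_max fun i => c i ^ 2
  have hpos : 0 < c i ^ 2 := by
    obtain ⟨k, hk⟩ := Function.ne_iff.1 hc
    exact lt_of_lt_of_le (by have : c k ≠ 0 := hk; positivity) (hi k)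
  have hnorm : ‖∑ k, c k • v k‖ ^ 2 ≤ 3 * c i ^ 2 := by
    rw [← real_inner_self_eq_norm_sq, hv.inner_sum, Fin.sum_univ_three]
    have := hi 0
    have := hi 1
    have := hi 2
    simp only [conj_trivial]
    linarith
  have h2 := gram_combination_le (fun k => A (v k)) c i (m := m ^ 2 * (3 * c i ^ 2)) (M := M ^ 2)
    (fun j => by
      have := hM (v j)
      rw [hv.1 j, mul_one] at this
      gcongr) (by
      have := hm _ hw
      rw [map_sum] at this
      simp only [map_smul] at this
      calc _ ≤ (m * ‖∑ k, c k • v k‖) ^ 2 := by gcongr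
        _ = m ^ 2 * ‖∑ k, c k • v k‖ ^ 2 := by ring
        _ ≤ _ := by gcongr)
  refine le_of_mul_le_mul_left (h2.trans ?_) hpos
  have : 0 ≤ c i ^ 2 * (m ^ 2 * M ^ 4) := by positivity
  nlinarith

end Gram

section Rank

open Quaternion Topology Filter

namespace TTS

/-- The Hopf map to the sphere of radius one half. -/
def hopf (q : Quaternion ℝ) : Fin 3 → ℝ :=
  ![q.re ^ 2 + q.imI ^ 2 - 1 / 2, q.re * q.imJ - q.imI * q.imK, q.re * q.imK + q.imI * q.imJ]

theorem hopf_dot {q : Quaternion ℝ} (h : normSq q = 1) : hopf q ⬝ᵥ hopf q = 1 / 4 := by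
  rw [normSq_def'] at h
  simp only [hopf, dotProduct, Fin.sum_univ_three, Matrix.cons_val]
  linear_combination (q.re ^ 2 + q.imI ^ 2) * h

/-- The commutator as a function of the image under the Hopf map. -/
def cmix (w : ℂ) (u : Fin 3 → ℝ) : Quaternion ℝ :=
  hq (u 0 + 1 / 2 + (1 / 2 - u 0) * w.re) ((1 / 2 - u 0) * w.im)
    ((w.re - 1) * u 1 - w.im * u 2) ((w.re - 1) * u 2 + w.im * u 1)

theorem com_eq_cmix (w : ℂ) {q : Quaternion ℝ} (h : normSq q = 1) : com w q = cmix w (hopf q) := by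
  rw [normSq_def'] at h
  refine QuaternionAlgebra.ext ?_ ?_ ?_ ?_ <;> simp [com, rot, cmix, hopf]
  · linear_combination w.re * h
  · linear_combination w.im * h
  · ring
  · ring

theorem contDiff_hopf {n : WithTop ℕ∞} : ContDiff ℝ n hopf := by
  have h0 : ContDiff ℝ n fun q : Quaternion ℝ => q.re := contDiff_coord 0
  have h1 : ContDiff ℝ n fun q : Quaternion ℝ => q.imI := contDiff_coord 1
  have h2 : ContDiff ℝ n fun q : Quaternion ℝ => q.imJ := contDiff_coord 2
  have h3 : ContDiff ℝ n fun q : Quaternion ℝ => q.imK := contDiff_coord 3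
  refine contDiff_pi.2 fun i => ?_
  fin_cases i
  · exact ((h0.pow 2).add (h1.pow 2)).sub contDiff_const
  · exact (h0.mul h2).sub (h1.mul h3)
  · exact (h0.mul h3).add (h1.mul h2)

theorem contDiff_cmix {n : ℕ∞} :
    ContDiff ℝ n fun p : ℝ × (Fin 3 → ℝ) => cmix (colE p.1) p.2 := by
  refine contDiff_iff_contDiffAt.2 fun p => ?_
  have hE : ContDiffAt ℝ n (fun p : ℝ × (Fin 3 → ℝ) => colE p.1) p := contDiffAt_colE contDiffAt_fst
  have hr : ContDiffAt ℝ n (fun p : ℝ × (Fin 3 → ℝ) => (colE p.1).re) p :=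
    Complex.reCLM.contDiff.contDiffAt.comp p hE
  have hi : ContDiffAt ℝ n (fun p : ℝ × (Fin 3 → ℝ) => (colE p.1).im) p :=
    Complex.imCLM.contDiff.contDiffAt.comp p hE
  have hu : ∀ i, ContDiffAt ℝ n (fun p : ℝ × (Fin 3 → ℝ) => p.2 i) p :=
    contDiffAt_pi.1 contDiffAt_snd
  exact contDiffAt_hq (((hu 0).add contDiffAt_const).add ((contDiffAt_const.sub (hu 0)).mul hr))
    ((contDiffAt_const.sub (hu 0)).mul hi)
    (((hr.sub contDiffAt_const).mul (hu 1)).sub (hi.mul (hu 2)))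
    (((hr.sub contDiffAt_const).mul (hu 2)).add (hi.mul (hu 1)))

/-- The collapse to the source of the inner Hopf map. -/
def qG (q : ℝ × ℝ × ℝ × ℝ) : Quaternion ℝ := colG q.1 q.2.1 q.2.2.1 q.2.2.2

/-- The iterated commutator of collapses, as a function on a product. -/
def qF (q : ℝ × ℝ × ℝ × ℝ × ℝ) : Quaternion ℝ := com (colE q.1) (qG q.2)

theorem contDiff_qG {n : ℕ∞} : ContDiff ℝ n qG :=
  contDiff_iff_contDiffAt.2 fun _ => contDiffAt_colG contDiffAt_fst contDiffAt_snd.fst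
    contDiffAt_snd.snd.fst contDiffAt_snd.snd.snd

theorem contDiff_qF {n : ℕ∞} : ContDiff ℝ n qF :=
  contDiff_iff_contDiffAt.2 fun _ => contDiffAt_com (contDiffAt_colE contDiffAt_fst)
    (contDiff_qG.contDiffAt.comp _ contDiffAt_snd)

theorem normSq_qG (q : ℝ × ℝ × ℝ × ℝ) : normSq (qG q) = 1 := normSq_colG _ _ _ _

/-- The derivative of the Hopf coordinates of `qG`. -/
def dH (q : ℝ × ℝ × ℝ × ℝ) : (ℝ × ℝ × ℝ × ℝ) →L[ℝ] (Fin 3 → ℝ) := fderiv ℝ (fun q => hopf (qG q)) q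

theorem hasFDerivAt_hopf_qG (q : ℝ × ℝ × ℝ × ℝ) : HasFDerivAt (fun q => hopf (qG q)) (dH q) q :=
  (((contDiff_hopf (n := 1)).comp (contDiff_qG (n := 1))).differentiable one_ne_zero q).hasFDerivAt

theorem dH_dot (q v : ℝ × ℝ × ℝ × ℝ) : dH q v ⬝ᵥ hopf (qG q) = 0 := by
  have h := hasFDerivAt_pi'.1 (hasFDerivAt_hopf_qG q)
  have h1 := ((h 0).mul (h 0)).add (((h 1).mul (h 1)).add ((h 2).mul (h 2)))
  have h2 : HasFDerivAt (fun q => hopf (qG q) 0 * hopf (qG q) 0 + (hopf (qG q) 1 * hopf (qG q) 1 +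
      hopf (qG q) 2 * hopf (qG q) 2)) (0 : (ℝ × ℝ × ℝ × ℝ) →L[ℝ] ℝ) q := by
    have : (fun q => hopf (qG q) 0 * hopf (qG q) 0 + (hopf (qG q) 1 * hopf (qG q) 1 +
        hopf (qG q) 2 * hopf (qG q) 2)) = fun _ => (1 / 4 : ℝ) := funext fun q => by
      rw [← hopf_dot (normSq_qG q), dotProduct, Fin.sum_univ_three, add_assoc]
    rw [this]
    exact hasFDerivAt_const _ _
  have h3 := DFunLike.congr_fun (h1.unique h2) v
  simp at h3
  rw [dotProduct, Fin.sum_univ_three]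
  linarith

theorem fderiv_qF_of_dH_eq_zero (q v : ℝ × ℝ × ℝ × ℝ × ℝ) (h : dH q.2 v.2 = 0) :
    fderiv ℝ qF q v = fderiv ℝ qF q (v.1, 0) := by
  have e : qF = (fun p : ℝ × (Fin 3 → ℝ) => cmix (colE p.1) p.2) ∘
      fun q : ℝ × ℝ × ℝ × ℝ × ℝ => (q.1, hopf (qG q.2)) :=
    funext fun q => com_eq_cmix _ (normSq_qG _)
  have h1 : HasFDerivAt (fun q : ℝ × ℝ × ℝ × ℝ × ℝ => (q.1, hopf (qG q.2)))
      ((ContinuousLinearMap.fst ℝ ℝ (ℝ × ℝ × ℝ × ℝ)).prod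
        (dH q.2 ∘L ContinuousLinearMap.snd ℝ ℝ (ℝ × ℝ × ℝ × ℝ))) q :=
    hasFDerivAt_fst.prodMk ((hasFDerivAt_hopf_qG q.2).comp q hasFDerivAt_snd)
  have h2 := (((contDiff_cmix (n := 1)).differentiable one_ne_zero
    (q.1, hopf (qG q.2))).hasFDerivAt).comp q h1
  rw [← e] at h2
  rw [h2.fderiv]
  simp [h]

theorem hopf_ne_zero {q : Quaternion ℝ} (h : normSq q = 1) : hopf q ≠ 0 := fun h0 => by
  have := hopf_dot h
  rw [h0, zero_dotProduct] at this
  norm_num at this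

theorem exists_fderiv_qF_le : ∃ C : ℝ, 0 ≤ C ∧ ∀ q : ℝ × ℝ × ℝ × ℝ × ℝ, ‖q‖ ≤ 1 →
    ‖fderiv ℝ qF q‖ ≤ C := by
  obtain ⟨C, hC⟩ := (isCompact_closedBall (0 : ℝ × ℝ × ℝ × ℝ × ℝ) 1).exists_bound_of_continuousOn
    ((contDiff_qF (n := 1)).continuous_fderiv one_ne_zero).continuousOn
  exact ⟨C, (norm_nonneg _).trans (hC 0 (by simp)), fun q hq => hC q (by simpa using hq)⟩

end TTS

end Rank

section Angles

open Quaternion Topology Filter TTS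

namespace Twist

theorem norm_zc_le (j : Fin 3) (x : EuclideanSpace ℝ (Fin 6)) : ‖zc j x‖ ≤ ‖x‖ := by
  refine le_of_sq_le_sq ?_ (norm_nonneg _)
  rw [norm_sq_eq, ← Complex.normSq_eq_norm_sq]
  have h : ∀ j, 0 ≤ rc j x := fun j => Complex.normSq_nonneg _
  have h0 := h 0
  have h1 := h 1
  have h2 := h 2
  fin_cases j <;> simp only [rc] at * <;> simp <;> linarith

/-- The derivative of the argument of a coordinate. -/
def dang (j : Fin 3) (a : EuclideanSpace ℝ (Fin 6)) : EuclideanSpace ℝ (Fin 6) →L[ℝ] ℝ :=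
  Complex.imCLM ∘L ((zc j a)⁻¹ • zc j)

theorem abs_dang_le {j : Fin 3} {a : EuclideanSpace ℝ (Fin 6)} (h : 17 / 100 ≤ rc j a)
    (v : EuclideanSpace ℝ (Fin 6)) : |dang j a v| ≤ 3 * ‖v‖ := by
  have h1 : 1 / 3 ≤ ‖zc j a‖ := by
    rw [rc, Complex.normSq_eq_norm_sq] at h
    nlinarith [norm_nonneg (zc j a)]
  have h2 : ‖zc j a‖⁻¹ ≤ 3 := by
    rw [inv_le_comm₀ (by linarith) (by norm_num)]
    linarith
  calc |dang j a v| ≤ ‖(zc j a)⁻¹ * zc j v‖ := Complex.abs_im_le_norm _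
    _ = ‖zc j a‖⁻¹ * ‖zc j v‖ := by rw [norm_mul, norm_inv]
    _ ≤ 3 * ‖v‖ := by
      have := norm_zc_le j v
      gcongr

/-- A twisted argument plus the twist has the derivative of the argument. -/
theorem hasFDerivAt_arg_unw {b : EuclideanSpace ℝ (Fin 6) → ℝ} {b' : EuclideanSpace ℝ (Fin 6) →L[ℝ] ℝ}
    {a : EuclideanSpace ℝ (Fin 6)} (j : Fin 3) (hb : HasFDerivAt b b' a)
    (h : 0 < (unw (zc j a) (b a)).re) :
    HasFDerivAt (fun x => (unw (zc j x) (b x)).arg + b x) (dang j a) a := by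
  have hz : zc j a ≠ 0 := fun h0 => by simp [unw, h0] at h
  have h1 : HasFDerivAt (fun x => (b x : ℂ)) (Complex.ofRealCLM ∘L b') a :=
    Complex.ofRealCLM.hasFDerivAt.comp a hb
  have h2 := ((zc j).hasFDerivAt (x := a)).mul ((h1.neg.mul_const Complex.I).cexp)
  have h3 := (Complex.hasStrictDerivAt_log (Or.inl h :
    unw (zc j a) (b a) ∈ Complex.slitPlane)).hasDerivAt.complexToReal_fderiv
  have h4 := (Complex.imCLM.hasFDerivAt.comp a (h3.comp a h2)).add hb
  refine (h4.congr_fderiv ?_).congr_of_eventuallyEq (Eventually.of_forall fun x => ?_)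
  · ext v
    have he := Complex.exp_ne_zero (-(b a : ℂ) * Complex.I)
    have key : (zc j a * Complex.exp (-(b a : ℂ) * Complex.I))⁻¹ *
        (zc j a * (Complex.exp (-(b a : ℂ) * Complex.I) * (Complex.I * -(b' v : ℂ))) +
          Complex.exp (-(b a : ℂ) * Complex.I) * zc j v) =
        (zc j a)⁻¹ * zc j v - b' v * Complex.I := by
      field_simp
      ring
    have key2 := congrArg Complex.im key
    rw [Complex.sub_im, Complex.im_ofReal_mul, Complex.I_im, mul_one] at key2
    refine eq_sub_iff_add_eq.1 (Eq.trans (congrArg Complex.im ?_) key2)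
    change (unw (zc j a) (b a))⁻¹ * (zc j a * (Complex.exp (-(b a : ℂ) * Complex.I) *
      (Complex.I * -(b' v : ℂ))) + Complex.exp (-(b a : ℂ) * Complex.I) * zc j v) = _
    rw [unw]
  · simp [unw, Complex.log_im]

/-- The collapse coordinates at the end of the twisted family. -/
def pt (N : ℝ) (x : EuclideanSpace ℝ (Fin 6)) : ℝ × ℝ × ℝ × ℝ × ℝ :=
  (sl N (1, x), (w0 N (1, x)).arg, (w1 N (1, x)).arg, (w2 N (1, x)).arg, rh x)

theorem core_eq_qF (N : ℝ) (x : EuclideanSpace ℝ (Fin 6)) : core N (1, x) = qF (pt N x) := rfl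

/-- The derivative of `pt`. -/
def dpt (N : ℝ) (a : EuclideanSpace ℝ (Fin 6)) : EuclideanSpace ℝ (Fin 6) →L[ℝ] ℝ × ℝ × ℝ × ℝ × ℝ :=
  ((N ^ 3)⁻¹ • dang 2 a).prod ((dang 0 a - N • fderiv ℝ ph a).prod ((dang 1 a - N • dang 0 a).prod
    ((dang 2 a - N • dang 1 a).prod (fderiv ℝ rh a))))

theorem hasFDerivAt_pt {N : ℝ} (hN : 1 ≤ N) {a : EuclideanSpace ℝ (Fin 6)} (h : grd N (1, a)) :
    HasFDerivAt (pt N) (dpt N a) a := by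
  have hph : HasFDerivAt ph (fderiv ℝ ph a) a :=
    ((contDiff_ph (n := 1)).differentiable one_ne_zero a).hasFDerivAt
  have hrh : HasFDerivAt rh (fderiv ℝ rh a) a :=
    ((contDiff_rh (n := 1)).differentiable one_ne_zero a).hasFDerivAt
  have h0 : HasFDerivAt (fun x => t0 N (1, x)) (dang 0 a) a :=
    hasFDerivAt_arg_unw 0 (hph.const_mul (1 * N)) h.1
  have h1 : HasFDerivAt (fun x => t1 N (1, x)) (dang 1 a) a :=
    hasFDerivAt_arg_unw 1 (h0.const_mul (1 * N)) h.2.1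
  have h2 : HasFDerivAt (fun x => (w2 N (1, x)).arg + 1 * N * t1 N (1, x)) (dang 2 a) a :=
    hasFDerivAt_arg_unw 2 (h1.const_mul (1 * N)) h.2.2
  have h3 := (h2.const_mul (N ^ 3)⁻¹).prodMk ((h0.sub (hph.const_mul N)).prodMk
    ((h1.sub (h0.const_mul N)).prodMk ((h2.sub (h1.const_mul N)).prodMk hrh)))
  have hN0 : N ≠ 0 := by positivity
  refine h3.congr_of_eventuallyEq (Eventually.of_forall fun x => ?_)
  have e1 : sl N (1, x) = (N ^ 3)⁻¹ * ((w2 N (1, x)).arg + 1 * N * t1 N (1, x)) := by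
    simp only [sl, t1, t0]
    field_simp
    ring
  refine Prod.ext e1 (Prod.ext ?_ (Prod.ext ?_ (Prod.ext ?_ rfl))) <;> simp [pt, t0, t1]

theorem exists_dpt_le : ∃ C : ℝ, 0 ≤ C ∧ ∀ (N : ℝ) (a : EuclideanSpace ℝ (Fin 6)), 1 ≤ N → ‖a‖ = 1 →
    (∀ j, 17 / 100 ≤ rc j a) → ∀ v, |(dpt N a v).1| ≤ C / N ^ 3 * ‖v‖ ∧ ‖dpt N a v‖ ≤ C * N * ‖v‖ := by
  obtain ⟨C, hC⟩ := (isCompact_sphere (0 : EuclideanSpace ℝ (Fin 6)) 1).exists_bound_of_continuousOn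
    ((contDiff_ph (n := 1)).continuous_fderiv one_ne_zero).continuousOn
  obtain ⟨D, hD⟩ := (isCompact_sphere (0 : EuclideanSpace ℝ (Fin 6)) 1).exists_bound_of_continuousOn
    ((contDiff_rh (n := 1)).continuous_fderiv one_ne_zero).continuousOn
  refine ⟨6 + |C| + |D|, by positivity, fun N a hN ha hr v => ?_⟩
  have hN0 : 0 < N := by positivity
  have hN3 : 1 ≤ N ^ 3 := one_le_pow₀ hN
  have hd : ∀ j, |dang j a v| ≤ 3 * ‖v‖ := fun j => abs_dang_le (hr j) v
  have hc : |fderiv ℝ ph a v| ≤ |C| * ‖v‖ := ((fderiv ℝ ph a).le_opNorm v).trans (by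
    have := (hC a (by simpa using ha)).trans (le_abs_self C)
    gcongr)
  have hd' : |fderiv ℝ rh a v| ≤ |D| * ‖v‖ := ((fderiv ℝ rh a).le_opNorm v).trans (by
    have := (hD a (by simpa using ha)).trans (le_abs_self D)
    gcongr)
  have hv := norm_nonneg v
  have hC0 : 0 ≤ |C| * ‖v‖ := by positivity
  have hD0 : 0 ≤ |D| * ‖v‖ := by positivity
  have hs : |(dpt N a v).1| ≤ (6 + |C| + |D|) / N ^ 3 * ‖v‖ := by
    change |(N ^ 3)⁻¹ * dang 2 a v| ≤ _
    rw [abs_mul, abs_of_pos (by positivity), div_eq_inv_mul, mul_assoc]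
    have := hd 2
    gcongr
    linarith
  have hsub : ∀ p q B : ℝ, |p| ≤ 3 * ‖v‖ → |q| ≤ B → |p - N * q| ≤ N * (3 * ‖v‖ + B) := by
    intro p q B hp hq
    refine (abs_sub _ _).trans ?_
    rw [abs_mul, abs_of_pos hN0, mul_add]
    gcongr
    nlinarith
  refine ⟨hs, ?_⟩
  have hfin : ∀ t B : ℝ, |t| ≤ N * B → B ≤ (6 + |C| + |D|) * ‖v‖ → |t| ≤ (6 + |C| + |D|) * N * ‖v‖ :=
    fun t B ht hB => by
      refine ht.trans ?_
      rw [mul_comm _ N, mul_assoc]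
      gcongr
  have b1 := hfin _ _ (hsub _ _ _ (hd 0) hc) (by linarith)
  have b2 := hfin _ _ (hsub _ _ _ (hd 1) (hd 0)) (by linarith)
  have b3 := hfin _ _ (hsub _ _ _ (hd 2) (hd 1)) (by linarith)
  have b4 : |fderiv ℝ rh a v| ≤ (6 + |C| + |D|) * N * ‖v‖ := by
    refine hfin _ (|D| * ‖v‖) (hd'.trans (le_mul_of_one_le_left hD0 hN)) (by linarith)
  have b0 : |(dpt N a v).1| ≤ (6 + |C| + |D|) * N * ‖v‖ := by
    refine hs.trans ?_
    have : (6 + |C| + |D|) / N ^ 3 ≤ (6 + |C| + |D|) * N :=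
      (div_le_self (by positivity) hN3).trans (le_mul_of_one_le_right (by positivity) hN)
    gcongr
  exact max_le b0 (max_le b1 (max_le b2 (max_le b3 b4)))

theorem grd_of_frequently {N : ℝ} (hN : 1 ≤ N) {a : EuclideanSpace ℝ (Fin 6)} (ha : ‖a‖ = 1)
    (h : ∃ᶠ x in 𝓝 a, fam N (1, x) ≠ 1) :
    grd N (1, a) ∧ (∀ j, 17 / 100 ≤ rc j a) ∧ ‖pt N a‖ ≤ 1 := by
  have hgood : ∀ᶠ x in 𝓝 a, Good (1, x) := by
    have : ∀ᶠ x in 𝓝 a, 7 / 10 < ‖x‖ ^ 2 :=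
      (Continuous.continuousAt (f := fun x : EuclideanSpace ℝ (Fin 6) => ‖x‖ ^ 2)
        (by fun_prop)).eventually (lt_mem_nhds (by norm_num [ha]))
    filter_upwards [this] with x hx
    exact ⟨by simp, hx⟩
  have hf : ∃ᶠ x in 𝓝 a, Good (1, x) ∧ fam N (1, x) ≠ 1 :=
    (h.and_eventually hgood).mono fun x hx => ⟨hx.2, hx.1⟩
  have hg : grd N (1, a) := by
    rcases fam_dichotomy hN (1, a) with h1 | h1
    · have h2 : ∀ᶠ x in 𝓝 a, Good (1, x) → fam N (1, x) = 1 :=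
        (Continuous.continuousAt (f := fun x : EuclideanSpace ℝ (Fin 6) => ((1 : ℝ), x))
          (by fun_prop)).eventually h1
      obtain ⟨x, hx, hx'⟩ := (hf.and_eventually h2).exists
      exact absurd (hx' hx.1) hx.2
    · exact h1
  refine ⟨hg, fun j => ?_, ?_⟩
  · exact ge_of_tendsto_of_frequently ((contDiff_rc (n := 0) j).continuous.continuousAt)
      (hf.mono fun x hx => (fam_ne_one hN hx.1 hx.2).2.2.1 j)
  · refine le_of_tendsto_of_frequently ((hasFDerivAt_pt hN hg).continuousAt.norm)
      (hf.mono fun x hx => ?_)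
    obtain ⟨h0, h1, h2, h3, h4⟩ := colF_ne_one (fam_ne_one hN hx.1 hx.2).2.1
    simp only [pt, Prod.norm_mk, Real.norm_eq_abs]
    exact max_le h0.le (max_le h1.le (max_le h2.le (max_le h3.le h4.le)))

end Twist

end Angles

section Dilation

open Quaternion Topology Filter TTS

namespace Twist

/-- The final twisted map, cut off near the origin. -/
def cut (N : ℝ) (z : EuclideanSpace ℝ (Fin 6)) : Quaternion ℝ :=
  1 + Real.smoothTransition (10 * ‖z‖ ^ 2 - 8) • (fam N (1, z) - 1)

/-- The final twisted map, in Euclidean coordinates. -/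
def fin6 (N : ℝ) (z : EucA 6) : EucA 4 := linearIsometryEquivTuple (cut N z)

theorem eventually_lt_norm_sq {c : ℝ} {a : EuclideanSpace ℝ (Fin 6)} (h : c < ‖a‖ ^ 2) :
    ∀ᶠ x in 𝓝 a, c < ‖x‖ ^ 2 :=
  (Continuous.continuousAt (f := fun x : EuclideanSpace ℝ (Fin 6) => ‖x‖ ^ 2)
    (by fun_prop)).eventually (lt_mem_nhds h)

theorem cut_eq_fam {N : ℝ} {z : EuclideanSpace ℝ (Fin 6)} (h : 9 / 10 < ‖z‖ ^ 2) :
    cut N z = fam N (1, z) := by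
  rw [cut, Real.smoothTransition.one_of_one_le (by linarith), one_smul, add_sub_cancel]

theorem contDiff_cut {N : ℝ} (hN : 1 ≤ N) : ContDiff ℝ 1 (cut N) := by
  refine contDiff_iff_contDiffAt.2 fun a => ?_
  rcases lt_or_ge (‖a‖ ^ 2) (8 / 10) with h | h
  · have h1 : ∀ᶠ x in 𝓝 a, ‖x‖ ^ 2 < 8 / 10 :=
      (Continuous.continuousAt (f := fun x : EuclideanSpace ℝ (Fin 6) => ‖x‖ ^ 2)
        (by fun_prop)).eventually (gt_mem_nhds h)
    refine (contDiffAt_const (c := (1 : Quaternion ℝ))).congr_of_eventuallyEq ?_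
    filter_upwards [h1] with x hx
    rw [cut, Real.smoothTransition.zero_of_nonpos (by linarith), zero_smul, add_zero]
  · have hg : ∀ᶠ x in 𝓝 a, Good (1, x) :=
      (eventually_lt_norm_sq (c := 7 / 10) (by linarith)).mono fun x hx => ⟨by simp, hx⟩
    rcases fam_dichotomy hN (1, a) with h1 | h1
    · have h2 : ∀ᶠ x in 𝓝 a, Good (1, x) → fam N (1, x) = 1 :=
        (Continuous.continuousAt (f := fun x : EuclideanSpace ℝ (Fin 6) => ((1 : ℝ), x))
          (by fun_prop)).eventually h1
      refine (contDiffAt_const (c := (1 : Quaternion ℝ))).congr_of_eventuallyEq ?_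
      filter_upwards [hg, h2] with x hx hx'
      rw [cut, hx' hx, sub_self, smul_zero, add_zero]
    · have h2 : ContDiffAt ℝ 1 (fun x : EuclideanSpace ℝ (Fin 6) => fam N (1, x)) a :=
        (contDiffAt_fam (n := 1) h1).comp a (contDiffAt_const.prodMk contDiffAt_id)
      have h3 : ContDiffAt ℝ 1 (fun x : EuclideanSpace ℝ (Fin 6) =>
          Real.smoothTransition (10 * ‖x‖ ^ 2 - 8)) a :=
        Real.smoothTransition.contDiff.contDiffAt.comp a
          ((contDiffAt_const.mul (contDiff_norm_sq ℝ).contDiffAt).sub contDiffAt_const)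
      exact contDiffAt_const.add (h3.smul (h2.sub contDiffAt_const))

theorem fin6_eq {N : ℝ} {z : EucA 6} (hz : z ∈ usph 6) :
    fin6 N z = linearIsometryEquivTuple (fam N (1, z)) := by
  rw [fin6, cut_eq_fam]
  rw [mem_sphere_zero_iff_norm.1 hz]
  norm_num

theorem mapsTo_fin6 {N : ℝ} : MapsTo (fin6 N) (usph 6) (usph 4) := fun z hz => by
  rw [fin6_eq hz]
  refine mem_sphere_zero_iff_norm.2 ?_
  rw [LinearIsometryEquiv.norm_map]
  exact norm_of_normSq normSq_fam

theorem not_sphereNullhomotopic_fin6 {N : ℝ} (hN : 1 ≤ N) : ¬ SphereNullhomotopic (fin6 N) := by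
  rintro ⟨y, hy, H, hc, hm, h0, h1⟩
  have hS : ∀ w : EucA 4, w ∈ usph 4 → linearIsometryEquivTuple.symm w ∈ S3 := fun w hw =>
    mem_S3 (normSq_of_norm (by
      rw [LinearIsometryEquiv.norm_map]; exact mem_sphere_zero_iff_norm.1 hw))
  refine not_nullhomotopic_famC hN ⟨⟨linearIsometryEquivTuple.symm y, hS y hy⟩, ⟨⟨⟨fun q =>
    ⟨linearIsometryEquivTuple.symm (H q.1 q.2), hS _ (hm q.1 q.1.2 q.2.2)⟩, ?_⟩, fun x => ?_,
    fun x => ?_⟩⟩⟩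
  · refine Continuous.subtype_mk (linearIsometryEquivTuple.symm.continuous.comp
      (hc.comp_continuous (f := fun q : unitInterval × Metric.sphere (0 : EuclideanSpace ℝ (Fin 6)) 1 =>
        ((q.1 : ℝ), (q.2 : EucA 6))) (by fun_prop) fun q => ⟨q.1.2, q.2.2⟩)) _
  · refine Subtype.ext ?_
    change linearIsometryEquivTuple.symm (H 0 x) = fam N (1, x)
    rw [h0 x.2, fin6_eq x.2, LinearIsometryEquiv.symm_apply_apply]
  · refine Subtype.ext ?_
    change linearIsometryEquivTuple.symm (H 1 x) = linearIsometryEquivTuple.symm y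
    rw [h1 x.2]

theorem exists_kDilation_le : ∃ C : ℝ, 0 ≤ C ∧ ∀ N : ℝ, 1 ≤ N → kDilation 3 (fin6 N) ≤ C / N := by
  obtain ⟨C, hC0, hC⟩ := exists_fderiv_qF_le
  obtain ⟨D, hD0, hD⟩ := exists_dpt_le
  refine ⟨2 * (C * D) ^ 3, by positivity, fun N hN => ?_⟩
  have hN0 : 0 < N := by positivity
  refine Real.iSup_le (fun ⟨a, ha⟩ => ?_) (by positivity)
  have e : 2 * (C * D) ^ 3 / N = 2 * (C * D / N ^ 3) * (C * D * N) ^ 2 := by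
    field_simp
  rw [e]
  have ha' : ‖a‖ = 1 := mem_sphere_zero_iff_norm.1 ha
  have hcut : ∀ᶠ x in 𝓝 a, cut N x = fam N (1, x) :=
    (eventually_lt_norm_sq (c := 9 / 10) (by norm_num [ha'])).mono fun x hx => cut_eq_fam hx
  by_cases h : ∃ᶠ x in 𝓝 a, fam N (1, x) ≠ 1
  · obtain ⟨hg, hr, hp⟩ := grd_of_frequently hN ha' h
    have hev : fin6 N =ᶠ[𝓝 a] linearIsometryEquivTuple ∘ qF ∘ pt N := by
      have h1 : ∀ᶠ x in 𝓝 a, fam N (1, x) = core N (1, x) :=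
        (Continuous.continuousAt (f := fun x : EuclideanSpace ℝ (Fin 6) => ((1 : ℝ), x))
          (by fun_prop)).eventually (fam_eventuallyEq hg)
      filter_upwards [hcut, h1] with x hx hx'
      rw [fin6, hx, hx', core_eq_qF]
      rfl
    have hq : HasFDerivAt qF (fderiv ℝ qF (pt N a)) (pt N a) :=
      ((contDiff_qF (n := 1)).differentiable one_ne_zero _).hasFDerivAt
    have hF := ((linearIsometryEquivTuple.toContinuousLinearEquiv.hasFDerivAt.comp a
      (hq.comp a (hasFDerivAt_pt hN hg))).congr_of_eventuallyEq hev).fderiv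
    have hnorm : ∀ v, ‖fderiv ℝ (fin6 N) a v‖ = ‖fderiv ℝ qF (pt N a) (dpt N a v)‖ := fun v => by
      rw [hF]
      exact linearIsometryEquivTuple.norm_map (fderiv ℝ qF (pt N a) (dpt N a v))
    refine lamNorm_three_le _ ((dH (pt N a).2 ∘L ContinuousLinearMap.snd ℝ ℝ (ℝ × ℝ × ℝ × ℝ) ∘L
      dpt N a).toLinearMap ∘ₗ ((ℝ ∙ a)ᗮ).subtype) (hopf_ne_zero (normSq_qG (pt N a).2))
      (fun v => dH_dot _ _) (by positivity) (fun v => ?_) fun v hv => ?_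
    · change ‖fderiv ℝ (fin6 N) a v‖ ≤ _ * ‖(v : EucA 6)‖
      rw [hnorm]
      calc _ ≤ C * (D * N * ‖(v : EucA 6)‖) :=
            ((fderiv ℝ qF (pt N a)).le_opNorm _).trans (by
              have := hC _ hp
              have := (hD N a hN ha' hr v).2
              gcongr)
        _ = _ := by ring
    · change ‖fderiv ℝ (fin6 N) a v‖ ≤ _ * ‖(v : EucA 6)‖
      rw [hnorm, fderiv_qF_of_dH_eq_zero _ (dpt N a (v : EucA 6)) hv]
      calc _ ≤ C * (D / N ^ 3 * ‖(v : EucA 6)‖) :=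
            ((fderiv ℝ qF (pt N a)).le_opNorm _).trans (by
              have := hC _ hp
              have h2 := (hD N a hN ha' hr v).1
              have h3 : ‖((dpt N a v).1, (0 : ℝ × ℝ × ℝ × ℝ))‖ = |(dpt N a v).1| := by
                simp [Prod.norm_def]
              rw [h3]
              gcongr)
        _ = _ := by ring
  · have hev : fin6 N =ᶠ[𝓝 a] fun _ => linearIsometryEquivTuple (1 : Quaternion ℝ) := by
      filter_upwards [hcut, not_frequently.1 h] with x hx hx'
      rw [fin6, hx, not_not.1 hx']
    have hF : fderiv ℝ (fin6 N) a = 0 := by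
      rw [hev.fderiv_eq]
      exact fderiv_const_apply _
    refine lamNorm_three_le _ 0 (hopf_ne_zero (normSq_qG (pt N a).2)) (fun v => by simp)
      (by positivity) (fun v => ?_) fun v _ => ?_
    · simp only [hF]
      simp
      positivity
    · simp only [hF]
      simp
      positivity

end Twist

end Dilation

/-- For every `ε > 0` there exists a homotopically non-trivial `C¹` map from `S^5` to
`S^3` with `3`-dilation less than `ε`.  (The class of such a map is the non-trivial element of `π₅(S³) ≅ ℤ/2`, a suspension of a class in `π₄(S²)`.)
(`S^5 = usph 6 ⊆ ℝ^6`, `S^3 = usph 4 ⊆ ℝ^4`; a `C¹` map of spheres is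
represented by a `C¹` ambient map sending the unit sphere to the unit sphere.) -/
theorem nontrivial_small_3dilation_S5_S3 :
    ∀ ε : ℝ, 0 < ε →
      ∃ F : EucA 6 → EucA 4,
        ContDiff ℝ 1 F ∧
        MapsTo F (usph 6) (usph 4) ∧
        ¬ SphereNullhomotopic F ∧
        kDilation 3 F < ε := by
  intro ε hε
  obtain ⟨C, hC0, hC⟩ := Twist.exists_kDilation_le
  have hN : 1 ≤ 1 + C / ε := le_add_of_nonneg_right (by positivity)
  refine ⟨Twist.fin6 (1 + C / ε), Quaternion.linearIsometryEquivTuple.contDiff.comp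
    (Twist.contDiff_cut hN), Twist.mapsTo_fin6, Twist.not_sphereNullhomotopic_fin6 hN,
    (hC _ hN).trans_lt ?_⟩
  rw [div_lt_iff₀ (by positivity), mul_add, mul_div_cancel₀ _ hε.ne']
  linarith
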